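/- arXiv:1009.4168 — 8 statements merged into one kernel-verified Lean document; each statement's English description precedes it below -/
import Mathlib

section
/- Let α be the unique positive real number satisfying cosh α = α·sinh α, let (x_m)_{m≥1} be the strictly increasing enumeration of the positive solutions of cos x + x·sin x = 0, define λ₀ = −4α², λ_{2m−1} = (2m−1)²π², λ_{2m} = 4x_m² for m ≥ 1, and set A_p = Σ_{n=0}^∞ 1/λ_n^p for p ≥ 1. Then A_1 = 0 and for every integer n ≥ 1, 4·A_{n+1} + Σ_{k=1}^{n−1} (−1)^k·(2/(2k)! − 1/(2k−1)!)·A_{n−k+1} = (−1)^{n+1}·n/(2n+1)!. -/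
/-- An entire function vanishing on a finite set is divisible by the corresponding polynomial. -/
theorem Differentiable.exists_eq_prod_sub_mul {F : ℂ → ℂ} (hF : Differentiable ℂ F)
    (S : Finset ℂ) (hS : ∀ ρ ∈ S, F ρ = 0) :
    ∃ h : ℂ → ℂ, Differentiable ℂ h ∧ ∀ z, F z = (∏ ρ ∈ S, (z - ρ)) * h z := by
  classical
  induction S using Finset.induction_on with
  | empty => exact ⟨F, hF, by simp⟩
  | insert ρ S hρ ih =>
    obtain ⟨h, hh, hFh⟩ := ih fun x hx => hS x (Finset.mem_insert_of_mem hx)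
    have h0 : h ρ = 0 := by
      have h1 := hFh ρ
      rw [hS ρ (Finset.mem_insert_self _ _), eq_comm, mul_eq_zero, Finset.prod_eq_zero_iff] at h1
      rcases h1 with ⟨x, hx, hx0⟩ | h1
      · rw [sub_eq_zero] at hx0
        exact absurd (hx0 ▸ hx) hρ
      · exact h1
    refine ⟨dslope h ρ, ?_, fun z => ?_⟩
    · rw [← differentiableOn_univ] at hh ⊢
      exact (Complex.differentiableOn_dslope Filter.univ_mem).2 hh
    · have h2 := sub_smul_dslope h ρ z
      rw [h0, sub_zero, smul_eq_mul] at h2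
      rw [hFh z, Finset.prod_insert hρ, ← h2]
      ring

theorem circleIntegral_inv_pow_mul_sub_inv {R : ℝ} {ρ : ℂ} (h0 : ρ ≠ 0) (hρ : ‖ρ‖ < R) (k : ℕ) :
    ∮ z in C(0, R), (z ^ (k + 1))⁻¹ * (z - ρ)⁻¹ = 0 := by
  have hR : 0 < R := (norm_nonneg ρ).trans_lt hρ
  have hz0 : ∀ z ∈ Metric.sphere (0 : ℂ) R, z ≠ 0 := fun z hz h => by
    simp [h] at hz; linarith
  have hzρ : ∀ z ∈ Metric.sphere (0 : ℂ) R, z - ρ ≠ 0 := fun z hz h => by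
    rw [sub_eq_zero] at h
    simp [h] at hz; linarith
  have hc (j : ℕ) : ContinuousOn (fun z : ℂ => (z ^ j)⁻¹) (Metric.sphere (0 : ℂ) R) :=
    (continuousOn_id.pow j).inv₀ fun z hz => pow_ne_zero j (hz0 z hz)
  have hd : ContinuousOn (fun z : ℂ => (z - ρ)⁻¹) (Metric.sphere (0 : ℂ) R) :=
    (continuousOn_id.sub continuousOn_const).inv₀ hzρ
  have key (j : ℕ) : ∮ z in C(0, R), (z ^ (j + 1))⁻¹ * (z - ρ)⁻¹ =
      ρ⁻¹ * ((∮ z in C(0, R), (z ^ j)⁻¹ * (z - ρ)⁻¹) - ∮ z in C(0, R), (z ^ (j + 1))⁻¹) := by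
    rw [← circleIntegral.integral_sub (((hc j).fun_mul hd).circleIntegrable hR.le)
      ((hc (j + 1)).circleIntegrable hR.le), ← smul_eq_mul, ← circleIntegral.integral_smul]
    refine circleIntegral.integral_congr hR.le fun z hz => ?_
    have := hz0 z hz
    have := hzρ z hz
    simp only [smul_eq_mul]
    field_simp
    ring
  induction k with
  | zero =>
    have h1 := circleIntegral.integral_sub_inv_of_mem_ball (c := 0) (w := ρ) (R := R) (by simpa)
    have h2 := circleIntegral.integral_sub_inv_of_mem_ball (c := 0) (w := 0) (R := R) (by simpa)
    simp only [sub_zero] at h2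
    rw [key]
    simp [h1, h2]
  | succ k ih =>
    have h2 := circleIntegral.integral_sub_zpow_of_ne (n := -((k : ℤ) + 2)) (by omega) 0 0 R
    have h3 : ∮ z in C(0, R), (z ^ (k + 1 + 1))⁻¹ = 0 := by
      rw [← h2]
      congr 1
      ext z
      rw [sub_zero, zpow_neg]
      norm_cast
    rw [key, ih, h3]
    simp

/-- If all zeros of an entire function `F` in a disc are simple, then the Taylor coefficients
of `F' / F` at the origin are power sums of these zeros, up to an error controlled by the
size of `F' / F` on the boundary circle. -/
theorem norm_iteratedDeriv_logDeriv_add_sum_le {F : ℂ → ℂ} (hF : Differentiable ℂ F)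
    (hF0 : F 0 ≠ 0) (S : Finset ℂ) {R C : ℝ} (hR : 0 < R)
    (hS : ∀ z, z ∈ S ↔ ‖z‖ ≤ R ∧ F z = 0) (hsimple : ∀ z, F z = 0 → deriv F z ≠ 0)
    (hsphere : ∀ z, ‖z‖ = R → F z ≠ 0 ∧ ‖deriv F z‖ ≤ C * ‖F z‖) (k : ℕ) :
    ‖iteratedDeriv k (logDeriv F) 0 / k.factorial + ∑ ρ ∈ S, (ρ ^ (k + 1))⁻¹‖ ≤ C / R ^ k := by
  obtain ⟨h, hh, hFh⟩ := hF.exists_eq_prod_sub_mul S fun ρ hρ => ((hS ρ).1 hρ).2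
  have hS0 : ∀ ρ ∈ S, ρ ≠ 0 := fun ρ hρ h0 => hF0 (h0 ▸ ((hS ρ).1 hρ).2)
  have hSR : ∀ ρ ∈ S, ‖ρ‖ < R := fun ρ hρ =>
    lt_of_le_of_ne ((hS ρ).1 hρ).1 fun h => (hsphere ρ h).1 ((hS ρ).1 hρ).2
  have hPd : Differentiable ℂ fun z : ℂ => ∏ ρ ∈ S, (z - ρ) := by fun_prop
  have hh0 : ∀ z, ‖z‖ ≤ R → h z ≠ 0 := by
    intro z hz hz0
    have hFz : F z = 0 := by rw [hFh, hz0, mul_zero]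
    have hzS : z ∈ S := (hS z).2 ⟨hz, hFz⟩
    apply hsimple z hFz
    rw [show F = fun z => (∏ ρ ∈ S, (z - ρ)) * h z from funext hFh,
      deriv_fun_mul hPd.differentiableAt hh.differentiableAt, hz0,
      Finset.prod_eq_zero hzS (sub_self z)]
    simp
  have hlog : ∀ z, ‖z‖ ≤ R → F z ≠ 0 →
      logDeriv F z = (∑ ρ ∈ S, (z - ρ)⁻¹) + logDeriv h z := by
    intro z hz hFz
    have hρ : ∀ ρ ∈ S, z - ρ ≠ 0 := fun ρ hρ h0 =>
      hFz ((sub_eq_zero.1 h0) ▸ ((hS ρ).1 hρ).2)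
    rw [show F = fun z => (∏ ρ ∈ S, (z - ρ)) * h z from funext hFh,
      logDeriv_mul z (Finset.prod_ne_zero_iff.2 hρ) (hh0 z hz) hPd.differentiableAt
        hh.differentiableAt, logDeriv_prod hρ fun ρ _ => by fun_prop]
    simp [logDeriv_apply]
  have hhlog : DifferentiableOn ℂ (logDeriv h) (Metric.closedBall 0 R) := fun z hz =>
    ((hh.analyticAt z).deriv.differentiableAt.div hh.differentiableAt
      (hh0 z (by simpa using hz))).differentiableWithinAt
  have hderiv : iteratedDeriv k (logDeriv F) 0 / k.factorial + ∑ ρ ∈ S, (ρ ^ (k + 1))⁻¹ =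
      iteratedDeriv k (logDeriv h) 0 / k.factorial := by
    have hnear : logDeriv F =ᶠ[nhds 0] fun z => (∑ ρ ∈ S, (z - ρ)⁻¹) + logDeriv h z := by
      filter_upwards [Metric.closedBall_mem_nhds (0 : ℂ) hR,
        hF.continuous.continuousAt.eventually_ne hF0] with z hz hFz
      exact hlog z (by simpa using hz) hFz
    have hinv : ∀ ρ ∈ S, ContDiffAt ℂ k (fun z : ℂ => (z - ρ)⁻¹) 0 := fun ρ hρ =>
      (contDiffAt_id.sub contDiffAt_const).inv (by simpa using hS0 ρ hρ)
    have hL : ContDiffAt ℂ k (logDeriv h) 0 :=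
      (((hh.analyticAt 0).deriv).div (hh.analyticAt 0) (hh0 0 (by simpa using hR.le))).contDiffAt
    rw [hnear.iteratedDeriv_eq, iteratedDeriv_fun_add (ContDiffAt.sum hinv) hL,
      iteratedDeriv_fun_sum hinv]
    have hterm : ∀ ρ ∈ S, iteratedDeriv k (fun z : ℂ => (z - ρ)⁻¹) 0 =
        -(k.factorial * (ρ ^ (k + 1))⁻¹) := by
      intro ρ hρ
      have h1 := congrFun (iter_deriv_inv_linear_sub k (1 : ℂ) ρ) 0
      simp only [one_mul, one_pow, zero_sub, mul_one] at h1
      rw [iteratedDeriv_eq_iterate, h1, show (-1 - k : ℤ) = -((k + 1 : ℕ) : ℤ) by push_cast; ring,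
        zpow_neg, zpow_natCast, neg_pow ρ, mul_inv, pow_succ, mul_inv]
      have : ((-1 : ℂ) ^ k) ≠ 0 := by simp
      field_simp
    rw [Finset.sum_congr rfl hterm, Finset.sum_neg_distrib, ← Finset.mul_sum]
    have : (k.factorial : ℂ) ≠ 0 := by exact_mod_cast k.factorial_ne_zero
    field_simp
    ring
  have hz0 : ∀ z ∈ Metric.sphere (0 : ℂ) R, z ≠ 0 := fun z hz h => by
    simp [h] at hz; linarith
  have hsub : ∀ z ∈ Metric.sphere (0 : ℂ) R, ∀ ρ ∈ S, z - ρ ≠ 0 := fun z hz ρ hρ h => by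
    have h1 := hSR ρ hρ
    rw [sub_eq_zero] at h
    simp [h] at hz; linarith
  have hcpow : ContinuousOn (fun z : ℂ => (z ^ (k + 1))⁻¹) (Metric.sphere (0 : ℂ) R) :=
    (continuousOn_id.pow _).inv₀ fun z hz => pow_ne_zero _ (hz0 z hz)
  have hcauchy := hhlog.circleIntegral_one_div_sub_center_pow_smul hR k
  have hsum : ∮ z in C(0, R), (∑ ρ ∈ S, (z ^ (k + 1))⁻¹ * (z - ρ)⁻¹) = 0 := by
    rw [circleIntegral.integral_fun_sum]
    · exact Finset.sum_eq_zero fun ρ hρ =>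
        circleIntegral_inv_pow_mul_sub_inv (hS0 ρ hρ) (hSR ρ hρ) k
    · exact fun ρ hρ => (hcpow.mul ((continuousOn_id.sub continuousOn_const).inv₀
        fun z hz => hsub z hz ρ hρ)).circleIntegrable hR.le
  have hcontour : ∮ z in C(0, R), (z ^ (k + 1))⁻¹ * logDeriv F z =
      (2 * Real.pi * Complex.I / k.factorial) * iteratedDeriv k (logDeriv h) 0 := by
    rw [← smul_eq_mul, ← hcauchy,
      ← zero_add (∮ z in C(0, R), (1 / (z - 0) ^ (k + 1)) • logDeriv h z)]
    nth_rewrite 2 [← hsum]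
    rw [← circleIntegral.integral_add]
    · refine circleIntegral.integral_congr hR.le fun z hz => ?_
      have hzR : ‖z‖ = R := by simpa using hz
      simp only [hlog z hzR.le (hsphere z hzR).1, Finset.mul_sum, mul_add, sub_zero, one_div,
        smul_eq_mul]
    · refine (continuousOn_finsetSum _ fun ρ hρ => hcpow.mul
        ((continuousOn_id.sub continuousOn_const).inv₀
        fun z hz => hsub z hz ρ hρ)).circleIntegrable hR.le
    · simp only [sub_zero, one_div]
      exact (hcpow.smul (hhlog.continuousOn.mono Metric.sphere_subset_closedBall)).circleIntegrable
        hR.le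
  have hbound : ‖∮ z in C(0, R), (z ^ (k + 1))⁻¹ * logDeriv F z‖ ≤
      2 * Real.pi * R * ((R ^ (k + 1))⁻¹ * C) := by
    refine circleIntegral.norm_integral_le_of_norm_le_const hR.le fun z hz => ?_
    have hzR : ‖z‖ = R := by simpa using hz
    obtain ⟨h1, h2⟩ := hsphere z hzR
    rw [norm_mul, norm_inv, norm_pow, hzR, logDeriv_apply, norm_div]
    gcongr
    rwa [div_le_iff₀ (norm_pos_iff.2 h1)]
  rw [hderiv]
  rw [hcontour, div_mul_eq_mul_div, mul_div_assoc, norm_mul] at hbound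
  have h2pi : ‖(2 * Real.pi * Complex.I : ℂ)‖ = 2 * Real.pi := by
    simp [abs_of_pos Real.pi_pos]
  rw [h2pi, mul_assoc (2 * Real.pi)] at hbound
  refine (le_of_mul_le_mul_left hbound Real.two_pi_pos).trans_eq ?_
  field_simp
  ring

theorem Complex.sin_re_eq (z : ℂ) : (Complex.sin z).re = Real.sin z.re * Real.cosh z.im := by
  rw [Complex.sin_eq, ← Complex.ofReal_sin, ← Complex.ofReal_cos, ← Complex.ofReal_sinh,
    ← Complex.ofReal_cosh]
  simp [-Complex.ofReal_sin, -Complex.ofReal_cos, -Complex.ofReal_sinh, -Complex.ofReal_cosh]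

theorem Complex.sin_im_eq (z : ℂ) : (Complex.sin z).im = Real.cos z.re * Real.sinh z.im := by
  rw [Complex.sin_eq, ← Complex.ofReal_sin, ← Complex.ofReal_cos, ← Complex.ofReal_sinh,
    ← Complex.ofReal_cosh]
  simp [-Complex.ofReal_sin, -Complex.ofReal_cos, -Complex.ofReal_sinh, -Complex.ofReal_cosh]

theorem Complex.cos_re_eq (z : ℂ) : (Complex.cos z).re = Real.cos z.re * Real.cosh z.im := by
  rw [Complex.cos_eq, ← Complex.ofReal_sin, ← Complex.ofReal_cos, ← Complex.ofReal_sinh,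
    ← Complex.ofReal_cosh]
  simp [-Complex.ofReal_sin, -Complex.ofReal_cos, -Complex.ofReal_sinh, -Complex.ofReal_cosh]

theorem Complex.cos_im_eq (z : ℂ) : (Complex.cos z).im = -(Real.sin z.re * Real.sinh z.im) := by
  rw [Complex.cos_eq, ← Complex.ofReal_sin, ← Complex.ofReal_cos, ← Complex.ofReal_sinh,
    ← Complex.ofReal_cosh]
  simp [-Complex.ofReal_sin, -Complex.ofReal_cos, -Complex.ofReal_sinh, -Complex.ofReal_cosh]

theorem Complex.sq_norm_sin (z : ℂ) :
    ‖Complex.sin z‖ ^ 2 = Real.sin z.re ^ 2 + Real.sinh z.im ^ 2 := by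
  rw [Complex.sq_norm, Complex.normSq_apply, Complex.sin_re_eq, Complex.sin_im_eq]
  linear_combination Real.sinh z.im ^ 2 * Real.sin_sq_add_cos_sq z.re +
    Real.sin z.re ^ 2 * Real.cosh_sq z.im

theorem Complex.sq_norm_cos (z : ℂ) :
    ‖Complex.cos z‖ ^ 2 = Real.cos z.re ^ 2 + Real.sinh z.im ^ 2 := by
  rw [Complex.sq_norm, Complex.normSq_apply, Complex.cos_re_eq, Complex.cos_im_eq]
  linear_combination Real.sinh z.im ^ 2 * Real.sin_sq_add_cos_sq z.re +
    Real.cos z.re ^ 2 * Real.cosh_sq z.im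

theorem norm_sin_cos_le_of_norm_eq (K : ℕ) {z : ℂ}
    (hz : ‖z‖ = (K + 2) * Real.pi + Real.pi / 4) :
    ‖Complex.cos z‖ ≤ 2 * ‖Complex.sin z‖ ∧ ‖Complex.sin z‖ ≤ 2 * ‖Complex.cos z‖ := by
  suffices h : ‖Complex.cos z‖ ^ 2 ≤ (2 * ‖Complex.sin z‖) ^ 2 ∧
      ‖Complex.sin z‖ ^ 2 ≤ (2 * ‖Complex.cos z‖) ^ 2 from
    ⟨le_of_sq_le_sq h.1 (by positivity), le_of_sq_le_sq h.2 (by positivity)⟩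
  rw [mul_pow, mul_pow, Complex.sq_norm_sin, Complex.sq_norm_cos]
  have h1 := Real.sin_sq_add_cos_sq z.re
  rcases le_or_gt 1 (Real.sinh z.im ^ 2) with hs | hs
  · constructor <;> nlinarith [sq_nonneg (Real.sin z.re), sq_nonneg (Real.cos z.re)]
  · have hK : (0 : ℝ) ≤ K := K.cast_nonneg
    have hpi := Real.pi_gt_three
    have hR : 4 ≤ ‖z‖ := by rw [hz]; nlinarith
    have him : z.im ^ 2 ≤ 1 := by
      rw [← sq_abs] at hs ⊢
      rw [Real.abs_sinh] at hs
      have := Real.self_le_sinh_iff.2 (abs_nonneg z.im)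
      nlinarith [abs_nonneg z.im]
    have hsq : ‖z‖ ^ 2 = |z.re| ^ 2 + z.im ^ 2 := by
      rw [Complex.sq_norm, Complex.normSq_apply, sq_abs]; ring
    set t := ‖z‖ - |z.re| with ht
    have ht0 : 0 ≤ t := sub_nonneg.2 (Complex.abs_re_le_norm z)
    have ht1 : t ≤ 1 / 4 := by nlinarith [abs_nonneg z.re]
    have hcos : Real.cos (2 * z.re) = Real.sin (2 * t) := by
      rw [← Real.cos_abs, abs_mul, abs_two,
        show 2 * |z.re| = (Real.pi / 2 - 2 * t) + (K + 2 : ℕ) * (2 * Real.pi) by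
          push_cast; rw [ht, hz]; ring,
        Real.cos_add_nat_mul_two_pi, Real.cos_pi_div_two_sub]
    have hsin : |Real.sin (2 * t)| ≤ 1 / 2 :=
      Real.abs_sin_le_abs.trans (by rw [abs_of_nonneg (by positivity)]; linarith)
    rw [← hcos, Real.cos_two_mul, abs_le] at hsin
    constructor <;> nlinarith [sq_nonneg (Real.sinh z.im)]

/-- The entire function whose zeros are the numbers `ρ` such that `4 * ρ ^ 2` is an eigenvalue. -/
noncomputable def charFun (z : ℂ) : ℂ := Complex.cos z * (Complex.cos z + z * Complex.sin z)

theorem hasDerivAt_charFun (z : ℂ) : HasDerivAt charFun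
    (-Complex.sin z * (Complex.cos z + z * Complex.sin z) +
      Complex.cos z * (z * Complex.cos z)) z := by
  have h := (Complex.hasDerivAt_cos z).mul
    ((Complex.hasDerivAt_cos z).add ((hasDerivAt_id z).mul (Complex.hasDerivAt_sin z)))
  refine HasDerivAt.congr_deriv h ?_
  simp only [id_eq, one_mul, Pi.add_apply, Pi.mul_apply]
  ring

theorem differentiable_charFun : Differentiable ℂ charFun := fun z =>
  (hasDerivAt_charFun z).differentiableAt

theorem charFun_zero : charFun 0 = 1 := by simp [charFun]

theorem deriv_charFun_ne_zero {z : ℂ} (hz : charFun z = 0) : deriv charFun z ≠ 0 := by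
  rw [(hasDerivAt_charFun z).deriv]
  have h1 := Complex.sin_sq_add_cos_sq z
  have hz0 : z ≠ 0 := by
    rintro rfl
    simp [charFun_zero] at hz
  rw [charFun, mul_eq_zero] at hz
  intro h
  rcases hz with hc | hg
  · rw [hc] at h h1
    have hs : Complex.sin z ≠ 0 := by
      intro hs
      simp [hs] at h1
    simp [hs, hz0] at h
  · rw [hg] at h
    have hc : Complex.cos z ≠ 0 := by
      intro hc
      have hs : Complex.sin z = 0 := by simpa [hc, hz0] using hg
      simp [hc, hs] at h1
    simp [hc, hz0] at h

theorem charFun_ne_zero_and_norm_deriv_le (K : ℕ) {z : ℂ}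
    (hz : ‖z‖ = (K + 2) * Real.pi + Real.pi / 4) :
    charFun z ≠ 0 ∧ ‖deriv charFun z‖ ≤ 6 * ‖charFun z‖ := by
  obtain ⟨h1, h2⟩ := norm_sin_cos_le_of_norm_eq K hz
  have hpi := Real.pi_gt_three
  have hK : (0 : ℝ) ≤ K := K.cast_nonneg
  have hR : 4 ≤ ‖z‖ := by rw [hz]; nlinarith
  have hsin : 0 < ‖Complex.sin z‖ := by
    refine (norm_nonneg _).lt_of_ne' fun h => ?_
    rw [h] at h1
    have h0 := Complex.sin_sq_add_cos_sq z
    have hc : Complex.cos z = 0 := by simpa using h1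
    simp [norm_eq_zero.1 h, hc] at h0
  have hcos : 0 < ‖Complex.cos z‖ := by linarith
  have hg : (‖z‖ - 2) * ‖Complex.sin z‖ ≤ ‖Complex.cos z + z * Complex.sin z‖ := by
    have h3 := norm_sub_le (Complex.cos z + z * Complex.sin z) (Complex.cos z)
    rw [add_sub_cancel_left, norm_mul] at h3
    linarith
  have hg0 : 0 < ‖Complex.cos z + z * Complex.sin z‖ :=
    (mul_pos (by linarith) hsin).trans_le hg
  refine ⟨mul_ne_zero (norm_pos_iff.1 hcos) (norm_pos_iff.1 hg0), ?_⟩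
  rw [(hasDerivAt_charFun z).deriv, charFun]
  refine (norm_add_le _ _).trans ?_
  simp only [norm_mul, norm_neg]
  have h4 : ‖z‖ * ‖Complex.cos z‖ ≤ 4 * ‖Complex.cos z + z * Complex.sin z‖ := by
    nlinarith
  nlinarith

theorem finite_charFun_zeros (R : ℝ) : {z : ℂ | ‖z‖ ≤ R ∧ charFun z = 0}.Finite := by
  by_contra hinf
  obtain ⟨x, -, hx⟩ := Set.Infinite.exists_accPt_of_subset_isCompact hinf
    (isCompact_closedBall (0 : ℂ) R) fun z hz => by simpa using hz.1
  have h := AnalyticOnNhd.eqOn_zero_of_preconnected_of_frequently_eq_zero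
    (fun z _ => differentiable_charFun.analyticAt z) isPreconnected_univ (Set.mem_univ x)
    ((accPt_iff_frequently_nhdsNE.1 hx).mono fun z hz => hz.2) (Set.mem_univ 0)
  simp [charFun_zero] at h

theorem deriv_charFun_eq :
    deriv charFun = fun z => (0 - 1 / 2) * Complex.sin (2 * z) + z * Complex.cos (2 * z) := by
  ext z
  rw [(hasDerivAt_charFun z).deriv, Complex.sin_two_mul, Complex.cos_two_mul]
  linear_combination (- z) * Complex.sin_sq_add_cos_sq z

theorem hasDerivAt_mul_sin_add_mul_cos (c z : ℂ) :
    HasDerivAt (fun z => c * Complex.sin (2 * z) + z * Complex.cos (2 * z))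
      ((2 * c + 1) * Complex.cos (2 * z) - 2 * z * Complex.sin (2 * z)) z := by
  have h2 : HasDerivAt (fun z : ℂ => 2 * z) 2 z := by
    simpa using (hasDerivAt_id z).const_mul (2 : ℂ)
  have h := (((Complex.hasDerivAt_sin _).comp z h2).const_mul c).add
    ((hasDerivAt_id z).mul ((Complex.hasDerivAt_cos _).comp z h2))
  refine HasDerivAt.congr_deriv h ?_
  simp only [Function.comp_apply, id_eq, one_mul]
  ring

theorem hasDerivAt_mul_cos_sub_mul_sin (c z : ℂ) :
    HasDerivAt (fun z => (2 * c + 1) * Complex.cos (2 * z) - 2 * z * Complex.sin (2 * z))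
      (-4 * ((c + 1) * Complex.sin (2 * z) + z * Complex.cos (2 * z))) z := by
  have h2 : HasDerivAt (fun z : ℂ => 2 * z) 2 z := by
    simpa using (hasDerivAt_id z).const_mul (2 : ℂ)
  have h := (((Complex.hasDerivAt_cos _).comp z h2).const_mul (2 * c + 1)).sub
    (h2.mul ((Complex.hasDerivAt_sin _).comp z h2))
  refine HasDerivAt.congr_deriv h ?_
  simp only [Function.comp_apply]
  ring

theorem iteratedDeriv_charFun_odd (n : ℕ) : iteratedDeriv (2 * n + 1) charFun = fun z =>
    (-4) ^ n * ((n - 1 / 2) * Complex.sin (2 * z) + z * Complex.cos (2 * z)) := by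
  induction n with
  | zero => simp [iteratedDeriv_one, deriv_charFun_eq]
  | succ n ih =>
    rw [show 2 * (n + 1) + 1 = 2 * n + 1 + 1 + 1 by ring, iteratedDeriv_succ, iteratedDeriv_succ,
      ih]
    have h1 : deriv (fun z : ℂ =>
        (-4) ^ n * ((n - 1 / 2) * Complex.sin (2 * z) + z * Complex.cos (2 * z))) = fun z =>
        (-4) ^ n * ((2 * (n - 1 / 2) + 1) * Complex.cos (2 * z) -
          2 * z * Complex.sin (2 * z)) :=
      funext fun z => ((hasDerivAt_mul_sin_add_mul_cos _ z).const_mul _).deriv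
    rw [h1]
    ext z
    rw [((hasDerivAt_mul_cos_sub_mul_sin _ z).const_mul _).deriv]
    push_cast
    ring

theorem iteratedDeriv_charFun_odd_zero (n : ℕ) : iteratedDeriv (2 * n + 1) charFun 0 = 0 := by
  simp [iteratedDeriv_charFun_odd]

theorem iteratedDeriv_charFun_even_zero (n : ℕ) :
    iteratedDeriv (2 * n + 2) charFun 0 = (-4) ^ n * (2 * n) := by
  rw [iteratedDeriv_succ, iteratedDeriv_charFun_odd,
    ((hasDerivAt_mul_sin_add_mul_cos _ 0).const_mul _).deriv]
  simp
  ring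

/-- The zeros of `cos z + z * sin z` are real or purely imaginary. -/
theorem re_eq_zero_or_im_eq_zero_of_cos_add_mul_sin {z : ℂ}
    (hz : Complex.cos z + z * Complex.sin z = 0) : z.re = 0 ∨ z.im = 0 := by
  by_contra! h
  obtain ⟨ha, hb⟩ := h
  have h1 := congrArg Complex.re hz
  have h2 := congrArg Complex.im hz
  simp only [Complex.add_re, Complex.add_im, Complex.mul_re, Complex.mul_im, Complex.sin_re_eq,
    Complex.sin_im_eq, Complex.cos_re_eq, Complex.cos_im_eq, Complex.zero_re, Complex.zero_im]
    at h1 h2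
  set a := z.re
  set b := z.im
  have e1 := Real.sin_sq_add_cos_sq a
  have e2 := Real.cosh_sq b
  set D := Real.sin a ^ 2 + Real.sinh b ^ 2 with hD
  have hsb : Real.sinh b ≠ 0 := Real.sinh_ne_zero.2 hb
  have hDpos : 0 < D := by positivity
  have k1 : Real.sin (2 * a) = -(2 * a) * D := by
    rw [Real.sin_two_mul, hD]
    linear_combination 2 * Real.sin a * Real.cosh b * h1 + 2 * Real.cos a * Real.sinh b * h2 -
      2 * (Real.sin a * Real.cos a + a * Real.sin a ^ 2) * e2 - 2 * a * Real.sinh b ^ 2 * e1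
  have k2 : Real.sinh (2 * b) = 2 * b * D := by
    rw [Real.sinh_two_mul, hD]
    linear_combination 2 * Real.cos a * Real.sinh b * h1 - 2 * Real.sin a * Real.cosh b * h2 -
      2 * (Real.sinh b * Real.cosh b - b * Real.sinh b ^ 2) * e1 + 2 * b * Real.sin a ^ 2 * e2
  have l1 : |Real.sin (2 * a)| < |2 * a| := Real.abs_sin_lt_abs (by positivity)
  have l2 : |2 * b| < |Real.sinh (2 * b)| := by
    rw [Real.abs_sinh]
    exact Real.self_lt_sinh_iff.2 (by positivity)
  rw [k1, abs_mul, abs_neg, abs_of_pos hDpos] at l1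
  rw [k2, abs_mul _ D, abs_of_pos hDpos] at l2
  have : 0 < |2 * a| := by positivity
  have : 0 < |2 * b| := by positivity
  nlinarith

theorem charFun_neg (z : ℂ) : charFun (-z) = charFun z := by simp [charFun]

/-- Power sums of reciprocals of a sequence enumerating the values `4 * z ^ 2` at the zeros `z`
of `charFun`. -/
theorem iteratedDeriv_logDeriv_charFun {lam : ℕ → ℝ}
    (hinj : Function.Injective lam) (hpos : ∀ n, n ≠ 0 → 0 < lam n)
    (hzero : ∀ z : ℂ, charFun z = 0 ↔ ∃ n, 4 * z ^ 2 = (lam n : ℂ)) (q : ℕ) :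
    iteratedDeriv (2 * q + 1) (logDeriv charFun) 0 =
      -((2 * q + 1).factorial * (2 * 4 ^ (q + 1)) *
        ((∑' n, 1 / lam n ^ (q + 1) : ℝ) : ℂ)) := by
  classical
  have hroot (n : ℕ) : ∃ z : ℂ, 4 * z ^ 2 = (lam n : ℂ) := by
    obtain ⟨z, hz⟩ := IsAlgClosed.exists_pow_nat_eq ((lam n : ℂ) / 4) two_pos
    exact ⟨z, by rw [hz]; ring⟩
  choose r hr using hroot
  have hr0 (n : ℕ) : charFun (r n) = 0 := (hzero _).2 ⟨n, hr n⟩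
  have hrne (n : ℕ) : r n ≠ 0 := fun h => by
    have := hr0 n
    simp [h, charFun_zero] at this
  have hrsq {m n : ℕ} (h : r m ^ 2 = r n ^ 2) : m = n := by
    apply hinj
    have := hr m
    rw [h, hr n] at this
    exact_mod_cast this.symm
  have hrinj : Function.Injective r := fun m n h => hrsq (by rw [h])
  set R : ℕ → ℝ := fun N => (N + 2) * Real.pi + Real.pi / 4 with hR
  have hRpos (N : ℕ) : 0 < R N := by have := Real.pi_pos; positivity
  have hRmono : Monotone R := fun M N h => by
    have := Real.pi_pos
    simp only [hR]
    gcongr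
  have hRtop : Filter.Tendsto R Filter.atTop Filter.atTop :=
    Filter.tendsto_atTop_add_const_right _ _ ((Filter.tendsto_atTop_add_const_right _ _
      tendsto_natCast_atTop_atTop).atTop_mul_const Real.pi_pos)
  set S : ℕ → Finset ℂ := fun N => (finite_charFun_zeros (R N)).toFinset with hS
  have hSmem (N : ℕ) (z : ℂ) : z ∈ S N ↔ ‖z‖ ≤ R N ∧ charFun z = 0 := by simp [hS]
  set T : ℕ → Finset ℕ := fun N => (S N).preimage r hrinj.injOn with hT
  have hTmem (N n : ℕ) : n ∈ T N ↔ ‖r n‖ ≤ R N := by simp [hT, hSmem, hr0]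
  have hTtop : Filter.Tendsto T Filter.atTop Filter.atTop := by
    refine Filter.tendsto_atTop_finset_of_monotone (fun M N h n hn => ?_) fun n => ?_
    · exact (hTmem N n).2 (((hTmem M n).1 hn).trans (hRmono h))
    · obtain ⟨N, hN⟩ := (hRtop.eventually_ge_atTop ‖r n‖).exists
      exact ⟨N, (hTmem N n).2 hN⟩
  set f : ℕ → ℝ := fun n => 1 / lam n ^ (q + 1) with hf
  have hrf (n : ℕ) : (r n ^ (2 * q + 1 + 1))⁻¹ = 4 ^ (q + 1) * (f n : ℂ) := by
    have h1 : (lam n : ℂ) ≠ 0 := by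
      rw [← hr n]
      exact mul_ne_zero (by norm_num) (pow_ne_zero 2 (hrne n))
    simp only [hf]
    push_cast
    rw [← hr n, show 2 * q + 1 + 1 = 2 * (q + 1) by ring, mul_pow, pow_mul]
    have := hrne n
    field_simp
  have hsum (N : ℕ) : ∑ ρ ∈ S N, (ρ ^ (2 * q + 1 + 1))⁻¹ =
      2 * 4 ^ (q + 1) * ((∑ n ∈ T N, f n : ℝ) : ℂ) := by
    have hunion : S N = (T N).image r ∪ (T N).image fun n => -r n := by
      ext z
      simp only [Finset.mem_union, Finset.mem_image, hTmem, hSmem]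
      constructor
      · rintro ⟨hz, hz0⟩
        obtain ⟨n, hn⟩ := (hzero z).1 hz0
        rw [← hr n] at hn
        rcases sq_eq_sq_iff_eq_or_eq_neg.1 (mul_left_cancel₀ (by norm_num) hn) with h | h
        · exact Or.inl ⟨n, h ▸ hz, h.symm⟩
        · exact Or.inr ⟨n, by simpa [h] using hz, h.symm⟩
      · rintro (⟨n, hn, rfl⟩ | ⟨n, hn, rfl⟩)
        · exact ⟨hn, hr0 n⟩
        · exact ⟨by rwa [norm_neg], by rw [charFun_neg, hr0]⟩
    have hdisj : Disjoint ((T N).image r) ((T N).image fun n => -r n) := by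
      rw [Finset.disjoint_left]
      intro z hz hz'
      obtain ⟨m, -, rfl⟩ := Finset.mem_image.1 hz
      obtain ⟨n, -, hn⟩ := Finset.mem_image.1 hz'
      obtain rfl : n = m := hrsq (by rw [← hn, neg_sq])
      exact hrne n (self_eq_neg.1 hn.symm)
    rw [hunion, Finset.sum_union hdisj, Finset.sum_image hrinj.injOn,
      Finset.sum_image fun m _ n _ h => hrinj (neg_injective h)]
    have heven : Even (2 * q + 1 + 1) := ⟨q + 1, by ring⟩
    simp only [heven.neg_pow, hrf, ← Finset.mul_sum]
    push_cast
    ring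
  set c : ℂ := iteratedDeriv (2 * q + 1) (logDeriv charFun) 0 / (2 * q + 1).factorial with hc
  have hlim : Filter.Tendsto (fun N => c + 2 * 4 ^ (q + 1) * ((∑ n ∈ T N, f n : ℝ) : ℂ))
      Filter.atTop (nhds 0) := by
    refine squeeze_zero_norm (fun N => ?_) ((((Filter.tendsto_pow_atTop
      (Nat.succ_ne_zero (2 * q))).comp hRtop).const_div_atTop (6 : ℝ)))
    rw [← hsum]
    exact norm_iteratedDeriv_logDeriv_add_sum_le differentiable_charFun (by simp [charFun_zero])
      (S N) (hRpos N) (hSmem N) (fun z => deriv_charFun_ne_zero)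
      (fun z hz => charFun_ne_zero_and_norm_deriv_le N hz) _
  have h4 : (2 * 4 ^ (q + 1) : ℂ) ≠ 0 := by simp
  have hlim' : Filter.Tendsto (fun N => ((∑ n ∈ T N, f n : ℝ) : ℂ)) Filter.atTop
      (nhds (-c / (2 * 4 ^ (q + 1)))) := by
    have := (hlim.sub_const c).div_const (2 * 4 ^ (q + 1) : ℂ)
    simpa [h4] using this
  have hre := (Complex.continuous_re.tendsto _).comp hlim'
  simp only [Function.comp_def, Complex.ofReal_re] at hre
  have hsummable : Summable f := by
    obtain ⟨B, hB⟩ := hre.bddAbove_range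
    refine Summable.of_norm (summable_of_sum_le (c := B + 2 * |f 0|) (fun n => norm_nonneg _)
      fun u => ?_)
    obtain ⟨N, hN⟩ := (hTtop.eventually_ge_atTop u).exists
    calc ∑ n ∈ u, ‖f n‖ ≤ ∑ n ∈ T N, ‖f n‖ :=
          Finset.sum_le_sum_of_subset_of_nonneg hN fun _ _ _ => norm_nonneg _
      _ ≤ ∑ n ∈ T N, (f n + if n = 0 then 2 * |f 0| else 0) := by
          refine Finset.sum_le_sum fun n _ => ?_
          rw [Real.norm_eq_abs]
          split_ifs with h
          · rw [h]; linarith [neg_abs_le (f 0)]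
          · have := hpos n h
            rw [abs_of_nonneg (by positivity), add_zero]
      _ ≤ B + 2 * |f 0| := by
          rw [Finset.sum_add_distrib, Finset.sum_ite_eq']
          have := hB ⟨N, rfl⟩
          simp only at this
          split_ifs
          · linarith
          · linarith [abs_nonneg (f 0)]
  have htsum := tendsto_nhds_unique
    ((Complex.continuous_ofReal.tendsto _).comp (hsummable.hasSum.comp hTtop)) hlim'
  have hfac : ((2 * q + 1).factorial : ℂ) ≠ 0 := by exact_mod_cast Nat.factorial_ne_zero _
  rw [htsum, hc]
  field_simp

theorem Finset.sum_range_two_mul {M : Type*} [AddCommMonoid M] (g : ℕ → M) (m : ℕ) :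
    ∑ i ∈ Finset.range (2 * m), g i = ∑ j ∈ Finset.range m, (g (2 * j) + g (2 * j + 1)) := by
  induction m with
  | zero => simp
  | succ m ih =>
    rw [show 2 * (m + 1) = 2 * m + 1 + 1 by ring, Finset.sum_range_succ, Finset.sum_range_succ, ih,
      Finset.sum_range_succ, add_assoc]

theorem euler_rayleigh_of_iteratedDeriv {a : ℕ → ℂ}
    (ha : ∀ q : ℕ, iteratedDeriv (2 * q + 1) (logDeriv charFun) 0 =
      -((2 * q + 1).factorial * (2 * 4 ^ (q + 1)) * a (q + 1))) (n : ℕ) :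
    4 * a (n + 1) + ∑ j ∈ Finset.range n, (-1) ^ j * (2 * j / (2 * j + 2).factorial) * a (n - j) =
      (-1) ^ (n + 1) * n / (2 * n + 1).factorial := by
  have hF0 : charFun 0 ≠ 0 := by simp [charFun_zero]
  have hnear : deriv charFun =ᶠ[nhds 0] fun z => charFun z * logDeriv charFun z := by
    filter_upwards [differentiable_charFun.continuous.continuousAt.eventually_ne hF0] with z hz
    rw [logDeriv_apply]
    field_simp
  have hA := differentiable_charFun.analyticAt 0
  have hleib : iteratedDeriv (2 * n + 2) charFun 0 = ∑ i ∈ Finset.range (2 * (n + 1)),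
      ((2 * n + 1).choose i : ℂ) * iteratedDeriv i charFun 0 *
        iteratedDeriv (2 * n + 1 - i) (logDeriv charFun) 0 := by
    have hL : AnalyticAt ℂ (logDeriv charFun) 0 := hA.deriv.div hA hF0
    rw [iteratedDeriv_succ', hnear.iteratedDeriv_eq,
      iteratedDeriv_fun_mul hA.contDiffAt hL.contDiffAt]
    rfl
  rw [Finset.sum_range_two_mul, Finset.sum_range_succ', iteratedDeriv_charFun_even_zero] at hleib
  have hone : iteratedDeriv (0 + 1) charFun 0 = 0 := iteratedDeriv_charFun_odd_zero 0
  simp only [iteratedDeriv_charFun_odd_zero, hone, mul_zero, zero_mul, add_zero, iteratedDeriv_zero,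
    charFun_zero, Nat.choose_zero_right, Nat.cast_one, one_mul, Nat.sub_zero, ha] at hleib
  have hterm : ∀ j ∈ Finset.range n, ((2 * n + 1).choose (2 * (j + 1)) : ℂ) *
      iteratedDeriv (2 * (j + 1)) charFun 0 *
        iteratedDeriv (2 * n + 1 - 2 * (j + 1)) (logDeriv charFun) 0 =
      -((2 * n + 1).factorial * (2 * 4 ^ n)) *
        ((-1) ^ j * (2 * j / (2 * j + 2).factorial) * a (n - j)) := by
    intro j hj
    obtain ⟨m, rfl⟩ := Nat.exists_eq_add_of_lt (Finset.mem_range.1 hj)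
    rw [show 2 * (j + m + 1) + 1 - 2 * (j + 1) = 2 * m + 1 by omega, ha,
      show 2 * (j + 1) = 2 * j + 2 by ring, iteratedDeriv_charFun_even_zero,
      show j + m + 1 - j = m + 1 by omega]
    have hch' : (((2 * (j + m + 1) + 1).choose (2 * j + 2) : ℕ) : ℂ) * (2 * m + 1).factorial *
        (2 * j + 2).factorial = (2 * (j + m + 1) + 1).factorial := by
      rw [← Nat.choose_mul_factorial_mul_factorial (show 2 * j + 2 ≤ 2 * (j + m + 1) + 1 by omega),
        show 2 * (j + m + 1) + 1 - (2 * j + 2) = 2 * m + 1 by omega]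
      push_cast
      ring
    rw [← hch', neg_pow (4 : ℂ)]
    have : ((2 * j + 2).factorial : ℂ) ≠ 0 := by exact_mod_cast Nat.factorial_ne_zero _
    field_simp
    ring
  rw [Finset.sum_congr rfl hterm, ← Finset.mul_sum, neg_pow (4 : ℂ)] at hleib
  have hfac : ((2 * n + 1).factorial : ℂ) ≠ 0 := by exact_mod_cast Nat.factorial_ne_zero _
  have h4 : (2 * 4 ^ n : ℂ) ≠ 0 := by simp
  rw [eq_div_iff hfac]
  apply mul_left_cancel₀ h4
  linear_combination hleib

theorem eq_of_cosh_eq_mul_sinh {s t : ℝ} (hs : 0 < s) (ht : 0 < t)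
    (hs' : Real.cosh s = s * Real.sinh s) (ht' : Real.cosh t = t * Real.sinh t) : s = t := by
  by_contra hne
  wlog hlt : s < t generalizing s t
  · exact this ht hs ht' hs' (Ne.symm hne) (lt_of_le_of_ne (not_lt.1 hlt) (Ne.symm hne))
  have h1 : Real.sinh (t - s) = (s - t) * (Real.sinh s * Real.sinh t) := by
    rw [Real.sinh_sub, hs', ht']
    ring
  have h2 : 0 < Real.sinh (t - s) := Real.sinh_pos_iff.2 (sub_pos.2 hlt)
  have h3 : 0 < Real.sinh s * Real.sinh t :=
    mul_pos (Real.sinh_pos_iff.2 hs) (Real.sinh_pos_iff.2 ht)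
  nlinarith

theorem Nat.eq_zero_or_odd_or_even_succ (n : ℕ) :
    n = 0 ∨ (∃ m, n = 2 * m + 1) ∨ ∃ m, n = 2 * m + 2 := by
  rcases Nat.even_or_odd' n with ⟨k, rfl | rfl⟩
  · rcases k with _ | k
    · simp
    · exact Or.inr (Or.inr ⟨k, by ring⟩)
  · exact Or.inr (Or.inl ⟨k, rfl⟩)

section Eigenvalues

variable {α : ℝ} {X lam : ℕ → ℝ}

theorem eigenvalue_injective (hα_pos : 0 < α) (hX_mono : StrictMono X) (hX_pos : ∀ m, 0 < X m)
    (hX_root : ∀ m, Real.cos (X m) + X m * Real.sin (X m) = 0)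
    (hlam0 : lam 0 = -4 * α ^ 2)
    (hlam_odd : ∀ m : ℕ, lam (2 * m + 1) = (2 * (m : ℝ) + 1) ^ 2 * Real.pi ^ 2)
    (hlam_even : ∀ m : ℕ, lam (2 * m + 2) = 4 * (X m) ^ 2) : Function.Injective lam := by
  have hpi := Real.pi_pos
  have h0 : lam 0 < 0 := by rw [hlam0]; nlinarith [sq_pos_of_pos hα_pos]
  have hodd (m : ℕ) : 0 < lam (2 * m + 1) := by rw [hlam_odd]; positivity
  have heven (m : ℕ) : 0 < lam (2 * m + 2) := by
    have := hX_pos m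
    rw [hlam_even]; positivity
  have hne (m k : ℕ) : lam (2 * m + 1) ≠ lam (2 * k + 2) := by
    rw [hlam_odd, hlam_even]
    intro h
    have hX : X k = (2 * (m : ℝ) + 1) * Real.pi / 2 := by
      refine (sq_eq_sq₀ (hX_pos k).le (by positivity)).1 ?_
      linear_combination -h / 4
    have hcos : Real.cos (X k) = 0 := Real.cos_eq_zero_iff.2 ⟨m, by rw [hX]; push_cast; ring⟩
    have hsin : Real.sin (X k) = 0 := by
      simpa [hcos, (hX_pos k).ne'] using hX_root k
    have := Real.sin_sq_add_cos_sq (X k)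
    simp [hcos, hsin] at this
  intro a b hab
  rcases a.eq_zero_or_odd_or_even_succ with rfl | ⟨m, rfl⟩ | ⟨m, rfl⟩ <;>
    rcases b.eq_zero_or_odd_or_even_succ with rfl | ⟨k, rfl⟩ | ⟨k, rfl⟩
  · rfl
  · linarith [hodd k]
  · linarith [heven k]
  · linarith [hodd m]
  · rw [hlam_odd, hlam_odd] at hab
    have h1 := mul_right_cancel₀ (by positivity) hab
    have h2 := (sq_eq_sq₀ (by positivity) (by positivity)).1 h1
    have h3 : (m : ℝ) = k := by linarith
    rw [Nat.cast_injective h3]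
  · exact absurd hab (hne m k)
  · linarith [heven m]
  · exact absurd hab.symm (hne k m)
  · rw [hlam_even, hlam_even] at hab
    have h1 := mul_left_cancel₀ (by norm_num) hab
    have h2 := (sq_eq_sq₀ (hX_pos m).le (hX_pos k).le).1 h1
    rw [hX_mono.injective h2]

theorem charFun_eq_zero_iff (hα_pos : 0 < α) (hα_eq : Real.cosh α = α * Real.sinh α)
    (hX_root : ∀ m, Real.cos (X m) + X m * Real.sin (X m) = 0)
    (hX_all : ∀ t : ℝ, 0 < t → Real.cos t + t * Real.sin t = 0 → ∃ m, X m = t)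
    (hlam0 : lam 0 = -4 * α ^ 2)
    (hlam_odd : ∀ m : ℕ, lam (2 * m + 1) = (2 * (m : ℝ) + 1) ^ 2 * Real.pi ^ 2)
    (hlam_even : ∀ m : ℕ, lam (2 * m + 2) = 4 * (X m) ^ 2) (z : ℂ) :
    charFun z = 0 ↔ ∃ n, 4 * z ^ 2 = (lam n : ℂ) := by
  constructor
  · intro hz
    rcases mul_eq_zero.1 hz with hc | hg
    · obtain ⟨k, rfl⟩ := Complex.cos_eq_zero_iff.1 hc
      rcases Int.eq_nat_or_neg k with ⟨m, rfl | rfl⟩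
      · refine ⟨2 * m + 1, ?_⟩
        rw [hlam_odd]
        push_cast
        ring
      · rcases m with _ | m
        · refine ⟨2 * 0 + 1, ?_⟩
          rw [hlam_odd]
          push_cast
          ring
        · refine ⟨2 * m + 1, ?_⟩
          rw [hlam_odd]
          push_cast
          ring
    · rcases re_eq_zero_or_im_eq_zero_of_cos_add_mul_sin hg with h | h
      · obtain ⟨b, rfl⟩ : ∃ b : ℝ, z = b * Complex.I := ⟨z.im, by apply Complex.ext <;> simp [h]⟩
        have hb : Real.cosh b = b * Real.sinh b := by
          rw [Complex.cos_mul_I, Complex.sin_mul_I] at hg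
          have h2 : (Complex.cosh b : ℂ) = b * Complex.sinh b := by
            linear_combination hg - b * Complex.sinh b * Complex.I_mul_I
          exact_mod_cast h2
        have hb0 : b ≠ 0 := by
          rintro rfl
          simp at hb
        have habs : Real.cosh |b| = |b| * Real.sinh |b| := by
          rw [Real.cosh_abs, hb, ← Real.abs_sinh, ← abs_mul, abs_of_nonneg]
          rw [← hb]
          exact (Real.cosh_pos b).le
        have hbα := eq_of_cosh_eq_mul_sinh (abs_pos.2 hb0) hα_pos habs hα_eq
        refine ⟨0, ?_⟩
        rw [hlam0, ← hbα, sq_abs, mul_pow, Complex.I_sq]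
        push_cast
        ring
      · obtain ⟨x, rfl⟩ : ∃ x : ℝ, z = x := ⟨z.re, by apply Complex.ext <;> simp [h]⟩
        have hx : Real.cos x + x * Real.sin x = 0 := by exact_mod_cast hg
        have hx0 : x ≠ 0 := by
          rintro rfl
          simp at hx
        have habs : Real.cos |x| + |x| * Real.sin |x| = 0 := by
          rcases abs_choice x with h | h <;> rw [h]
          · exact hx
          · simpa using hx
        obtain ⟨m, hm⟩ := hX_all |x| (abs_pos.2 hx0) habs
        refine ⟨2 * m + 2, ?_⟩
        rw [hlam_even, hm, sq_abs]
        push_cast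
        ring
  · rintro ⟨n, hn⟩
    have hsq {w : ℂ} (hw : charFun w = 0) (h : 4 * z ^ 2 = 4 * w ^ 2) : charFun z = 0 := by
      rcases sq_eq_sq_iff_eq_or_eq_neg.1 (mul_left_cancel₀ (by norm_num) h) with rfl | rfl
      · exact hw
      · rwa [charFun_neg]
    rcases n.eq_zero_or_odd_or_even_succ with rfl | ⟨m, rfl⟩ | ⟨m, rfl⟩
    · refine hsq (w := α * Complex.I) ?_ ?_
      · have hα' : Complex.cosh α = α * Complex.sinh α := by exact_mod_cast hα_eq
        rw [charFun, Complex.cos_mul_I, Complex.sin_mul_I]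
        linear_combination Complex.cosh α * hα' +
          Complex.cosh α * α * Complex.sinh α * Complex.I_mul_I
      · rw [hn, hlam0, mul_pow, Complex.I_sq]
        push_cast
        ring
    · refine hsq (w := (2 * (m : ℤ) + 1) * Real.pi / 2) ?_ ?_
      · exact mul_eq_zero_of_left (Complex.cos_eq_zero_iff.2 ⟨m, rfl⟩) _
      · rw [hn, hlam_odd]
        push_cast
        ring
    · refine hsq (w := X m) ?_ ?_
      · exact mul_eq_zero_of_right _ (by exact_mod_cast hX_root m)
      · rw [hn, hlam_even]
        push_cast
        ring

end Eigenvalues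

/-- Euler–Rayleigh recursion for the eigenvalue power sums
`A p = ∑_n 1/λ_n^p`: `A 1 = 0` and for every `n ≥ 1`,
`4 A_{n+1} + ∑_{k=1}^{n-1} (-1)^k (2/(2k)! - 1/(2k-1)!) A_{n-k+1}
  = (-1)^{n+1} n / (2n+1)!`.
Here `lam 0 = -4α²`, `lam (2m+1) = (2m+1)²π²`, `lam (2m+2) = 4 X m ²`. -/
theorem euler_rayleigh_recursion_for_A
    (α : ℝ) (hα_pos : 0 < α) (hα_eq : Real.cosh α = α * Real.sinh α)
    (X : ℕ → ℝ) (hX_mono : StrictMono X) (hX_pos : ∀ m, 0 < X m)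
    (hX_root : ∀ m, Real.cos (X m) + X m * Real.sin (X m) = 0)
    (hX_all : ∀ t : ℝ, 0 < t → Real.cos t + t * Real.sin t = 0 → ∃ m, X m = t)
    (lam : ℕ → ℝ) (hlam0 : lam 0 = -4 * α ^ 2)
    (hlam_odd : ∀ m : ℕ, lam (2 * m + 1) = (2 * (m : ℝ) + 1) ^ 2 * Real.pi ^ 2)
    (hlam_even : ∀ m : ℕ, lam (2 * m + 2) = 4 * (X m) ^ 2)
    (A : ℕ → ℝ) (hA : ∀ p : ℕ, A p = ∑' n : ℕ, 1 / (lam n) ^ p) :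
    A 1 = 0 ∧
    ∀ n : ℕ, 1 ≤ n →
      4 * A (n + 1) +
        ∑ k ∈ Finset.Icc 1 (n - 1),
          (-1 : ℝ) ^ k * (2 / (Nat.factorial (2 * k)) - 1 / (Nat.factorial (2 * k - 1))) *
            A (n - k + 1) =
        (-1) ^ (n + 1) * n / (Nat.factorial (2 * n + 1)) := by
  have hpos : ∀ n, n ≠ 0 → 0 < lam n := by
    intro n hn
    rcases n.eq_zero_or_odd_or_even_succ with rfl | ⟨m, rfl⟩ | ⟨m, rfl⟩
    · exact absurd rfl hn
    · have := Real.pi_pos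
      rw [hlam_odd]; positivity
    · have := hX_pos m
      rw [hlam_even]; positivity
  have hrec (n : ℕ) : 4 * A (n + 1) +
      ∑ j ∈ Finset.range n, (-1) ^ j * (2 * j / (2 * j + 2).factorial) * A (n - j) =
        (-1) ^ (n + 1) * n / (2 * n + 1).factorial := by
    have h := euler_rayleigh_of_iteratedDeriv (a := fun p => (A p : ℂ)) (fun q => by
      simp only [hA]
      exact iteratedDeriv_logDeriv_charFun
        (eigenvalue_injective hα_pos hX_mono hX_pos hX_root hlam0 hlam_odd hlam_even) hpos
        (charFun_eq_zero_iff hα_pos hα_eq hX_root hX_all hlam0 hlam_odd hlam_even) q) n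
    apply Complex.ofReal_injective
    push_cast
    exact h
  have hA1 : A 1 = 0 := by simpa using hrec 0
  refine ⟨hA1, fun n hn => ?_⟩
  obtain ⟨m, rfl⟩ := Nat.exists_eq_add_of_le' hn
  rw [← hrec (m + 1), Finset.sum_range_succ, show m + 1 - m = 1 by omega, hA1, mul_zero, add_zero,
    Nat.add_sub_cancel, ← Finset.Ico_add_one_right_eq_Icc, Finset.sum_Ico_eq_sum_range,
    Nat.add_sub_cancel]
  congr 1
  refine Finset.sum_congr rfl fun j hj => ?_
  have hjm := Finset.mem_range.1 hj
  rw [show m + 1 - (1 + j) + 1 = m + 1 - j by omega, show 2 * (1 + j) = 2 * j + 2 by ring,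
    show 2 * j + 2 - 1 = 2 * j + 1 by omega, Nat.factorial_succ (2 * j + 1)]
  have hfac : ((2 * j + 1).factorial : ℝ) ≠ 0 := by exact_mod_cast Nat.factorial_ne_zero _
  have hj2 : (2 * (j : ℝ) + 1 + 1) ≠ 0 := by positivity
  push_cast
  field_simp
  ring
end

section
/- Let α be the unique positive real number satisfying cosh α = α·sinh α, let (x_m)_{m≥1} be the strictly increasing enumeration of the positive solutions of cos x + x·sin x = 0, and define λ₀ = −4α², λ_{2m−1} = (2m−1)²π², λ_{2m} = 4x_m² for m ≥ 1. Then for every real number x, the infinite product (1 − x²/λ₀)·∏_{m=1}^∞ (1 − x²/λ_m) converges and equals (1 + cos x)/2 + (x/4)·sin x. -/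
open Filter Topology Set in
/-- If `f` is continuous on a compact set `K`, has a single zero `b` there, and `f` tends to zero
along a `K`-valued family, then the family converges to `b`. -/
theorem tendsto_of_tendsto_zero_of_unique_zero {ι : Type*} {l : Filter ι} {f : ℝ → ℝ} {K : Set ℝ}
    {u : ι → ℝ} {b : ℝ} (hK : IsCompact K) (hf : Continuous f) (hu : ∀ᶠ i in l, u i ∈ K)
    (huniq : ∀ x ∈ K, f x = 0 → x = b) (hlim : Tendsto (fun i => f (u i)) l (𝓝 0)) :
    Tendsto u l (𝓝 b) := by
  refine hK.tendsto_nhds_of_unique_mapClusterPt hu fun x hx hcl => huniq x hx ?_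
  have h1 : MapClusterPt (f x) l (f ∘ u) := hcl.continuousAt_comp hf.continuousAt
  have : (𝓝 (f x) ⊓ 𝓝 0).NeBot := ClusterPt.mono h1 hlim
  exact eq_of_nhds_neBot this

open Filter Topology in
/-- If `f` vanishes at `0` with derivative `1`, then `n f (y_n / n) - y_n` tends to zero for every
bounded sequence `y`. -/
theorem tendsto_nat_mul_comp_div_sub {f : ℝ → ℝ} (hf : HasDerivAt f 1 0) (hf0 : f 0 = 0)
    {y : ℕ → ℝ} {C : ℝ} (hy : ∀ᶠ n in atTop, |y n| ≤ C) :
    Tendsto (fun n : ℕ => n * f (y n / n) - y n) atTop (𝓝 0) := by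
  have hdiv : Tendsto (fun n : ℕ => y n / n) atTop (𝓝 0) := by
    have h : Tendsto (fun n : ℕ => C / (n : ℝ)) atTop (𝓝 0) := tendsto_const_div_atTop_nhds_zero_nat C
    refine squeeze_zero_norm' ?_ h
    filter_upwards [hy] with n hn
    rw [Real.norm_eq_abs, abs_div, Nat.abs_cast]
    gcongr
  have hd : Tendsto (fun n : ℕ => dslope f 0 (y n / n) - 1) atTop (𝓝 0) := by
    have h := (continuousAt_dslope_same.2 hf.differentiableAt).tendsto.comp hdiv
    rw [dslope_same, hf.deriv] at h
    simpa using h.sub_const 1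
  have hb : Tendsto (fun n : ℕ => C * |dslope f 0 (y n / n) - 1|) atTop (𝓝 0) := by
    simpa using hd.abs.const_mul C
  refine squeeze_zero_norm' ?_ hb
  filter_upwards [hy, eventually_gt_atTop 0] with n hn hn0
  have hn' : (n : ℝ) ≠ 0 := by positivity
  have h := sub_smul_dslope f 0 (y n / n)
  rw [hf0, sub_zero, sub_zero, smul_eq_mul] at h
  have : n * f (y n / n) - y n = y n * (dslope f 0 (y n / n) - 1) := by
    rw [← h]; field_simp
  rw [this, Real.norm_eq_abs, abs_mul]
  gcongr

open Filter Topology in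
theorem tendsto_nat_mul_comp_div {f : ℝ → ℝ} (hf : HasDerivAt f 1 0) (hf0 : f 0 = 0)
    {y : ℕ → ℝ} {b : ℝ} (hy : Tendsto y atTop (𝓝 b)) :
    Tendsto (fun n : ℕ => n * f (y n / n)) atTop (𝓝 b) := by
  have hbdd : ∀ᶠ n in atTop, |y n| ≤ |b| + 1 :=
    hy.abs.eventually_le_const (lt_add_one |b|)
  simpa using (tendsto_nat_mul_comp_div_sub hf hf0 hbdd).add hy

theorem hasDerivAt_sin_zero : HasDerivAt Real.sin 1 0 := by
  simpa using Real.hasDerivAt_sin 0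

theorem hasDerivAt_sinh_zero : HasDerivAt Real.sinh 1 0 := by
  simpa using Real.hasDerivAt_sinh 0

open Filter Topology in
theorem tendsto_sq_mul_one_sub_cos_div {y : ℕ → ℝ} {b : ℝ} (hy : Tendsto y atTop (𝓝 b)) :
    Tendsto (fun n : ℕ => (n : ℝ) ^ 2 * (1 - Real.cos (y n / n))) atTop (𝓝 (b ^ 2 / 2)) := by
  have h := tendsto_nat_mul_comp_div hasDerivAt_sin_zero Real.sin_zero (hy.div_const 2)
  convert (h.pow 2).const_mul 2 using 2 with n
  · have : y n / n = 2 * (y n / 2 / n) := by ring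
    rw [this, Real.cos_two_mul, Real.cos_sq']
    ring
  · ring

open Filter Topology in
theorem tendsto_sq_mul_one_sub_cosh_div {y : ℕ → ℝ} {b : ℝ} (hy : Tendsto y atTop (𝓝 b)) :
    Tendsto (fun n : ℕ => (n : ℝ) ^ 2 * (1 - Real.cosh (y n / n))) atTop (𝓝 (-b ^ 2 / 2)) := by
  have h := tendsto_nat_mul_comp_div hasDerivAt_sinh_zero Real.sinh_zero (hy.div_const 2)
  convert (h.pow 2).const_mul (-2) using 2 with n
  · have : y n / n = 2 * (y n / 2 / n) := by ring
    rw [this, Real.cosh_two_mul, Real.cosh_sq]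
    ring
  · ring

open Polynomial in
/-- A polynomial of degree at most `N` with value `1` at `1` and `N` distinct roots is determined
by its roots. -/
theorem Polynomial.eval_eq_prod_one_sub_div {K : Type*} [Field K] [DecidableEq K]
    {p : K[X]} {N : ℕ} {r : ℕ → K} (hdeg : p.natDegree ≤ N) (h1 : p.eval 1 = 1)
    (hinj : Set.InjOn r (Finset.range N)) (hne : ∀ i < N, r i ≠ 1)
    (hroot : ∀ i < N, p.eval (r i) = 0) (c : K) :
    p.eval c = ∏ i ∈ Finset.range N, (1 - (1 - c) / (1 - r i)) := by
  set q : K[X] := ∏ i ∈ Finset.range N, (1 - C (1 - r i)⁻¹ * (1 - X)) with hq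
  have hqe (z : K) : q.eval z = ∏ i ∈ Finset.range N, (1 - (1 - z) / (1 - r i)) := by
    rw [hq, eval_prod]
    refine Finset.prod_congr rfl fun i _ => ?_
    simp only [eval_sub, eval_one, eval_mul, eval_C, eval_X]
    ring
  have hqdeg : q.natDegree ≤ N := by
    refine (natDegree_prod_le _ _).trans ?_
    refine (Finset.sum_le_card_nsmul _ _ 1 fun i _ => ?_).trans (by simp)
    compute_degree
  have hcard : (insert 1 ((Finset.range N).image r)).card = N + 1 := by
    rw [Finset.card_insert_of_notMem, Finset.card_image_of_injOn hinj, Finset.card_range]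
    simpa using fun i hi => hne i hi
  have hlt {s : K[X]} (hs : s.natDegree ≤ N) :
      s.degree < ((insert 1 ((Finset.range N).image r)).card : WithBot ℕ) := by
    rw [hcard]
    refine degree_le_natDegree.trans_lt ?_
    exact_mod_cast Nat.lt_succ_of_le hs
  have : p = q := by
    refine eq_of_degrees_lt_of_eval_finset_eq _ (hlt hdeg) (hlt hqdeg) fun z hz => ?_
    rw [hqe]
    simp only [Finset.mem_insert, Finset.mem_image, Finset.mem_range] at hz
    rcases hz with rfl | ⟨i, hi, rfl⟩
    · simp [h1]
    · rw [hroot i hi, Finset.prod_eq_zero (Finset.mem_range.2 hi)]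
      rw [div_self (sub_ne_zero.2 (hne i hi).symm), sub_self]
  rw [this, hqe]

/-- The `k`-th interval on which `cos` and `sin` have opposite signs. -/
def oppositeSignInterval (k : ℕ) : Set ℝ :=
  Set.Icc (k * Real.pi + Real.pi / 2) ((k + 1) * Real.pi)

theorem pos_of_mem_oppositeSignInterval {k : ℕ} {y : ℝ} (hy : y ∈ oppositeSignInterval k) :
    0 < y :=
  lt_of_lt_of_le (by positivity) hy.1

theorem div_mem_Ioc_of_mem_oppositeSignInterval {n k : ℕ} (hk : k < n) {y : ℝ}
    (hy : y ∈ oppositeSignInterval k) : y / n ∈ Set.Ioc 0 Real.pi := by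
  have hn : (0 : ℝ) < n := by exact_mod_cast (Nat.zero_le k).trans_lt hk
  have hkn : (k : ℝ) + 1 ≤ n := by exact_mod_cast hk
  refine ⟨div_pos (pos_of_mem_oppositeSignInterval hy) hn, ?_⟩
  rw [div_le_iff₀ hn, mul_comm]
  exact hy.2.trans (by gcongr)

theorem lt_of_mem_oppositeSignInterval {j k : ℕ} (hjk : j < k) {y z : ℝ}
    (hy : y ∈ oppositeSignInterval j) (hz : z ∈ oppositeSignInterval k) : y < z := by
  have h : (j : ℝ) + 1 ≤ k := by exact_mod_cast hjk
  have := mul_le_mul_of_nonneg_right h Real.pi_pos.le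
  linarith [hy.2, hz.1, Real.pi_pos]

theorem injOn_cos_div_of_mem_oppositeSignInterval {n : ℕ} {y : ℕ → ℝ}
    (hy : ∀ k < n, y k ∈ oppositeSignInterval k) :
    Set.InjOn (fun k => Real.cos (y k / n)) (Finset.range n) := by
  intro i hi j hj hij
  simp only [Finset.coe_range, Set.mem_Iio] at hi hj
  have hn : (n : ℝ) ≠ 0 := by
    have : 0 < n := (Nat.zero_le i).trans_lt hi
    positivity
  have h := Real.injOn_cos (Set.Ioc_subset_Icc_self
    (div_mem_Ioc_of_mem_oppositeSignInterval hi (hy i hi))) (Set.Ioc_subset_Icc_self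
    (div_mem_Ioc_of_mem_oppositeSignInterval hj (hy j hj))) hij
  have h' : y i = y j := by field_simp at h; exact h
  rcases lt_trichotomy i j with hlt | heq | hlt
  · exact absurd h' (lt_of_mem_oppositeSignInterval hlt (hy i hi) (hy j hj)).ne
  · exact heq
  · exact absurd h' (lt_of_mem_oppositeSignInterval hlt (hy j hj) (hy i hi)).ne'

theorem cos_div_lt_one_of_mem_oppositeSignInterval {n k : ℕ} (hk : k < n) {y : ℝ}
    (hy : y ∈ oppositeSignInterval k) : Real.cos (y / n) < 1 := by
  have h := div_mem_Ioc_of_mem_oppositeSignInterval hk hy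
  simpa using Real.cos_lt_cos_of_nonneg_of_le_pi le_rfl h.2 h.1

theorem one_sub_cos_div_div_le {n k : ℕ} (hk : k < n) {y : ℝ}
    (hy : y ∈ oppositeSignInterval k) (t : ℝ) :
    (1 - Real.cos (t / n)) / (1 - Real.cos (y / n)) ≤ t ^ 2 / ((k : ℝ) + 1) ^ 2 := by
  have hn : (0 : ℝ) < n := by exact_mod_cast (Nat.zero_le k).trans_lt hk
  have hmem := div_mem_Ioc_of_mem_oppositeSignInterval hk hy
  have h1 : 1 - Real.cos (t / n) ≤ t ^ 2 / (2 * (n : ℝ) ^ 2) := by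
    have := Real.one_sub_sq_div_two_le_cos (x := t / n)
    have h : (t / n) ^ 2 / 2 = t ^ 2 / (2 * (n : ℝ) ^ 2) := by ring
    linarith
  have h2 : ((k : ℝ) + 1) ^ 2 / (2 * (n : ℝ) ^ 2) ≤ 1 - Real.cos (y / n) := by
    have h := Real.cos_le_one_sub_mul_cos_sq (x := y / n)
      (by rw [abs_of_pos hmem.1]; exact hmem.2)
    have hy1 : ((k : ℝ) + 1) * (Real.pi / 2) ≤ y := by
      have : (0 : ℝ) ≤ k * Real.pi := by positivity
      linarith [hy.1]
    have hy2 : (((k : ℝ) + 1) * (Real.pi / 2)) ^ 2 ≤ y ^ 2 := by gcongr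
    have h3 : ((k : ℝ) + 1) ^ 2 / (2 * (n : ℝ) ^ 2) ≤ 2 / Real.pi ^ 2 * (y / n) ^ 2 := by
      calc ((k : ℝ) + 1) ^ 2 / (2 * (n : ℝ) ^ 2)
          = 2 / (Real.pi ^ 2 * (n : ℝ) ^ 2) * (((k : ℝ) + 1) * (Real.pi / 2)) ^ 2 := by
            field_simp
        _ ≤ 2 / (Real.pi ^ 2 * (n : ℝ) ^ 2) * y ^ 2 := by gcongr
        _ = 2 / Real.pi ^ 2 * (y / n) ^ 2 := by field_simp
    linarith
  calc (1 - Real.cos (t / n)) / (1 - Real.cos (y / n))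
      ≤ (t ^ 2 / (2 * (n : ℝ) ^ 2)) / (((k : ℝ) + 1) ^ 2 / (2 * (n : ℝ) ^ 2)) := by gcongr
    _ = t ^ 2 / ((k : ℝ) + 1) ^ 2 := by field_simp

theorem summable_sq_div_add_one_sq (t : ℝ) : Summable fun k : ℕ => t ^ 2 / ((k : ℝ) + 1) ^ 2 := by
  have h := (summable_nat_add_iff 1).2 (Real.summable_one_div_nat_pow.2 one_lt_two)
  simpa [div_eq_mul_inv] using h.mul_left (t ^ 2)

theorem multipliable_one_sub_sq_div_sq {Y : ℕ → ℝ} (hY : ∀ k, Y k ∈ oppositeSignInterval k)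
    (t : ℝ) : Multipliable fun k => 1 - t ^ 2 / Y k ^ 2 := by
  simp_rw [sub_eq_add_neg]
  refine Real.multipliable_one_add_of_summable (Summable.neg ?_)
  refine (summable_sq_div_add_one_sq t).of_nonneg_of_le (fun k => by positivity) fun k => ?_
  have h : (k : ℝ) + 1 ≤ Y k := by
    have := (hY k).1
    have h2 : (0 : ℝ) ≤ k := by positivity
    nlinarith [Real.pi_gt_three]
  gcongr

open Filter Topology in
theorem tendsto_prod_one_sub_cos_div {y : ℕ → ℕ → ℝ} {Y : ℕ → ℝ}
    (hy : ∀ n, ∀ k < n, y n k ∈ oppositeSignInterval k)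
    (hY : ∀ k, 0 < Y k) (hlim : ∀ k, Tendsto (fun n => y n k) atTop (𝓝 (Y k))) (t : ℝ) :
    Tendsto (fun n : ℕ => ∏ k ∈ Finset.range n,
      (1 - (1 - Real.cos (t / n)) / (1 - Real.cos (y n k / n)))) atTop
      (𝓝 (∏' k, (1 - t ^ 2 / Y k ^ 2))) := by
  let F : ℕ → ℕ → ℝ := fun n k =>
    if k < n then -((1 - Real.cos (t / n)) / (1 - Real.cos (y n k / n))) else 0
  have hF : Tendsto (fun n => ∏' k, (1 + F n k)) atTop
      (𝓝 (∏' k, (1 + -(t ^ 2 / Y k ^ 2)))) := by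
    refine tendsto_tprod_one_add_of_dominated_convergence (summable_sq_div_add_one_sq t) ?_
      (Eventually.of_forall fun n k => ?_)
    · intro k
      have h := ((tendsto_sq_mul_one_sub_cos_div (tendsto_const_nhds (x := t))).div
        (tendsto_sq_mul_one_sub_cos_div (hlim k)) (by have := hY k; positivity)).neg
      have e : t ^ 2 / 2 / (Y k ^ 2 / 2) = t ^ 2 / Y k ^ 2 := by
        have := hY k; field_simp
      rw [e] at h
      refine h.congr' ?_
      filter_upwards [eventually_gt_atTop k] with n hn
      have hn' : (n : ℝ) ≠ 0 := by
        have : 0 < n := (Nat.zero_le k).trans_lt hn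
        positivity
      simp only [F, hn, if_true, Pi.div_apply]
      rw [mul_div_mul_left _ _ (pow_ne_zero 2 hn')]
    · by_cases hk : k < n
      · simp only [F, hk, if_true]
        rw [norm_neg, Real.norm_eq_abs, abs_of_nonneg]
        · exact one_sub_cos_div_div_le hk (hy n k hk) t
        · exact div_nonneg (sub_nonneg.2 (Real.cos_le_one _)) (sub_nonneg.2 (Real.cos_le_one _))
      · simp only [F, hk, if_false, norm_zero]
        positivity
  simp_rw [← sub_eq_add_neg] at hF
  refine hF.congr fun n => ?_
  rw [tprod_eq_prod (s := Finset.range n)]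
  · refine Finset.prod_congr rfl fun k hk => ?_
    simp only [F, Finset.mem_range.1 hk, if_true, sub_eq_add_neg]
  · intro k hk
    simp only [F, Finset.mem_range.not.1 hk, if_false, add_zero]

open Filter Topology in
theorem tprod_one_sub_sq_div_eq_cos (t : ℝ) :
    ∏' k : ℕ, (1 - t ^ 2 / (k * Real.pi + Real.pi / 2) ^ 2) = Real.cos t := by
  have hmem (k : ℕ) : k * Real.pi + Real.pi / 2 ∈ oppositeSignInterval k :=
    ⟨le_rfl, by linarith [Real.pi_pos]⟩
  have h := tendsto_prod_one_sub_cos_div (y := fun _ k => k * Real.pi + Real.pi / 2)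
    (fun _ k _ => hmem k) (fun k => pos_of_mem_oppositeSignInterval (hmem k))
    (fun _ => tendsto_const_nhds) t
  refine tendsto_nhds_unique h (tendsto_const_nhds.congr' ?_)
  filter_upwards [eventually_gt_atTop 0] with n hn
  have hn' : (n : ℝ) ≠ 0 := by positivity
  have key := Polynomial.eval_eq_prod_one_sub_div (p := Polynomial.Chebyshev.T ℝ n) (N := n)
    (r := fun k : ℕ => Real.cos ((k * Real.pi + Real.pi / 2) / n)) (by simp) (by simp)
    (injOn_cos_div_of_mem_oppositeSignInterval fun k _ => hmem k)
    (fun k hk => (cos_div_lt_one_of_mem_oppositeSignInterval hk (hmem k)).ne)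
    (fun k _ => ?_) (Real.cos (t / n))
  · rw [← key, Polynomial.Chebyshev.T_real_cos]
    congr 1
    push_cast
    field_simp
  · rw [Polynomial.Chebyshev.T_real_cos, Int.cast_natCast, mul_div_cancel₀ _ hn', add_comm,
      Real.cos_add_nat_mul_pi]
    simp

/-- If `g` is continuous and nonnegative at the left end of the `k`-th interval, then
`cos y + g y * sin y` has a zero in this interval. -/
theorem exists_mem_oppositeSignInterval_eq_zero {g : ℝ → ℝ} (hg : Continuous g) {k : ℕ}
    (hpos : 0 ≤ g (k * Real.pi + Real.pi / 2)) :
    ∃ y ∈ oppositeSignInterval k, Real.cos y + g y * Real.sin y = 0 := by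
  have hle : k * Real.pi + Real.pi / 2 ≤ ((k : ℝ) + 1) * Real.pi := by linarith [Real.pi_pos]
  have hcont : ContinuousOn (fun y => (-1) ^ k * (Real.cos y + g y * Real.sin y))
      (Set.Icc (k * Real.pi + Real.pi / 2) (((k : ℝ) + 1) * Real.pi)) := by fun_prop
  have hsq : ((-1 : ℝ) ^ k) * (-1) ^ k = 1 := by rw [← mul_pow]; simp
  have hc : Real.cos (k * Real.pi + Real.pi / 2) = 0 := by
    rw [add_comm, Real.cos_add_nat_mul_pi]; simp
  have hs : Real.sin (k * Real.pi + Real.pi / 2) = (-1) ^ k := by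
    rw [add_comm, Real.sin_add_nat_mul_pi]; simp
  have hc' : Real.cos (((k : ℝ) + 1) * Real.pi) = -(-1) ^ k := by
    rw [add_one_mul, add_comm, Real.cos_add_nat_mul_pi]; simp
  have hs' : Real.sin (((k : ℝ) + 1) * Real.pi) = 0 := by
    rw [add_one_mul, add_comm, Real.sin_add_nat_mul_pi]; simp
  obtain ⟨y, hy, h0⟩ := intermediate_value_Icc' hle hcont (show (0 : ℝ) ∈ Set.Icc _ _ from by
    simp only [hc, hs, hc', hs', mul_zero, add_zero, zero_add]
    constructor
    · linarith
    · linear_combination hpos - g (k * Real.pi + Real.pi / 2) * hsq)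
  exact ⟨y, hy, (mul_eq_zero.1 h0).resolve_left (by simp)⟩

theorem hasDerivAt_cos_add_mul_sin (y : ℝ) :
    HasDerivAt (fun y => Real.cos y + y * Real.sin y) (y * Real.cos y) y := by
  exact ((Real.hasDerivAt_cos y).add ((hasDerivAt_id' y).mul (Real.hasDerivAt_sin y))).congr_deriv
    (by ring)

theorem injOn_cos_add_mul_sin (k : ℕ) :
    Set.InjOn (fun y => Real.cos y + y * Real.sin y) (oppositeSignInterval k) := by
  have h : StrictAntiOn (fun y => (-1) ^ k * (Real.cos y + y * Real.sin y))
      (oppositeSignInterval k) := by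
    refine strictAntiOn_of_deriv_neg (convex_Icc _ _) (by fun_prop) fun y hy => ?_
    rw [((hasDerivAt_cos_add_mul_sin y).const_mul _).deriv]
    have hy0 := pos_of_mem_oppositeSignInterval (interior_subset hy)
    replace hy : y ∈ Set.Ioo (k * Real.pi + Real.pi / 2) ((k + 1) * Real.pi) :=
      interior_Icc.subset hy
    have hcos : 0 < Real.sin (y - (k * Real.pi + Real.pi / 2)) :=
      Real.sin_pos_of_pos_of_lt_pi (by linarith [hy.1]) (by linarith [hy.2, Real.pi_pos])
    have e : Real.cos y = -((-1) ^ k * Real.sin (y - (k * Real.pi + Real.pi / 2))) := by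
      have : y = (y - (k * Real.pi + Real.pi / 2) + Real.pi / 2) + k * Real.pi := by ring
      conv_lhs => rw [this]
      rw [Real.cos_add_nat_mul_pi, Real.cos_add_pi_div_two]
      ring
    have hsq : ((-1 : ℝ) ^ k) * (-1) ^ k = 1 := by rw [← mul_pow]; simp
    rw [e]
    have := mul_pos hy0 hcos
    linear_combination this - y * Real.sin (y - (k * Real.pi + Real.pi / 2)) * hsq
  intro a ha b hb hab
  refine h.injOn ha hb ?_
  exact congrArg ((-1) ^ k * ·) hab

theorem exists_mem_oppositeSignInterval_of_cos_add_mul_sin_eq_zero {t : ℝ} (ht : 0 < t)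
    (h : Real.cos t + t * Real.sin t = 0) : ∃ k, t ∈ oppositeSignInterval k := by
  refine ⟨⌊t / Real.pi⌋₊, ?_⟩
  have hπ := Real.pi_pos
  set k := ⌊t / Real.pi⌋₊
  have h1 : k * Real.pi ≤ t := (le_div_iff₀ hπ).1 (Nat.floor_le (by positivity))
  have h2 : t < ((k : ℝ) + 1) * Real.pi := (div_lt_iff₀ hπ).1 (Nat.lt_floor_add_one _)
  refine ⟨?_, h2.le⟩
  by_contra! hlt
  have e : t = (t - k * Real.pi) + k * Real.pi := by ring
  have h' : (-1) ^ k * (Real.cos (t - k * Real.pi) + t * Real.sin (t - k * Real.pi)) = 0 := by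
    have hc := Real.cos_add_nat_mul_pi (t - k * Real.pi) k
    have hs := Real.sin_add_nat_mul_pi (t - k * Real.pi) k
    rw [← e] at hc hs
    rw [← h, hc, hs]
    ring
  have hc : 0 < Real.cos (t - k * Real.pi) :=
    Real.cos_pos_of_mem_Ioo ⟨by linarith, by linarith⟩
  have hs : 0 ≤ Real.sin (t - k * Real.pi) :=
    Real.sin_nonneg_of_nonneg_of_le_pi (by linarith) (by linarith)
  have := (mul_eq_zero.1 h').resolve_left (by simp)
  have := mul_nonneg ht.le hs
  linarith

/-- The increasing enumeration of the positive zeros of `cos t + t * sin t` takes exactly one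
value in each interval on which `cos` and `sin` have opposite signs. -/
theorem mem_oppositeSignInterval_of_enumeration {X : ℕ → ℝ} (hX_mono : StrictMono X)
    (hX_pos : ∀ m, 0 < X m) (hX_root : ∀ m, Real.cos (X m) + X m * Real.sin (X m) = 0)
    (hX_all : ∀ t : ℝ, 0 < t → Real.cos t + t * Real.sin t = 0 → ∃ m, X m = t) (k : ℕ) :
    X k ∈ oppositeSignInterval k := by
  choose Y hY hY0 using fun k : ℕ => exists_mem_oppositeSignInterval_eq_zero
    (g := id) continuous_id (k := k) (by simp only [id]; positivity)
  have hYmono : StrictMono Y := fun i j hij => lt_of_mem_oppositeSignInterval hij (hY i) (hY j)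
  have hrange : Set.range X = Set.range Y := by
    ext t
    constructor
    · rintro ⟨m, rfl⟩
      obtain ⟨k, hk⟩ :=
        exists_mem_oppositeSignInterval_of_cos_add_mul_sin_eq_zero (hX_pos m) (hX_root m)
      exact ⟨k, injOn_cos_add_mul_sin k (hY k) hk ((hY0 k).trans (hX_root m).symm)⟩
    · rintro ⟨k, rfl⟩
      exact hX_all _ (pos_of_mem_oppositeSignInterval (hY k)) (hY0 k)
  rw [(hX_mono.range_inj hYmono).1 hrange]
  exact hY k

open Polynomial in
/-- The polynomial in `cos θ` that equals `cos (n θ) + n sin θ sin (n θ)`. -/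
noncomputable def discretePolynomial (n : ℕ) : ℝ[X] :=
  Chebyshev.T ℝ n + C ((n : ℝ) / 2) * (Chebyshev.T ℝ (n - 1) - Chebyshev.T ℝ (n + 1))

theorem discretePolynomial_eval_cos (n : ℕ) (θ : ℝ) :
    (discretePolynomial n).eval (Real.cos θ) =
      Real.cos (n * θ) + n * Real.sin θ * Real.sin (n * θ) := by
  simp only [discretePolynomial, Polynomial.eval_add, Polynomial.eval_mul, Polynomial.eval_C,
    Polynomial.eval_sub, Polynomial.Chebyshev.T_real_cos]
  push_cast
  rw [sub_mul, add_mul, one_mul, Real.cos_sub, Real.cos_add]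
  ring

theorem discretePolynomial_eval_cosh (n : ℕ) (η : ℝ) :
    (discretePolynomial n).eval (Real.cosh η) =
      Real.cosh (n * η) - n * Real.sinh η * Real.sinh (n * η) := by
  simp only [discretePolynomial, Polynomial.eval_add, Polynomial.eval_mul, Polynomial.eval_C,
    Polynomial.eval_sub, Polynomial.Chebyshev.T_real_cosh]
  push_cast
  rw [sub_mul, add_mul, one_mul, Real.cosh_sub, Real.cosh_add]
  ring

theorem discretePolynomial_natDegree_le (n : ℕ) : (discretePolynomial n).natDegree ≤ n + 1 := by
  refine (Polynomial.natDegree_add_le _ _).trans (max_le ?_ ?_)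
  · simp
  · refine (Polynomial.natDegree_C_mul_le _ _).trans
      ((Polynomial.natDegree_sub_le _ _).trans (max_le ?_ ?_)) <;>
    · rw [Polynomial.Chebyshev.natDegree_T]
      omega

theorem discretePolynomial_eval_cos_eq_prod {n : ℕ} (hn : 0 < n) {y : ℕ → ℝ} {z : ℝ} (hz : 0 < z)
    (hz0 : Real.cosh z - n * Real.sinh (z / n) * Real.sinh z = 0)
    (hy : ∀ k < n, y k ∈ oppositeSignInterval k)
    (hy0 : ∀ k < n, Real.cos (y k) + n * Real.sin (y k / n) * Real.sin (y k) = 0) (t : ℝ) :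
    Real.cos t + n * Real.sin (t / n) * Real.sin t =
      (∏ k ∈ Finset.range n, (1 - (1 - Real.cos (t / n)) / (1 - Real.cos (y k / n)))) *
        (1 - (1 - Real.cos (t / n)) / (1 - Real.cosh (z / n))) := by
  have hn' : (n : ℝ) ≠ 0 := by positivity
  have hcosh : 1 < Real.cosh (z / n) := Real.one_lt_cosh.2 (by positivity)
  let r : ℕ → ℝ := fun k => if k < n then Real.cos (y k / n) else Real.cosh (z / n)
  have hr {k : ℕ} (hk : k < n) : r k = Real.cos (y k / n) := if_pos hk
  have hrn : r n = Real.cosh (z / n) := if_neg (lt_irrefl n)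
  have hlt {k : ℕ} (hk : k < n) : r k < 1 := by
    rw [hr hk]; exact cos_div_lt_one_of_mem_oppositeSignInterval hk (hy k hk)
  have key := Polynomial.eval_eq_prod_one_sub_div (p := discretePolynomial n) (N := n + 1)
    (r := r) (discretePolynomial_natDegree_le n)
    (by have := discretePolynomial_eval_cos n 0; simpa using this) ?_ ?_ ?_ (Real.cos (t / n))
  · rw [discretePolynomial_eval_cos, mul_div_cancel₀ _ hn', Finset.prod_range_succ, hrn] at key
    rw [key]
    congr 1
    exact Finset.prod_congr rfl fun k hk => by rw [hr (Finset.mem_range.1 hk)]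
  · rw [Finset.range_add_one, Finset.coe_insert, Set.injOn_insert (by simp)]
    refine ⟨(injOn_cos_div_of_mem_oppositeSignInterval hy).congr fun k hk => ?_, ?_⟩
    · exact (hr (by simpa using hk)).symm
    · rintro ⟨k, hk, hkn⟩
      have := hlt (k := k) (by simpa using hk)
      linarith
  · intro k hk
    rcases Nat.lt_succ_iff_lt_or_eq.1 hk with h | rfl
    · exact (hlt h).ne
    · rw [hrn]; exact hcosh.ne'
  · intro k hk
    rcases Nat.lt_succ_iff_lt_or_eq.1 hk with h | rfl
    · rw [hr h, discretePolynomial_eval_cos, mul_div_cancel₀ _ hn', hy0 k h]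
    · rw [hrn, discretePolynomial_eval_cosh, mul_div_cancel₀ _ hn', hz0]

theorem injOn_cosh_sub_mul_sinh :
    Set.InjOn (fun y => Real.cosh y - y * Real.sinh y) (Set.Ici 0) := by
  refine StrictAntiOn.injOn (strictAntiOn_of_deriv_neg (convex_Ici _) (by fun_prop) fun y hy => ?_)
  rw [interior_Ici] at hy
  have h : HasDerivAt (fun y => Real.cosh y - y * Real.sinh y) (-(y * Real.cosh y)) y := by
    exact ((Real.hasDerivAt_cosh y).sub
      ((hasDerivAt_id' y).mul (Real.hasDerivAt_sinh y))).congr_deriv (by ring)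
  rw [h.deriv]
  exact neg_neg_of_pos (mul_pos hy (Real.cosh_pos y))

theorem exists_discrete_hyperbolic_root {α : ℝ} (hα_pos : 0 < α)
    (hα_eq : Real.cosh α = α * Real.sinh α) {n : ℕ} (hn : 0 < n) :
    ∃ z ∈ Set.Ioc 0 α, Real.cosh z - n * Real.sinh (z / n) * Real.sinh z = 0 := by
  have hn' : (0 : ℝ) < n := by positivity
  have hcont : ContinuousOn (fun z => Real.cosh z - n * Real.sinh (z / n) * Real.sinh z)
      (Set.Icc 0 α) := by fun_prop
  obtain ⟨z, hz, h0⟩ := intermediate_value_Icc' hα_pos.le hcont (show (0 : ℝ) ∈ Set.Icc _ _ from by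
    constructor
    · have h1 : α / n ≤ Real.sinh (α / n) := Real.self_le_sinh_iff.2 (by positivity)
      have h2 : α ≤ n * Real.sinh (α / n) := by
        rwa [div_le_iff₀' hn'] at h1
      have h3 := mul_le_mul_of_nonneg_right h2 (Real.sinh_pos_iff.2 hα_pos).le
      linarith
    · simp)
  refine ⟨z, ⟨lt_of_le_of_ne hz.1 ?_, hz.2⟩, h0⟩
  rintro rfl
  simp at h0

open Filter Topology in
theorem tendsto_discrete_hyperbolic_root {α : ℝ} (hα_pos : 0 < α)
    (hα_eq : Real.cosh α = α * Real.sinh α) {z : ℕ → ℝ} (hz : ∀ n, 0 < n → z n ∈ Set.Ioc 0 α)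
    (hz0 : ∀ n : ℕ, 0 < n → Real.cosh (z n) - n * Real.sinh (z n / n) * Real.sinh (z n) = 0) :
    Tendsto z atTop (𝓝 α) := by
  have hmem : ∀ᶠ n in atTop, z n ∈ Set.Icc 0 α := by
    filter_upwards [eventually_gt_atTop 0] with n hn using Set.Ioc_subset_Icc_self (hz n hn)
  refine tendsto_of_tendsto_zero_of_unique_zero (f := fun y => Real.cosh y - y * Real.sinh y)
    isCompact_Icc (by fun_prop) hmem ?_ ?_
  · intro y hy h
    refine injOn_cosh_sub_mul_sinh hy.1 hα_pos.le ?_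
    simp only [h, hα_eq, sub_self]
  · have h := tendsto_nat_mul_comp_div_sub hasDerivAt_sinh_zero Real.sinh_zero (y := z) (C := α) (by
      filter_upwards [hmem] with n hn
      rw [abs_of_nonneg hn.1]; exact hn.2)
    have hb : Tendsto (fun n : ℕ => |n * Real.sinh (z n / n) - z n| * Real.sinh α) atTop (𝓝 0) := by
      simpa using h.abs.mul_const (Real.sinh α)
    refine squeeze_zero_norm' ?_ hb
    filter_upwards [eventually_gt_atTop 0] with n hn
    have e : Real.cosh (z n) - z n * Real.sinh (z n) =
        (n * Real.sinh (z n / n) - z n) * Real.sinh (z n) := by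
      linear_combination hz0 n hn
    rw [e, Real.norm_eq_abs, abs_mul, abs_of_pos (Real.sinh_pos_iff.2 (hz n hn).1)]
    gcongr
    exact Real.sinh_le_sinh.2 (hz n hn).2

theorem exists_discrete_root {n k : ℕ} (hk : k < n) :
    ∃ y ∈ oppositeSignInterval k,
      Real.cos y + n * Real.sin (y / n) * Real.sin y = 0 := by
  refine exists_mem_oppositeSignInterval_eq_zero (g := fun y => n * Real.sin (y / n))
    (by fun_prop) ?_
  have h := div_mem_Ioc_of_mem_oppositeSignInterval hk (y := k * Real.pi + Real.pi / 2)
    ⟨le_rfl, by linarith [Real.pi_pos]⟩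
  exact mul_nonneg (Nat.cast_nonneg n) (Real.sin_nonneg_of_nonneg_of_le_pi h.1.le h.2)

open Filter Topology in
theorem tendsto_discrete_root {k : ℕ} {b : ℝ} (hb : b ∈ oppositeSignInterval k)
    (hb0 : Real.cos b + b * Real.sin b = 0) {y : ℕ → ℝ}
    (hy : ∀ n, k < n → y n ∈ oppositeSignInterval k)
    (hy0 : ∀ n : ℕ, k < n → Real.cos (y n) + n * Real.sin (y n / n) * Real.sin (y n) = 0) :
    Tendsto y atTop (𝓝 b) := by
  have hmem : ∀ᶠ n in atTop, y n ∈ oppositeSignInterval k := by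
    filter_upwards [eventually_gt_atTop k] with n hn using hy n hn
  refine tendsto_of_tendsto_zero_of_unique_zero (f := fun y => Real.cos y + y * Real.sin y)
    (K := oppositeSignInterval k) isCompact_Icc (by fun_prop) hmem ?_ ?_
  · exact fun x hx h => injOn_cos_add_mul_sin k hx hb (h.trans hb0.symm)
  · have h := tendsto_nat_mul_comp_div_sub hasDerivAt_sin_zero Real.sin_zero (y := y)
      (C := ((k : ℝ) + 1) * Real.pi) (by
        filter_upwards [hmem] with n hn
        rw [abs_of_pos (pos_of_mem_oppositeSignInterval hn)]; exact hn.2)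
    refine squeeze_zero_norm' ?_ (by simpa using h.abs)
    filter_upwards [eventually_gt_atTop k] with n hn
    have e : Real.cos (y n) + y n * Real.sin (y n) =
        -((n * Real.sin (y n / n) - y n) * Real.sin (y n)) := by
      linear_combination hy0 n hn
    rw [e, norm_neg, Real.norm_eq_abs, abs_mul]
    exact mul_le_of_le_one_right (abs_nonneg _) (Real.abs_sin_le_one _)

open Filter Topology in
/-- The product formula for `cos t + t * sin t` over its zeros. -/
theorem tprod_one_sub_sq_div_mul_eq_cos_add_mul_sin {α : ℝ} (hα_pos : 0 < α)
    (hα_eq : Real.cosh α = α * Real.sinh α) {X : ℕ → ℝ}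
    (hX : ∀ k, X k ∈ oppositeSignInterval k)
    (hX_root : ∀ k, Real.cos (X k) + X k * Real.sin (X k) = 0) (t : ℝ) :
    (∏' k, (1 - t ^ 2 / X k ^ 2)) * (1 + t ^ 2 / α ^ 2) = Real.cos t + t * Real.sin t := by
  choose! z hz hz0 using fun (n : ℕ) (hn : 0 < n) =>
    exists_discrete_hyperbolic_root hα_pos hα_eq hn
  choose! y hy hy0 using fun (n k : ℕ) (hk : k < n) => exists_discrete_root hk
  have hlim_z := tendsto_discrete_hyperbolic_root hα_pos hα_eq hz hz0
  have hprod := tendsto_prod_one_sub_cos_div hy (fun k => pos_of_mem_oppositeSignInterval (hX k))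
    (fun k => tendsto_discrete_root (hX k) (hX_root k) (fun n hn => hy n k hn)
      (fun n hn => hy0 n k hn)) t
  have hfac : Tendsto (fun n : ℕ => 1 - (1 - Real.cos (t / n)) / (1 - Real.cosh (z n / n))) atTop
      (𝓝 (1 + t ^ 2 / α ^ 2)) := by
    have h := ((tendsto_sq_mul_one_sub_cos_div (tendsto_const_nhds (x := t))).div
      (tendsto_sq_mul_one_sub_cosh_div hlim_z)
      (div_ne_zero (neg_ne_zero.2 (by positivity)) two_ne_zero)).const_sub 1
    have e : 1 - t ^ 2 / 2 / (-α ^ 2 / 2) = 1 + t ^ 2 / α ^ 2 := by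
      field_simp
      ring
    rw [e] at h
    refine h.congr' ?_
    filter_upwards [eventually_gt_atTop 0] with n hn
    have hn' : (n : ℝ) ≠ 0 := by positivity
    simp only [Pi.div_apply]
    rw [mul_div_mul_left _ _ (pow_ne_zero 2 hn')]
  have hleft : Tendsto (fun n : ℕ => Real.cos t + n * Real.sin (t / n) * Real.sin t) atTop
      (𝓝 (Real.cos t + t * Real.sin t)) :=
    ((tendsto_nat_mul_comp_div hasDerivAt_sin_zero Real.sin_zero
      (tendsto_const_nhds (x := t))).mul_const _).const_add _
  refine tendsto_nhds_unique (hprod.mul hfac) (hleft.congr' ?_)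
  filter_upwards [eventually_gt_atTop 0] with n hn
  exact discretePolynomial_eval_cos_eq_prod hn (hz n hn).1 (hz0 n hn) (hy n) (hy0 n) t


/-- Infinite product factorization over the eigenvalues:
`(1 + cos x)/2 + (x/4) sin x = (1 - x²/λ₀) ∏_{m≥1} (1 - x²/λ_m)`.
Here `lam 0 = -4α²`, `lam (2m+1) = (2m+1)²π²`, `lam (2m+2) = 4 X m ²`, where
`α` is the unique positive solution of `cosh α = α sinh α` and `X 0 < X 1 < ⋯`
enumerates the positive roots of `cos t + t sin t = 0`. -/
theorem eigenvalue_product_formula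
    (α : ℝ) (hα_pos : 0 < α) (hα_eq : Real.cosh α = α * Real.sinh α)
    (X : ℕ → ℝ) (hX_mono : StrictMono X) (hX_pos : ∀ m, 0 < X m)
    (hX_root : ∀ m, Real.cos (X m) + X m * Real.sin (X m) = 0)
    (hX_all : ∀ t : ℝ, 0 < t → Real.cos t + t * Real.sin t = 0 → ∃ m, X m = t)
    (lam : ℕ → ℝ) (hlam0 : lam 0 = -4 * α ^ 2)
    (hlam_odd : ∀ m : ℕ, lam (2 * m + 1) = (2 * (m : ℝ) + 1) ^ 2 * Real.pi ^ 2)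
    (hlam_even : ∀ m : ℕ, lam (2 * m + 2) = 4 * (X m) ^ 2)
    (x : ℝ) :
    Multipliable (fun m : ℕ => 1 - x ^ 2 / lam (m + 1)) ∧
    (1 - x ^ 2 / lam 0) * ∏' m : ℕ, (1 - x ^ 2 / lam (m + 1)) =
      (1 + Real.cos x) / 2 + (x / 4) * Real.sin x := by
  have hX := mem_oppositeSignInterval_of_enumeration hX_mono hX_pos hX_root hX_all
  have hmem (k : ℕ) : k * Real.pi + Real.pi / 2 ∈ oppositeSignInterval k :=
    ⟨le_rfl, by linarith [Real.pi_pos]⟩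
  have he : (fun k : ℕ => 1 - x ^ 2 / lam (2 * k + 1)) =
      fun k : ℕ => 1 - (x / 2) ^ 2 / (k * Real.pi + Real.pi / 2) ^ 2 := by
    funext k
    have h : ((2 * (k : ℝ) + 1) ^ 2 * Real.pi ^ 2) = 4 * (k * Real.pi + Real.pi / 2) ^ 2 := by ring
    rw [hlam_odd, h, div_pow, div_div]
    norm_num
  have ho : (fun k : ℕ => 1 - x ^ 2 / lam (2 * k + 1 + 1)) =
      fun k : ℕ => 1 - (x / 2) ^ 2 / X k ^ 2 := by
    funext k
    rw [hlam_even, div_pow, div_div]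
    norm_num
  have hme : Multipliable fun k : ℕ => 1 - x ^ 2 / lam (2 * k + 1) := by
    rw [he]; exact multipliable_one_sub_sq_div_sq hmem _
  have hmo : Multipliable fun k : ℕ => 1 - x ^ 2 / lam (2 * k + 1 + 1) := by
    rw [ho]; exact multipliable_one_sub_sq_div_sq hX _
  refine ⟨Multipliable.even_mul_odd (f := fun m : ℕ => 1 - x ^ 2 / lam (m + 1)) hme hmo, ?_⟩
  rw [← tprod_even_mul_odd (f := fun m : ℕ => 1 - x ^ 2 / lam (m + 1)) hme hmo, he, ho,
    tprod_one_sub_sq_div_eq_cos, hlam0]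
  have key := tprod_one_sub_sq_div_mul_eq_cos_add_mul_sin hα_pos hα_eq hX hX_root (x / 2)
  have h0 : 1 - x ^ 2 / (-4 * α ^ 2) = 1 + (x / 2) ^ 2 / α ^ 2 := by
    field_simp
    ring
  have hx : x = 2 * (x / 2) := by ring
  have hcos : Real.cos x = 2 * Real.cos (x / 2) ^ 2 - 1 := by
    conv_lhs => rw [hx, Real.cos_two_mul]
  have hsin : Real.sin x = 2 * Real.sin (x / 2) * Real.cos (x / 2) := by
    conv_lhs => rw [hx, Real.sin_two_mul]
  rw [h0, hcos, hsin]
  linear_combination Real.cos (x / 2) * key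
end

section
/- Let α be the unique positive real number satisfying cosh α = α·sinh α, let (x_m)_{m≥1} be the strictly increasing enumeration of the positive solutions of cos x + x·sin x = 0, define λ₀ = −4α², λ_{2m−1} = (2m−1)²π², λ_{2m} = 4x_m² for m ≥ 1, and set A_p = Σ_{n=0}^∞ 1/λ_n^p. Then A_2 = 1/24, A_3 = −1/240, A_4 = 41/40320, and A_5 = −107/725760. -/
open Complex Metric in
/-- On a ball where a normalized holomorphic function has no zeros and a critical point at the
centre, its logarithmic derivative is controlled by the growth of the function. -/
theorem norm_logDeriv_le_of_norm_le_exp {G : ℂ → ℂ} {R M : ℝ} (hR : 0 < R) (hM : 0 < M)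
    (hG : DifferentiableOn ℂ G (ball 0 R)) (hG0 : ∀ z ∈ ball (0 : ℂ) R, G z ≠ 0)
    (h1 : G 0 = 1) (hd : deriv G 0 = 0) (hb : ∀ z ∈ ball (0 : ℂ) R, ‖G z‖ ≤ Real.exp M)
    {z : ℂ} (hz : z ∈ ball (0 : ℂ) (R / 4)) : ‖logDeriv G z‖ ≤ 32 * M / R ^ 2 * ‖z‖ := by
  have h0R : (0 : ℂ) ∈ ball (0 : ℂ) R := mem_ball_self hR
  have hG' : DifferentiableOn ℂ (logDeriv G) (ball 0 R) :=
    (hG.deriv isOpen_ball).div hG hG0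
  obtain ⟨g, hg⟩ := hG'.isExactOn_ball
  set L : ℂ → ℂ := fun z ↦ g z - g 0 with hL
  have hLd : ∀ z ∈ ball (0 : ℂ) R, HasDerivAt L (logDeriv G z) z := fun z hz ↦
    (hg z hz).sub_const _
  have hLdiff : DifferentiableOn ℂ L (ball 0 R) := fun z hz ↦
    (hLd z hz).differentiableAt.differentiableWithinAt
  have hexp : ∀ z ∈ ball (0 : ℂ) R, G z = exp (L z) := by
    intro z hz
    have hder : ∀ w ∈ ball (0 : ℂ) R, HasDerivAt (fun w ↦ G w * exp (-L w)) 0 w := by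
      intro w hw
      have hGw := (hG.differentiableAt (isOpen_ball.mem_nhds hw)).hasDerivAt
      have h := hGw.fun_mul (hLd w hw).fun_neg.cexp
      rw [logDeriv_apply] at h
      refine h.congr_deriv ?_
      field_simp [hG0 w hw]
      ring
    have := isOpen_ball.is_const_of_deriv_eq_zero (convex_ball (0 : ℂ) R).isPreconnected
      (fun w hw ↦ (hder w hw).differentiableAt.differentiableWithinAt)
      (fun w hw ↦ (hder w hw).deriv) hz h0R
    simp only [h1, hL, sub_self, neg_zero, exp_zero, mul_one] at this
    rw [exp_neg, mul_inv_eq_one₀ (exp_ne_zero _)] at this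
    exact this
  have hre : Set.MapsTo L (ball 0 R) {z | z.re ≤ M} := by
    intro z hz
    have := hb z hz
    rwa [hexp z hz, norm_exp, Real.exp_le_exp] at this
  have hLb : ∀ w : ℂ, ‖w‖ ≤ R / 2 → ‖L w‖ ≤ 2 * M := by
    intro w hw
    have hwR : w ∈ ball (0 : ℂ) R := by rw [mem_ball_zero_iff]; linarith
    refine (borelCaratheodory_zero hM hLdiff hre hR hwR (by simp [hL])).trans ?_
    rw [div_le_iff₀ (by linarith)]
    nlinarith [norm_nonneg w]
  have hsub : ∀ w ∈ ball (0 : ℂ) (R / 4), closedBall w (R / 4) ⊆ ball 0 R := by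
    intro w hw
    rw [mem_ball_zero_iff] at hw
    refine closedBall_subset_ball' ?_
    rw [dist_zero_right]
    linarith
  have hdb : ∀ w ∈ ball (0 : ℂ) (R / 4), ‖logDeriv G w‖ ≤ 2 * M / (R / 4) := by
    intro w hw
    have hws := hsub w hw
    rw [mem_ball_zero_iff] at hw
    rw [← (hLd w (hws (mem_closedBall_self (by linarith)))).deriv]
    refine norm_deriv_le_of_forall_mem_sphere_norm_le (by linarith)
      (hLdiff.diffContOnCl_ball hws) fun v hv ↦ hLb v ?_
    have : ‖v - w‖ = R / 4 := by simpa using hv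
    linarith [norm_sub_norm_le v w]
  have hzero : logDeriv G 0 = 0 := by simp [logDeriv_apply, hd]
  have key := dist_le_div_mul_dist_of_mapsTo_ball (R₂ := 2 * M / (R / 4))
    (hG'.mono (ball_subset_ball (by linarith : R / 4 ≤ R)))
    (fun w hw ↦ by simpa [hzero] using hdb w hw) hz
  rw [hzero, dist_zero_right, dist_zero_right] at key
  convert key using 2
  field_simp
  norm_num

open Complex in
/-- Finitely many nonzero zeros can be divided out of an entire function. -/
theorem exists_differentiable_eq_prod_mul {f : ℂ → ℂ} (hf : Differentiable ℂ f) (S : Finset ℂ)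
    (hS0 : ∀ a ∈ S, a ≠ 0) (hS : ∀ a ∈ S, f a = 0) :
    ∃ G : ℂ → ℂ, Differentiable ℂ G ∧ ∀ z, f z = (∏ a ∈ S, (1 - z / a)) * G z := by
  classical
  induction S using Finset.induction_on with
  | empty => exact ⟨f, hf, by simp⟩
  | insert a S ha ih =>
    obtain ⟨G, hG, hfG⟩ := ih (fun b hb ↦ hS0 b (Finset.mem_insert_of_mem hb))
      (fun b hb ↦ hS b (Finset.mem_insert_of_mem hb))
    have ha0 := hS0 a (Finset.mem_insert_self a S)
    have hGa : G a = 0 := by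
      have h := hS a (Finset.mem_insert_self a S)
      rw [hfG, mul_eq_zero, Finset.prod_eq_zero_iff] at h
      rcases h with ⟨b, hb, hab⟩ | h
      · have hb0 := hS0 b (Finset.mem_insert_of_mem hb)
        rw [sub_eq_zero, eq_div_iff hb0, one_mul] at hab
        exact absurd (hab ▸ hb) ha
      · exact h
    refine ⟨fun z ↦ -a * dslope G a z, ?_, fun z ↦ ?_⟩
    · refine Differentiable.const_mul ?_ _
      rw [← differentiableOn_univ] at hG ⊢
      exact (differentiableOn_dslope Filter.univ_mem).mpr hG
    · have h := sub_smul_dslope G a z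
      rw [hGa, sub_zero, smul_eq_mul] at h
      rw [Finset.prod_insert ha, hfG, ← h]
      field_simp
      ring

open Complex Metric in
/-- The logarithmic derivative of an even entire function is approximated near the origin by the
partial fraction sum over its zeros in a large ball. -/
theorem norm_logDeriv_sub_sum_le {f : ℂ → ℂ} (hf : Differentiable ℂ f) (h1 : f 0 = 1)
    (hd : deriv f 0 = 0) {S : Finset ℂ} {R M : ℝ} (hR : 0 < R) (hM : 0 < M)
    (hS0 : ∀ a ∈ S, a ≠ 0) (hS : ∀ a ∈ S, f a = 0) (hS' : ∀ a ∈ S, deriv f a ≠ 0)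
    (hneg : ∀ a ∈ S, -a ∈ S) (hSR : ∀ a ∈ S, ‖a‖ ≤ R)
    (hall : ∀ z ∈ ball (0 : ℂ) R, f z = 0 → z ∈ S)
    (hb : ∀ z : ℂ, ‖z‖ = 2 * R → ‖f z‖ ≤ Real.exp M)
    {z : ℂ} (hz : z ∈ ball (0 : ℂ) (R / 4)) (hfz : f z ≠ 0) :
    ‖logDeriv f z - ∑ a ∈ S, 1 / (z - a)‖ ≤ 32 * M / R ^ 2 * ‖z‖ := by
  obtain ⟨G, hG, hfG⟩ := exists_differentiable_eq_prod_mul hf S hS0 hS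
  have hfac : ∀ w, f w ≠ 0 → ∀ a ∈ S, 1 - w / a ≠ 0 := by
    intro w hw a ha h
    apply hw
    rw [hfG, Finset.prod_eq_zero ha h, zero_mul]
  have hPd : ∀ w, DifferentiableAt ℂ (fun w : ℂ ↦ ∏ a ∈ S, (1 - w / a)) w := by
    intro w
    fun_prop
  have hlog : ∀ w, f w ≠ 0 → logDeriv f w = ∑ a ∈ S, 1 / (w - a) + logDeriv G w := by
    intro w hw
    have hw' := hw
    rw [hfG, mul_ne_zero_iff] at hw'
    rw [show f = fun w ↦ (∏ a ∈ S, (1 - w / a)) * G w from funext hfG,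
      logDeriv_mul w hw'.1 hw'.2 (hPd w) (hG w),
      logDeriv_prod (hfac w hw) (fun a _ ↦ by fun_prop)]
    congr 1
    refine Finset.sum_congr rfl fun a ha ↦ ?_
    have h2 := hS0 a ha
    have h3 := hfac w hw a ha
    have h4 : w - a ≠ 0 := by
      intro h
      apply h3
      rw [sub_eq_zero.mp h, div_self h2, sub_self]
    have h5 : HasDerivAt (fun w : ℂ ↦ 1 - w / a) (-(1 / a)) w :=
      ((hasDerivAt_id w).div_const a).const_sub 1
    rw [logDeriv_apply, h5.deriv]
    rw [div_eq_div_iff h3 h4]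
    field_simp
    ring
  have hG1 : G 0 = 1 := by
    have := hfG 0
    simpa [h1] using this.symm
  have hGd : deriv G 0 = 0 := by
    have h := hlog 0 (by simp [h1])
    have hsum : ∑ a ∈ S, 1 / ((0 : ℂ) - a) = 0 := by
      refine Finset.sum_involution (fun a _ ↦ -a) ?_ ?_ (fun a ha ↦ hneg a ha) ?_
      · intro a _
        simp
      · intro a ha _ h
        exact hS0 a ha (by linear_combination (-1 / 2 : ℂ) * h)
      · simp
    rw [hsum, logDeriv_apply, logDeriv_apply, hd, hG1] at h
    simpa using h.symm
  have hGne : ∀ w ∈ ball (0 : ℂ) R, G w ≠ 0 := by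
    intro w hw hGw
    have hwS : w ∈ S := hall w hw (by rw [hfG, hGw, mul_zero])
    apply hS' w hwS
    have h := (hPd w).hasDerivAt.fun_mul (hG w).hasDerivAt
    rw [← show f = fun w ↦ (∏ a ∈ S, (1 - w / a)) * G w from funext hfG] at h
    rw [h.deriv, hGw, Finset.prod_eq_zero hwS (by rw [div_self (hS0 w hwS), sub_self])]
    ring
  have hGb : ∀ w ∈ ball (0 : ℂ) R, ‖G w‖ ≤ Real.exp M := by
    intro w hw
    refine norm_le_of_forall_mem_frontier_norm_le (U := ball (0 : ℂ) (2 * R)) isBounded_ball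
      hG.diffContOnCl ?_ (subset_closure (ball_subset_ball (by linarith) hw))
    intro v hv
    rw [frontier_ball _ (by linarith), mem_sphere_zero_iff_norm] at hv
    refine le_trans ?_ (hb v hv)
    rw [hfG, norm_mul, norm_prod]
    refine le_mul_of_one_le_left (norm_nonneg _) ?_
    rw [← Finset.prod_const_one (s := S)]
    refine Finset.prod_le_prod (fun _ _ ↦ zero_le_one) fun a ha ↦ ?_
    have ha0 : 0 < ‖a‖ := norm_pos_iff.mpr (hS0 a ha)
    have h2 : 2 ≤ ‖v / a‖ := by
      rw [norm_div, hv, le_div_iff₀ ha0]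
      linarith [hSR a ha]
    have h3 := norm_sub_norm_le (v / a) 1
    rw [norm_one, norm_sub_rev] at h3
    linarith
  rw [hlog z hfz, add_sub_cancel_left]
  exact norm_logDeriv_le_of_norm_le_exp hR hM hG.differentiableOn hGne hG1 hGd hGb hz

/-- The entire function whose nonzero zeros are the roots of `cot z = -z`. -/
noncomputable def cosAddMulSin (z : ℂ) : ℂ := Complex.cos z + z * Complex.sin z

theorem hasDerivAt_cosAddMulSin (z : ℂ) :
    HasDerivAt cosAddMulSin (z * Complex.cos z) z := by
  have h := (Complex.hasDerivAt_cos z).fun_add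
    ((hasDerivAt_id' z).fun_mul (Complex.hasDerivAt_sin z))
  exact h.congr_deriv (by ring)

theorem cosAddMulSin_ofReal (t : ℝ) :
    cosAddMulSin t = ((Real.cos t + t * Real.sin t : ℝ) : ℂ) := by
  simp [cosAddMulSin]

theorem cosAddMulSin_ofReal_mul_I (b : ℝ) :
    cosAddMulSin (b * Complex.I) = ((Real.cosh b - b * Real.sinh b : ℝ) : ℂ) := by
  simp only [cosAddMulSin, Complex.cos_mul_I, Complex.sin_mul_I]
  push_cast
  linear_combination (b * Complex.sinh b : ℂ) * Complex.I_mul_I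

theorem cosAddMulSin_neg (z : ℂ) : cosAddMulSin (-z) = cosAddMulSin z := by
  simp [cosAddMulSin]

theorem norm_cosAddMulSin_le (z : ℂ) : ‖cosAddMulSin z‖ ≤ Real.exp (2 * ‖z‖) := by
  have h1 : ‖Complex.exp (z * Complex.I)‖ ≤ Real.exp ‖z‖ := by
    simpa using Complex.norm_exp_le_exp_norm (z * Complex.I)
  have h2 : ‖Complex.exp (-z * Complex.I)‖ ≤ Real.exp ‖z‖ := by
    simpa using Complex.norm_exp_le_exp_norm (-z * Complex.I)
  have hc : ‖Complex.cos z‖ ≤ Real.exp ‖z‖ := by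
    rw [Complex.cos, norm_div, Complex.norm_two]
    linarith [norm_add_le (Complex.exp (z * Complex.I)) (Complex.exp (-z * Complex.I))]
  have hs : ‖Complex.sin z‖ ≤ Real.exp ‖z‖ := by
    rw [Complex.sin, norm_div, norm_mul, Complex.norm_two, Complex.norm_I, mul_one]
    linarith [norm_sub_le (Complex.exp (-z * Complex.I)) (Complex.exp (z * Complex.I))]
  calc ‖cosAddMulSin z‖ ≤ ‖Complex.cos z‖ + ‖z‖ * ‖Complex.sin z‖ := by
        simpa [cosAddMulSin] using norm_add_le (Complex.cos z) (z * Complex.sin z)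
    _ ≤ Real.exp ‖z‖ + ‖z‖ * Real.exp ‖z‖ := by gcongr
    _ = (‖z‖ + 1) * Real.exp ‖z‖ := by ring
    _ ≤ Real.exp ‖z‖ * Real.exp ‖z‖ := by gcongr; exact Real.add_one_le_exp _
    _ = Real.exp (2 * ‖z‖) := by rw [← Real.exp_add, two_mul]

theorem mul_cos_ne_zero_of_cosAddMulSin_eq_zero {z : ℂ} (hz : cosAddMulSin z = 0) :
    z * Complex.cos z ≠ 0 := by
  intro h
  have h0 : z ≠ 0 := by
    rintro rfl
    simp [cosAddMulSin] at hz
  have hc : Complex.cos z = 0 := (mul_eq_zero.mp h).resolve_left h0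
  have hs : Complex.sin z = 0 := by
    rw [cosAddMulSin, hc, zero_add] at hz
    exact (mul_eq_zero.mp hz).resolve_left h0
  simpa [hc, hs] using Complex.sin_sq_add_cos_sq z

/-- All zeros of `cosAddMulSin` lie on the coordinate axes. -/
theorem re_eq_zero_or_im_eq_zero_of_cosAddMulSin_eq_zero {z : ℂ} (hz : cosAddMulSin z = 0) :
    z.re = 0 ∨ z.im = 0 := by
  by_contra! hne
  obtain ⟨ha, hb⟩ := hne
  set a := z.re
  set b := z.im
  have hzab : z = a + b * Complex.I := (Complex.re_add_im z).symm
  rw [hzab, cosAddMulSin, Complex.cos_add_mul_I, Complex.sin_add_mul_I] at hz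
  have hre := congrArg Complex.re hz
  have him := congrArg Complex.im hz
  simp only [← Complex.ofReal_cos, ← Complex.ofReal_sin, ← Complex.ofReal_cosh,
    ← Complex.ofReal_sinh, Complex.add_re, Complex.sub_re, Complex.mul_re, Complex.add_im,
    Complex.sub_im, Complex.mul_im, Complex.ofReal_re, Complex.ofReal_im, Complex.I_re,
    Complex.I_im, Complex.zero_re, Complex.zero_im] at hre him
  ring_nf at hre him
  have h1 := Real.sin_sq_add_cos_sq a
  have h2 := Real.cosh_sq b
  set D := Real.sin a ^ 2 * Real.cosh b ^ 2 + Real.cos a ^ 2 * Real.sinh b ^ 2 with hD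
  have hx : Real.sin a * Real.cos a = -a * D := by
    rw [hD]
    linear_combination (Real.sin a * Real.cosh b) * hre + (Real.cos a * Real.sinh b) * him
      - Real.sin a * Real.cos a * h2
  have hy : Real.sinh b * Real.cosh b = b * D := by
    rw [hD]
    linear_combination (Real.cos a * Real.sinh b) * hre - (Real.sin a * Real.cosh b) * him
      - Real.sinh b * Real.cosh b * h1
  have hx' : |Real.sin (2 * a)| < |2 * a| := Real.abs_sin_lt_abs (by simpa using ha)
  have hy' : |2 * b| < |Real.sinh (2 * b)| := by
    rw [Real.abs_sinh]
    exact Real.self_lt_sinh_iff.mpr (by positivity)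
  rw [Real.sin_two_mul, mul_assoc, hx, abs_mul, abs_mul, abs_mul, abs_neg] at hx'
  rw [Real.sinh_two_mul, mul_assoc, hy, abs_mul, abs_mul, abs_mul] at hy'
  have ha' : 0 < |a| := abs_pos.mpr ha
  have hb' : 0 < |b| := abs_pos.mpr hb
  rw [abs_two] at hx' hy'
  nlinarith

/-- The equation `cosh b = b * sinh b` has at most one positive solution. -/
theorem eq_of_cosh_eq_mul_sinh_s13 {a b : ℝ} (ha : 0 < a) (hb : 0 < b)
    (hae : Real.cosh a = a * Real.sinh a) (hbe : Real.cosh b = b * Real.sinh b) : a = b := by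
  have hmono : StrictMonoOn (fun x : ℝ ↦ x * Real.sinh x - Real.cosh x) (Set.Ici 0) := by
    refine strictMonoOn_of_deriv_pos (convex_Ici 0) (by fun_prop) fun x hx ↦ ?_
    rw [interior_Ici, Set.mem_Ioi] at hx
    have h := ((hasDerivAt_id' x).fun_mul (Real.hasDerivAt_sinh x)).fun_sub
      (Real.hasDerivAt_cosh x)
    rw [h.deriv]
    nlinarith [Real.cosh_pos x, mul_pos hx (Real.cosh_pos x)]
  refine hmono.injOn (Set.mem_Ici.mpr ha.le) (Set.mem_Ici.mpr hb.le) ?_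
  rw [hae, hbe, sub_self, sub_self]

/-- A strictly increasing sequence of zeros of an entire function `f ≠ 0` is unbounded. -/
theorem tendsto_atTop_of_strictMono_of_eq_zero {f : ℂ → ℂ} (hf : Differentiable ℂ f)
    (hf0 : f ≠ 0) {X : ℕ → ℝ} (hX : StrictMono X) (hroot : ∀ m, f (X m) = 0) :
    Filter.Tendsto X Filter.atTop Filter.atTop := by
  refine (tendsto_atTop_of_monotone hX.monotone).resolve_right ?_
  rintro ⟨l, hl⟩
  apply hf0
  refine AnalyticOnNhd.eq_of_frequently_eq (𝕜 := ℂ) (z₀ := (l : ℂ)) (fun z _ ↦ hf.analyticAt z)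
    (fun z _ ↦ analyticAt_const) ?_
  have hlt : ∀ m, X m < l := fun m ↦ (hX m.lt_succ_self).trans_le (hX.monotone.ge_of_tendsto hl _)
  have htend : Filter.Tendsto (fun m ↦ (X m : ℂ)) Filter.atTop (nhdsWithin (l : ℂ) {(l : ℂ)}ᶜ) := by
    refine tendsto_nhdsWithin_iff.mpr ⟨(Complex.continuous_ofReal.tendsto l).comp hl, ?_⟩
    refine Filter.Eventually.of_forall fun m ↦ ?_
    simpa using (hlt m).ne
  exact htend.frequently (Filter.Frequently.of_forall hroot)

section PartialFractions

variable {α : ℝ} {X : ℕ → ℝ}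

/-- The zeros of `cosAddMulSin` up to sign, the imaginary one first. -/
noncomputable def signlessZero (α : ℝ) (X : ℕ → ℝ) : ℕ → ℂ
  | 0 => α * Complex.I
  | k + 1 => X k

theorem signlessZero_ne_zero (hα : 0 < α) (hX : ∀ m, 0 < X m) (k : ℕ) :
    signlessZero α X k ≠ 0 := by
  cases k with
  | zero => simp [signlessZero, hα.ne']
  | succ k => simpa [signlessZero] using (hX k).ne'

theorem signlessZero_sq_injective (hα : 0 < α) (hmono : StrictMono X) (hX : ∀ m, 0 < X m)
    {j k : ℕ} (h : signlessZero α X j ^ 2 = signlessZero α X k ^ 2) : j = k := by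
  have hne : ∀ m, ((α : ℂ) * Complex.I) ^ 2 ≠ (X m : ℂ) ^ 2 := by
    intro m hm
    rw [mul_pow, Complex.I_sq] at hm
    have : α ^ 2 * (-1) = X m ^ 2 := by exact_mod_cast hm
    nlinarith [pow_pos hα 2, pow_pos (hX m) 2]
  cases j with
  | zero =>
    cases k with
    | zero => rfl
    | succ k => exact absurd h (hne k)
  | succ j =>
    cases k with
    | zero => exact absurd h.symm (hne j)
    | succ k =>
      have h' : X j ^ 2 = X k ^ 2 := by
        simp only [signlessZero] at h
        exact_mod_cast h
      rw [hmono.injective ((sq_eq_sq₀ (hX j).le (hX k).le).mp h')]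

/-- Partial fraction expansion of the logarithmic derivative of `cos t + t * sin t`. -/
theorem hasSum_one_div_sq_sub_sq (hα_pos : 0 < α) (hα_eq : Real.cosh α = α * Real.sinh α)
    (hX_mono : StrictMono X) (hX_pos : ∀ m, 0 < X m)
    (hX_root : ∀ m, Real.cos (X m) + X m * Real.sin (X m) = 0)
    (hX_all : ∀ t : ℝ, 0 < t → Real.cos t + t * Real.sin t = 0 → ∃ m, X m = t)
    {t : ℝ} (ht : 0 < t) (htX : t < X 0) :
    HasSum (fun k ↦ 1 / (X k ^ 2 - t ^ 2))
      (1 / (α ^ 2 + t ^ 2) - Real.cos t / (2 * (Real.cos t + t * Real.sin t))) := by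
  classical
  have hdiff : Differentiable ℂ cosAddMulSin := fun z ↦ (hasDerivAt_cosAddMulSin z).differentiableAt
  have hf0 : cosAddMulSin 0 = 1 := by simp [cosAddMulSin]
  have hXtop : Filter.Tendsto X Filter.atTop Filter.atTop := by
    refine tendsto_atTop_of_strictMono_of_eq_zero hdiff ?_ hX_mono fun m ↦ ?_
    · intro h
      simp [h] at hf0
    · rw [cosAddMulSin_ofReal, hX_root, Complex.ofReal_zero]
  have hft : Real.cos t + t * Real.sin t ≠ 0 := by
    intro h
    obtain ⟨m, hm⟩ := hX_all t ht h
    linarith [hX_mono.monotone m.zero_le]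
  set r := signlessZero α X with hr
  have hr0 : ∀ k, r k ≠ 0 := signlessZero_ne_zero hα_pos hX_pos
  have hrinj : ∀ {j k}, r j ^ 2 = r k ^ 2 → j = k :=
    signlessZero_sq_injective hα_pos hX_mono hX_pos
  have hrf : ∀ k, cosAddMulSin (r k) = 0 := by
    rintro (_ | k)
    · simp [hr, signlessZero, cosAddMulSin_ofReal_mul_I, hα_eq]
    · simp only [hr, signlessZero, cosAddMulSin_ofReal, hX_root, Complex.ofReal_zero]
  set S : ℕ → Finset ℂ := fun N ↦
    (Finset.range (N + 1)).image r ∪ (Finset.range (N + 1)).image (fun k ↦ -r k) with hS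
  have hmem : ∀ {N a}, a ∈ S N ↔ ∃ k < N + 1, a = r k ∨ a = -r k := by
    intro N a
    simp only [hS, Finset.mem_union, Finset.mem_image, Finset.mem_range]
    grind
  have hsum : ∀ N, ∑ a ∈ S N, 1 / ((t : ℂ) - a)
      = ∑ k ∈ Finset.range (N + 1), (1 / ((t : ℂ) - r k) + 1 / ((t : ℂ) + r k)) := by
    intro N
    rw [hS, Finset.sum_union, Finset.sum_image, Finset.sum_image, ← Finset.sum_add_distrib]
    · simp
    · intro j _ k _ h
      exact hrinj (by rw [neg_inj.mp h])
    · intro j _ k _ h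
      exact hrinj (by rw [h])
    · rw [Finset.disjoint_left]
      simp only [Finset.mem_image, not_exists, not_and]
      rintro a ⟨j, -, rfl⟩ k - h
      have hjk : k = j := hrinj (by rw [← h, neg_sq])
      subst hjk
      exact hr0 k (by linear_combination (-1 / 2 : ℂ) * h)
  have hterm : ∀ k, 1 / ((t : ℂ) - r (k + 1)) + 1 / ((t : ℂ) + r (k + 1))
      = ((-2 * t * (1 / (X k ^ 2 - t ^ 2)) : ℝ) : ℂ) := by
    intro k
    have hXk : t < X k := htX.trans_le (hX_mono.monotone k.zero_le)
    simp only [hr, signlessZero]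
    have h1 : t - X k ≠ 0 := by linarith
    have h2 : t + X k ≠ 0 := by linarith
    have h3 : X k ^ 2 - t ^ 2 ≠ 0 := by nlinarith
    have : 1 / (t - X k) + 1 / (t + X k) = -2 * t * (1 / (X k ^ 2 - t ^ 2)) := by
      field_simp
      ring
    rw [← this]
    push_cast
    rfl
  have hterm0 : 1 / ((t : ℂ) - r 0) + 1 / ((t : ℂ) + r 0)
      = ((2 * t * (1 / (α ^ 2 + t ^ 2)) : ℝ) : ℂ) := by
    simp only [hr, signlessZero]
    have h3 : (α : ℂ) ^ 2 + t ^ 2 ≠ 0 := by exact_mod_cast (by positivity : α ^ 2 + t ^ 2 ≠ 0)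
    have h4 : ((t : ℂ) - α * Complex.I) * (t + α * Complex.I) = α ^ 2 + t ^ 2 := by
      linear_combination (-α ^ 2 : ℂ) * Complex.I_sq
    have h1 : (t : ℂ) - α * Complex.I ≠ 0 := left_ne_zero_of_mul (h4 ▸ h3)
    have h2 : (t : ℂ) + α * Complex.I ≠ 0 := right_ne_zero_of_mul (h4 ▸ h3)
    rw [div_add_div _ _ h1 h2, h4]
    push_cast
    ring
  set F : ℝ := t * Real.cos t / (Real.cos t + t * Real.sin t) with hF
  have hlog : logDeriv cosAddMulSin t = (F : ℂ) := by
    rw [logDeriv_apply, (hasDerivAt_cosAddMulSin t).deriv, cosAddMulSin_ofReal, hF]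
    push_cast
    rfl
  have hbound : ∀ᶠ N in Filter.atTop,
      ‖F - (2 * t * (1 / (α ^ 2 + t ^ 2))
        + ∑ k ∈ Finset.range N, -2 * t * (1 / (X k ^ 2 - t ^ 2)))‖ ≤ 128 * t * (X N)⁻¹ := by
    filter_upwards [hXtop.eventually_gt_atTop α, hXtop.eventually_gt_atTop (4 * t)] with N hN1 hN2
    have hXN := hX_pos N
    have key := norm_logDeriv_sub_sum_le hdiff hf0
      (by simp [(hasDerivAt_cosAddMulSin 0).deriv]) (S := S N) (R := X N) (M := 4 * X N)
      hXN (by linarith) ?_ ?_ ?_ ?_ ?_ ?_ ?_ (z := t) ?_ ?_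
    · rw [hsum, Finset.sum_range_succ', hterm0, hlog, Finset.sum_congr rfl fun k _ ↦ hterm k,
        ← Complex.ofReal_sum, ← Complex.ofReal_add, ← Complex.ofReal_sub, Complex.norm_real,
        Complex.norm_real, add_comm, Real.norm_of_nonneg ht.le] at key
      refine key.trans_eq ?_
      field_simp
      norm_num
    · intro a ha
      obtain ⟨k, -, rfl | rfl⟩ := hmem.mp ha
      · exact hr0 k
      · exact neg_ne_zero.mpr (hr0 k)
    · intro a ha
      obtain ⟨k, -, rfl | rfl⟩ := hmem.mp ha
      · exact hrf k
      · rw [cosAddMulSin_neg, hrf]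
    · intro a ha
      rw [(hasDerivAt_cosAddMulSin a).deriv]
      apply mul_cos_ne_zero_of_cosAddMulSin_eq_zero
      obtain ⟨k, -, rfl | rfl⟩ := hmem.mp ha
      · exact hrf k
      · rw [cosAddMulSin_neg, hrf]
    · intro a ha
      rw [hmem] at ha ⊢
      grind
    · intro a ha
      obtain ⟨k, hk, h⟩ := hmem.mp ha
      have : ‖a‖ = ‖r k‖ := by
        rcases h with rfl | rfl
        · rfl
        · exact norm_neg _
      rw [this]
      cases k with
      | zero => simpa [hr, signlessZero, abs_of_pos hα_pos] using hN1.le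
      | succ k =>
        simpa [hr, signlessZero, abs_of_pos (hX_pos k)] using hX_mono.monotone (by omega)
    · intro z hz hfz
      rw [mem_ball_zero_iff] at hz
      rw [hmem]
      rcases re_eq_zero_or_im_eq_zero_of_cosAddMulSin_eq_zero hfz with h | h
      · have hzI : z = z.im * Complex.I := by
          conv_lhs => rw [← Complex.re_add_im z, h]
          simp
        refine ⟨0, by omega, ?_⟩
        have habs : Real.cosh |z.im| = |z.im| * Real.sinh |z.im| := by
          rw [hzI, cosAddMulSin_ofReal_mul_I, Complex.ofReal_eq_zero, sub_eq_zero] at hfz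
          rw [Real.cosh_abs]
          rcases abs_choice z.im with h | h
          · rw [h, hfz]
          · rw [h, hfz, Real.sinh_neg]
            ring
        have hpos : 0 < |z.im| := by
          refine abs_pos.mpr fun h0 ↦ ?_
          simp [h0] at habs
        have hzα := eq_of_cosh_eq_mul_sinh_s13 hpos hα_pos habs hα_eq
        rw [hzI]
        rcases abs_choice z.im with h | h
        · left
          rw [← h, hzα]
          rfl
        · right
          rw [← neg_neg z.im, ← h, hzα, Complex.ofReal_neg, neg_mul]
          rfl
      · have hzR : z = z.re := by
          conv_lhs => rw [← Complex.re_add_im z, h]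
          simp
        have habs : Real.cos |z.re| + |z.re| * Real.sin |z.re| = 0 := by
          rw [hzR, cosAddMulSin_ofReal, Complex.ofReal_eq_zero] at hfz
          rw [Real.cos_abs]
          rcases abs_choice z.re with h | h
          · rw [h, hfz]
          · rw [h, Real.sin_neg, neg_mul_neg, hfz]
        have hpos : 0 < |z.re| := by
          refine abs_pos.mpr fun h0 ↦ ?_
          simp [h0] at habs
        obtain ⟨m, hm⟩ := hX_all _ hpos habs
        have hmN : m < N := by
          rw [hzR, Complex.norm_real, Real.norm_eq_abs, ← hm] at hz
          exact hX_mono.lt_iff_lt.mp hz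
        refine ⟨m + 1, by omega, ?_⟩
        rw [hzR]
        rcases abs_choice z.re with h | h
        · left
          rw [← h, ← hm]
          rfl
        · right
          rw [← neg_neg z.re, ← h, ← hm, Complex.ofReal_neg]
          rfl
    · intro z hz
      refine (norm_cosAddMulSin_le z).trans_eq ?_
      rw [hz]
      ring_nf
    · rw [mem_ball_zero_iff, Complex.norm_real, Real.norm_of_nonneg ht.le]
      linarith
    · rw [cosAddMulSin_ofReal]
      exact_mod_cast hft
  have hlim : Filter.Tendsto (fun N ↦ F - (2 * t * (1 / (α ^ 2 + t ^ 2))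
        + ∑ k ∈ Finset.range N, -2 * t * (1 / (X k ^ 2 - t ^ 2)))) Filter.atTop (nhds 0) := by
    refine squeeze_zero_norm' hbound ?_
    simpa using (tendsto_inv_atTop_zero.comp hXtop).const_mul (128 * t)
  rw [hasSum_iff_tendsto_nat_of_nonneg]
  · have h := (hlim.const_sub F).sub_const (2 * t * (1 / (α ^ 2 + t ^ 2)))
    have h' := h.div_const (-2 * t)
    refine (h'.congr fun N ↦ ?_).trans_eq ?_
    · rw [← Finset.mul_sum]
      field_simp
      ring
    · rw [hF]
      congr 1
      field_simp
      ring
  · intro k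
    have hXk : t < X k := htX.trans_le (hX_mono.monotone k.zero_le)
    exact one_div_nonneg.mpr (by nlinarith)

end PartialFractions

section Expansion

open Filter Topology Asymptotics

theorem one_div_sub_eq_sum_add {y s : ℝ} (hy : y ≠ 0) (hys : y - s ≠ 0) (n : ℕ) :
    1 / (y - s) = ∑ j ∈ Finset.range n, s ^ j * (1 / y ^ (j + 1)) + s ^ n / (y ^ n * (y - s)) := by
  induction n with
  | zero => simp
  | succ n ih =>
    rw [ih, Finset.sum_range_succ]
    field_simp
    ring

/-- Taylor expansion of `∑ 1 / (Y k - s)` at `s = 0`, with remainder. -/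
theorem abs_tsum_one_div_sub_sub_sum_le {Y : ℕ → ℝ} {c s : ℝ} (hc : 0 < c) (hY : ∀ k, c ≤ Y k)
    (hsum : ∀ p : ℕ, Summable fun k ↦ 1 / Y k ^ (p + 1)) (hs0 : 0 ≤ s) (hsc : s ≤ c / 2) (n : ℕ) :
    |∑' k, 1 / (Y k - s) - ∑ j ∈ Finset.range n, s ^ j * ∑' k, 1 / Y k ^ (j + 1)|
      ≤ 2 * (∑' k, 1 / Y k ^ (n + 1)) * s ^ n := by
  have hY0 : ∀ k, 0 < Y k := fun k ↦ hc.trans_le (hY k)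
  have hYs : ∀ k, Y k / 2 ≤ Y k - s := fun k ↦ by linarith [hY k]
  set e : ℕ → ℝ := fun k ↦ s ^ n / (Y k ^ n * (Y k - s)) with he
  have he0 : ∀ k, 0 ≤ e k := fun k ↦ by
    have := hY0 k
    have : 0 < Y k - s := by linarith [hYs k]
    positivity
  have hele : ∀ k, e k ≤ 2 * s ^ n * (1 / Y k ^ (n + 1)) := fun k ↦ by
    have h1 := hY0 k
    calc e k ≤ s ^ n / (Y k ^ n * (Y k / 2)) := by
          simp only [he]
          gcongr
          exact hYs k
      _ = _ := by
          field_simp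
          ring
  have hesum : Summable e := Summable.of_nonneg_of_le he0 hele ((hsum n).mul_left _)
  have hmain : ∑' k, 1 / (Y k - s)
      = ∑ j ∈ Finset.range n, s ^ j * ∑' k, 1 / Y k ^ (j + 1) + ∑' k, e k := by
    have h1 : HasSum (fun k ↦ ∑ j ∈ Finset.range n, s ^ j * (1 / Y k ^ (j + 1)))
        (∑ j ∈ Finset.range n, s ^ j * ∑' k, 1 / Y k ^ (j + 1)) :=
      hasSum_sum fun j _ ↦ (hsum j).hasSum.mul_left _
    rw [← (h1.add hesum.hasSum).tsum_eq]
    refine tsum_congr fun k ↦ one_div_sub_eq_sum_add (hY0 k).ne' ?_ n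
    have := hY0 k
    linarith [hYs k]
  rw [hmain, add_sub_cancel_left, abs_of_nonneg (tsum_nonneg he0)]
  calc ∑' k, e k ≤ ∑' k, 2 * s ^ n * (1 / Y k ^ (n + 1)) :=
        hesum.tsum_le_tsum hele ((hsum n).mul_left _)
    _ = _ := by rw [tsum_mul_left]; ring

/-- An even polynomial of degree less than `2 * n` that is `O(t ^ (2 * n))` at `0` vanishes. -/
theorem eq_zero_of_sum_mul_pow_isBigO (n : ℕ) (c : ℕ → ℝ)
    (h : (fun t : ℝ ↦ ∑ j ∈ Finset.range n, c j * t ^ (2 * j)) =O[𝓝[>] 0] fun t ↦ t ^ (2 * n)) :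
    ∀ j < n, c j = 0 := by
  induction n generalizing c with
  | zero => simp
  | succ n ih =>
    have hc0 : c 0 = 0 := by
      have h1 : Tendsto (fun t : ℝ ↦ ∑ j ∈ Finset.range (n + 1), c j * t ^ (2 * j)) (𝓝[>] 0)
          (𝓝 (c 0)) := by
        have hcont : Continuous fun t : ℝ ↦ ∑ j ∈ Finset.range (n + 1), c j * t ^ (2 * j) := by
          fun_prop
        have h2 := (hcont.tendsto 0).mono_left (nhdsWithin_le_nhds (s := Set.Ioi 0))
        simpa [Finset.sum_range_succ'] using h2
      have h2 : Tendsto (fun t : ℝ ↦ t ^ (2 * (n + 1))) (𝓝[>] 0) (𝓝 0) := by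
        have h3 := ((continuous_pow (2 * (n + 1))).tendsto (0 : ℝ)).mono_left
          (nhdsWithin_le_nhds (s := Set.Ioi 0))
        simpa using h3
      exact tendsto_nhds_unique h1 (h.trans_tendsto h2)
    have hrest := ih (fun j ↦ c (j + 1)) (by
      have h1 := h.mul (isBigO_refl (fun t : ℝ ↦ (t ^ 2)⁻¹) (𝓝[>] 0))
      refine (h1.congr' ?_ ?_)
      · filter_upwards [self_mem_nhdsWithin] with t ht
        have ht0 : t ≠ 0 := (Set.mem_Ioi.mp ht).ne'
        rw [Finset.sum_range_succ', hc0, zero_mul, add_zero, Finset.sum_mul]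
        refine Finset.sum_congr rfl fun j _ ↦ ?_
        rw [mul_add, pow_add, mul_one]
        field_simp
      · filter_upwards [self_mem_nhdsWithin] with t ht
        have ht0 : t ≠ 0 := (Set.mem_Ioi.mp ht).ne'
        rw [mul_add, pow_add, mul_one]
        field_simp)
    rintro (_ | j) hj
    · exact hc0
    · exact hrest j (by omega)

theorem norm_exp_mul_I_sub_taylor_le {t : ℝ} (ht : |t| ≤ 1) :
    ‖Complex.exp (t * Complex.I)
      - (((1 - t ^ 2 / 2 + t ^ 4 / 24 - t ^ 6 / 720 + t ^ 8 / 40320 : ℝ) : ℂ)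
        + ((t - t ^ 3 / 6 + t ^ 5 / 120 - t ^ 7 / 5040 + t ^ 9 / 362880 : ℝ) : ℂ) * Complex.I)‖
      ≤ |t| ^ 10 := by
  have hn : ‖(t : ℂ) * Complex.I‖ = |t| := by simp
  have h := Complex.exp_bound (x := t * Complex.I) (by rwa [hn]) (n := 10) (by norm_num)
  rw [hn] at h
  have h3 : Complex.I ^ 3 = -Complex.I := Complex.I_pow_three
  have h4 : Complex.I ^ 4 = 1 := Complex.I_pow_four
  have hsum : ∑ m ∈ Finset.range 10, ((t : ℂ) * Complex.I) ^ m / (m.factorial : ℂ)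
      = ((1 - t ^ 2 / 2 + t ^ 4 / 24 - t ^ 6 / 720 + t ^ 8 / 40320 : ℝ) : ℂ)
        + ((t - t ^ 3 / 6 + t ^ 5 / 120 - t ^ 7 / 5040 + t ^ 9 / 362880 : ℝ) : ℂ)
          * Complex.I := by
    simp only [Finset.sum_range_succ, Finset.sum_range_zero, mul_pow, Nat.factorial]
    rw [Complex.I_sq, h3, h4, show Complex.I ^ 5 = Complex.I by linear_combination Complex.I * h4,
      show Complex.I ^ 6 = -1 by linear_combination Complex.I ^ 2 * h4 + Complex.I_sq,
      show Complex.I ^ 7 = -Complex.I by linear_combination Complex.I ^ 3 * h4 + h3,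
      show Complex.I ^ 8 = 1 by linear_combination (Complex.I ^ 4 + 1) * h4,
      show Complex.I ^ 9 = Complex.I by
        linear_combination (Complex.I ^ 4 + 1) * Complex.I * h4]
    push_cast
    ring
  rw [hsum] at h
  refine h.trans (mul_le_of_le_one_right (by positivity) ?_)
  norm_num [Nat.factorial]

theorem cos_sub_taylor_isBigO :
    (fun t : ℝ ↦ Real.cos t - (1 - t ^ 2 / 2 + t ^ 4 / 24 - t ^ 6 / 720 + t ^ 8 / 40320))
      =O[𝓝 0] fun t ↦ t ^ 10 := by
  refine IsBigO.of_bound 1 ?_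
  filter_upwards [Metric.closedBall_mem_nhds (0 : ℝ) one_pos] with t ht
  have h := (Complex.abs_re_le_norm _).trans
    (norm_exp_mul_I_sub_taylor_le (by simpa using ht : |t| ≤ 1))
  rw [Complex.sub_re, Complex.exp_ofReal_mul_I_re] at h
  simpa only [Complex.add_re, Complex.ofReal_re, Complex.re_ofReal_mul, Complex.I_re, mul_zero,
    add_zero, norm_pow, Real.norm_eq_abs, one_mul] using h

theorem sin_sub_taylor_isBigO :
    (fun t : ℝ ↦ Real.sin t - (t - t ^ 3 / 6 + t ^ 5 / 120 - t ^ 7 / 5040 + t ^ 9 / 362880))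
      =O[𝓝 0] fun t ↦ t ^ 10 := by
  refine IsBigO.of_bound 1 ?_
  filter_upwards [Metric.closedBall_mem_nhds (0 : ℝ) one_pos] with t ht
  have h := (Complex.abs_im_le_norm _).trans
    (norm_exp_mul_I_sub_taylor_le (by simpa using ht : |t| ≤ 1))
  rw [Complex.sub_im, Complex.exp_ofReal_mul_I_im] at h
  simpa only [Complex.add_im, Complex.ofReal_im, Complex.im_ofReal_mul, Complex.I_im, mul_one,
    zero_add, norm_pow, Real.norm_eq_abs, one_mul] using h

theorem cos_add_mul_sin_sub_taylor_isBigO :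
    (fun t : ℝ ↦ Real.cos t + t * Real.sin t
      - (1 + t ^ 2 / 2 - t ^ 4 / 8 + t ^ 6 / 144 - t ^ 8 / 5760)) =O[𝓝 0] fun t ↦ t ^ 10 := by
  have hid : (fun t : ℝ ↦ t) =O[𝓝 0] fun _ ↦ (1 : ℝ) := continuous_id.continuousAt.isBigO_one ℝ
  have h1 := hid.mul sin_sub_taylor_isBigO
  have h2 := (isBigO_refl (fun t : ℝ ↦ t ^ 10) (𝓝 0)).const_mul_left (1 / 362880)
  simp only [one_mul] at h1
  refine ((cos_sub_taylor_isBigO.add h1).add h2).congr_left fun t ↦ ?_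
  ring

/-- Newton's identities for the Taylor coefficients of `cos t + t * sin t`. -/
theorem power_sums_of_isBigO {U : ℕ → ℝ}
    (hU : (fun t : ℝ ↦ Real.cos t + 2 * (Real.cos t + t * Real.sin t)
      * ∑ j ∈ Finset.range 5, (t ^ 2) ^ j * U (j + 1)) =O[𝓝[>] 0] fun t ↦ t ^ 10) :
    U 2 = 1 / 2 ∧ U 3 = -1 / 3 ∧ U 4 = 7 / 30 ∧ U 5 = -17 / 105 := by
  have hbdd : ∀ q : ℝ → ℝ, Continuous q → q =O[𝓝[>] 0] fun _ ↦ (1 : ℝ) := fun q hq ↦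
    (hq.continuousAt.isBigO_one ℝ).mono nhdsWithin_le_nhds
  have h1 := cos_sub_taylor_isBigO.mono (nhdsWithin_le_nhds (s := Set.Ioi 0))
  have h2 := (cos_add_mul_sin_sub_taylor_isBigO.mono (nhdsWithin_le_nhds (s := Set.Ioi 0))).mul
    (hbdd (fun t ↦ 2 * ∑ j ∈ Finset.range 5, (t ^ 2) ^ j * U (j + 1)) (by fun_prop))
  have h3 := (isBigO_refl (fun t : ℝ ↦ t ^ 10) (𝓝[>] 0)).mul
    (hbdd (fun t ↦ U 5 + 2 * (-U 4 / 8 + U 3 / 144 - U 2 / 5760)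
      + 2 * (-U 5 / 8 + U 4 / 144 - U 3 / 5760) * t ^ 2
      + 2 * (U 5 / 144 - U 4 / 5760) * t ^ 4 - U 5 / 2880 * t ^ 6) (by fun_prop))
  simp only [mul_one] at h2 h3
  have h4 := ((hU.sub h1).sub h2).sub h3
  set c : ℕ → ℝ := fun j ↦ match j with
    | 0 => 1 + 2 * U 1
    | 1 => -1 / 2 + 2 * (U 2 + U 1 / 2)
    | 2 => 1 / 24 + 2 * (U 3 + U 2 / 2 - U 1 / 8)
    | 3 => -1 / 720 + 2 * (U 4 + U 3 / 2 - U 2 / 8 + U 1 / 144)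
    | _ => 1 / 40320 + 2 * (U 5 + U 4 / 2 - U 3 / 8 + U 2 / 144 - U 1 / 5760) with hc
  have h5 := eq_zero_of_sum_mul_pow_isBigO 5 c (h4.congr_left fun t ↦ by
    simp only [Finset.sum_range_succ, Finset.sum_range_zero, hc]
    ring)
  have e0 := h5 0 (by norm_num)
  have e1 := h5 1 (by norm_num)
  have e2 := h5 2 (by norm_num)
  have e3 := h5 3 (by norm_num)
  have e4 := h5 4 (by norm_num)
  simp only [hc] at e0 e1 e2 e3 e4
  refine ⟨?_, ?_, ?_, ?_⟩ <;> linarith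

theorem hasSum_one_div_odd_pow {p : ℕ} {Z : ℝ}
    (hZ : HasSum (fun n : ℕ ↦ 1 / (n : ℝ) ^ (2 * p)) Z) :
    HasSum (fun n : ℕ ↦ 1 / (2 * (n : ℝ) + 1) ^ (2 * p)) (Z - Z / 4 ^ p) := by
  have heven : HasSum (fun n : ℕ ↦ 1 / ((2 * n : ℕ) : ℝ) ^ (2 * p)) (Z / 4 ^ p) := by
    have heq : (fun n : ℕ ↦ 1 / ((2 * n : ℕ) : ℝ) ^ (2 * p))
        = fun n : ℕ ↦ 1 / (n : ℝ) ^ (2 * p) / 4 ^ p := by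
      funext n
      rw [Nat.cast_mul, mul_pow, div_div, mul_comm, Nat.cast_two, pow_mul (2 : ℝ) 2 p]
      norm_num
    rw [heq]
    exact hZ.div_const _
  have hodd : Summable (fun n : ℕ ↦ 1 / ((2 * n + 1 : ℕ) : ℝ) ^ (2 * p)) :=
    hZ.summable.comp_injective (i := fun n : ℕ ↦ 2 * n + 1) fun a b h ↦ by simpa using h
  have h := (heven.even_add_odd (f := fun n : ℕ ↦ 1 / (n : ℝ) ^ (2 * p)) hodd.hasSum).unique hZ
  have h' := hodd.hasSum
  rw [eq_sub_iff_add_eq'.mpr h] at h'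
  simpa using h'

/-- Power sums of the reciprocals of the squared zeros of `cos z + z * sin z`. -/
theorem power_sums_one_div_sq {α : ℝ} {X : ℕ → ℝ}
    (hα_pos : 0 < α) (hα_eq : Real.cosh α = α * Real.sinh α)
    (hX_mono : StrictMono X) (hX_pos : ∀ m, 0 < X m)
    (hX_root : ∀ m, Real.cos (X m) + X m * Real.sin (X m) = 0)
    (hX_all : ∀ t : ℝ, 0 < t → Real.cos t + t * Real.sin t = 0 → ∃ m, X m = t) :
    ∃ U : ℕ → ℝ, (∀ p, p ≠ 0 → HasSum (fun k ↦ 1 / (X k ^ 2) ^ p) (U p - 1 / (-α ^ 2) ^ p)) ∧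
      U 2 = 1 / 2 ∧ U 3 = -1 / 3 ∧ U 4 = 7 / 30 ∧ U 5 = -17 / 105 := by
  have hPF := fun t ↦ hasSum_one_div_sq_sub_sq hα_pos hα_eq hX_mono hX_pos hX_root hX_all (t := t)
  have hX0 := hX_pos 0
  have hY : ∀ k, X 0 ^ 2 ≤ X k ^ 2 := fun k ↦ by
    gcongr
    exact hX_mono.monotone k.zero_le
  have hsum : ∀ p : ℕ, Summable fun k ↦ 1 / (X k ^ 2) ^ (p + 1) := by
    intro p
    have h1 := (hPF (X 0 / 2) (by linarith) (by linarith)).summable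
    refine Summable.of_nonneg_of_le (fun k ↦ by positivity) (fun k ↦ ?_)
      (h1.mul_left (1 / (X 0 ^ 2) ^ p))
    have hk := hY k
    have hd : 0 < X k ^ 2 - (X 0 / 2) ^ 2 := by nlinarith
    rw [div_mul_div_comm, one_mul, pow_succ]
    have := hX_pos k
    gcongr
    nlinarith
  set U : ℕ → ℝ := fun p ↦ ∑' k, 1 / (X k ^ 2) ^ p + 1 / (-α ^ 2) ^ p with hU
  refine ⟨U, fun p hp ↦ ?_, power_sums_of_isBigO ?_⟩
  · obtain ⟨q, rfl⟩ := Nat.exists_eq_succ_of_ne_zero hp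
    simpa [hU] using (hsum q).hasSum
  set B : ℝ := 2 * (∑' k, 1 / (X k ^ 2) ^ (5 + 1)) + 1 / α ^ 12
  have hmain : (fun t : ℝ ↦ ∑ j ∈ Finset.range 5, (t ^ 2) ^ j * U (j + 1)
      + Real.cos t / (2 * (Real.cos t + t * Real.sin t))) =O[𝓝[>] 0] fun t ↦ t ^ 10 := by
    refine IsBigO.of_bound B ?_
    filter_upwards [Ioo_mem_nhdsGT (show (0 : ℝ) < X 0 / 2 by linarith)] with t ht
    obtain ⟨ht0, ht1⟩ := ht
    have h1 := abs_tsum_one_div_sub_sub_sum_le (by positivity : 0 < X 0 ^ 2) hY hsum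
      (sq_nonneg t) (by nlinarith) 5
    rw [(hPF t ht0 (by linarith)).tsum_eq] at h1
    have h2 := one_div_sub_eq_sum_add (y := -α ^ 2) (s := t ^ 2) (by nlinarith) (by nlinarith) 5
    have h3 : |(t ^ 2) ^ 5 / ((-α ^ 2) ^ 5 * (-α ^ 2 - t ^ 2))| ≤ 1 / α ^ 12 * (t ^ 2) ^ 5 := by
      rw [show (-α ^ 2) ^ 5 * (-α ^ 2 - t ^ 2) = α ^ 10 * (α ^ 2 + t ^ 2) by ring,
        abs_of_nonneg (by positivity), one_div_mul_eq_div]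
      gcongr
      nlinarith [pow_pos hα_pos 10, mul_nonneg (pow_pos hα_pos 10).le (sq_nonneg t)]
    have h4 : 1 / (-α ^ 2 - t ^ 2) = -(1 / (α ^ 2 + t ^ 2)) := by
      rw [show -α ^ 2 - t ^ 2 = -(α ^ 2 + t ^ 2) by ring, div_neg]
    rw [h4] at h2
    have hsplit : ∑ j ∈ Finset.range 5, (t ^ 2) ^ j * U (j + 1)
        = ∑ j ∈ Finset.range 5, (t ^ 2) ^ j * ∑' k, 1 / (X k ^ 2) ^ (j + 1)
          + ∑ j ∈ Finset.range 5, (t ^ 2) ^ j * (1 / (-α ^ 2) ^ (j + 1)) := by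
      simp only [hU, mul_add, Finset.sum_add_distrib]
    rw [hsplit, Real.norm_eq_abs, Real.norm_eq_abs,
      abs_of_nonneg (by positivity : 0 ≤ t ^ 10), show t ^ 10 = (t ^ 2) ^ 5 by ring]
    rw [abs_le] at h1 h3 ⊢
    constructor <;> simp only [B, add_mul] <;> linarith [h1.1, h1.2, h3.1, h3.2]
  have hbdd : (fun t : ℝ ↦ 2 * (Real.cos t + t * Real.sin t)) =O[𝓝[>] 0] fun _ ↦ (1 : ℝ) := by
    have hcont : Continuous fun t : ℝ ↦ 2 * (Real.cos t + t * Real.sin t) := by fun_prop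
    exact (hcont.continuousAt.isBigO_one ℝ).mono nhdsWithin_le_nhds
  refine (hmain.mul hbdd).congr' ?_ (by simp)
  filter_upwards [Ioo_mem_nhdsGT hX0] with t ht
  have hft : Real.cos t + t * Real.sin t ≠ 0 := by
    intro h
    obtain ⟨m, hm⟩ := hX_all t ht.1 h
    linarith [hX_mono.monotone m.zero_le, ht.2]
  field_simp
  ring

end Expansion


/-- First values of the eigenvalue power sums `A p = ∑_n 1/λ_n^p`:
`A 2 = 1/24`, `A 3 = -1/240`, `A 4 = 41/40320`, `A 5 = -107/725760`.
Here `lam 0 = -4α²`, `lam (2m+1) = (2m+1)²π²`, `lam (2m+2) = 4 X m ²`. -/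
theorem first_values_of_A
    (α : ℝ) (hα_pos : 0 < α) (hα_eq : Real.cosh α = α * Real.sinh α)
    (X : ℕ → ℝ) (hX_mono : StrictMono X) (hX_pos : ∀ m, 0 < X m)
    (hX_root : ∀ m, Real.cos (X m) + X m * Real.sin (X m) = 0)
    (hX_all : ∀ t : ℝ, 0 < t → Real.cos t + t * Real.sin t = 0 → ∃ m, X m = t)
    (lam : ℕ → ℝ) (hlam0 : lam 0 = -4 * α ^ 2)
    (hlam_odd : ∀ m : ℕ, lam (2 * m + 1) = (2 * (m : ℝ) + 1) ^ 2 * Real.pi ^ 2)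
    (hlam_even : ∀ m : ℕ, lam (2 * m + 2) = 4 * (X m) ^ 2)
    (A : ℕ → ℝ) (hA : ∀ p : ℕ, A p = ∑' n : ℕ, 1 / (lam n) ^ p) :
    A 2 = 1 / 24 ∧ A 3 = -1 / 240 ∧ A 4 = 41 / 40320 ∧ A 5 = -107 / 725760 := by
  obtain ⟨U, hU, hU2, hU3, hU4, hU5⟩ :=
    power_sums_one_div_sq hα_pos hα_eq hX_mono hX_pos hX_root hX_all
  have hA' : ∀ p, p ≠ 0 → ∀ Z : ℝ,
      HasSum (fun n : ℕ ↦ 1 / (n : ℝ) ^ (2 * p)) (Real.pi ^ (2 * p) * Z) →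
      A p = U p / 4 ^ p + (Z - Z / 4 ^ p) := by
    intro p hp Z hZ
    have hodd : HasSum (fun m ↦ 1 / lam (2 * m + 1) ^ p) (Z - Z / 4 ^ p) := by
      have heq : (fun m ↦ 1 / lam (2 * m + 1) ^ p)
          = fun m : ℕ ↦ 1 / (2 * (m : ℝ) + 1) ^ (2 * p) / Real.pi ^ (2 * p) := by
        funext m
        rw [hlam_odd, mul_pow, ← pow_mul, ← pow_mul, div_div]
      have hval : Z - Z / 4 ^ p
          = (Real.pi ^ (2 * p) * Z - Real.pi ^ (2 * p) * Z / 4 ^ p) / Real.pi ^ (2 * p) := by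
        have := Real.pi_ne_zero
        rw [mul_div_assoc, ← mul_sub, mul_div_cancel_left₀ _ (pow_ne_zero _ this)]
      rw [heq, hval]
      exact (hasSum_one_div_odd_pow hZ).div_const _
    have heven : HasSum (fun m ↦ 1 / lam (2 * m + 1 + 1) ^ p)
        ((U p - 1 / (-α ^ 2) ^ p) / 4 ^ p) := by
      have heq : (fun m ↦ 1 / lam (2 * m + 1 + 1) ^ p)
          = fun m ↦ 1 / (X m ^ 2) ^ p / 4 ^ p := by
        funext m
        rw [hlam_even, mul_pow, div_div, mul_comm]
      rw [heq]
      exact (hU p hp).div_const _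
    have htail : HasSum (fun n ↦ 1 / lam (n + 1) ^ p) _ :=
      HasSum.even_add_odd (f := fun n ↦ 1 / lam (n + 1) ^ p) hodd heven
    have hfull := ((hasSum_nat_add_iff (f := fun n ↦ 1 / lam n ^ p) 1).mp htail).tsum_eq
    rw [hA, hfull, Finset.sum_range_one, hlam0,
      show (-4 * α ^ 2) ^ p = 4 ^ p * (-α ^ 2) ^ p by rw [← mul_pow]; ring]
    have : (-α ^ 2) ^ p ≠ 0 := pow_ne_zero _ (neg_ne_zero.mpr (pow_ne_zero 2 hα_pos.ne'))
    field_simp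
    ring
  have hb : bernoulli 4 = -1 / 30 ∧ bernoulli 6 = 1 / 42 ∧ bernoulli 8 = -1 / 30 ∧
      bernoulli 10 = 5 / 66 := by
    decide +kernel
  obtain ⟨hb4, hb6, hb8, hb10⟩ := hb
  refine ⟨?_, ?_, ?_, ?_⟩
  · rw [hA' 2 (by norm_num) (1 / 90), hU2]
    · norm_num
    · convert hasSum_zeta_nat (k := 2) (by norm_num) using 1
      norm_num [hb4, Nat.factorial]
      ring
  · rw [hA' 3 (by norm_num) (1 / 945), hU3]
    · norm_num
    · convert hasSum_zeta_nat (k := 3) (by norm_num) using 1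
      norm_num [hb6, Nat.factorial]
      ring
  · rw [hA' 4 (by norm_num) (1 / 9450), hU4]
    · norm_num
    · convert hasSum_zeta_nat (k := 4) (by norm_num) using 1
      norm_num [hb8, Nat.factorial]
      ring
  · rw [hA' 5 (by norm_num) (1 / 93555), hU5]
    · norm_num
    · convert hasSum_zeta_nat (k := 5) (by norm_num) using 1
      norm_num [hb10, Nat.factorial]
      ring
end

section
/- Let α be the unique positive real number satisfying cosh α = α·sinh α, let (x_m)_{m≥1} be the strictly increasing enumeration of the positive solutions of cos x + x·sin x = 0, define λ₀ = −4α², λ_{2m−1} = (2m−1)²π², λ_{2m} = 4x_m² for m ≥ 1, and set A_p = Σ_{n=0}^∞ 1/λ_n^p. Then for every integer m ≥ 2, −|A_{2m−1}|^{−1/(2m−1)} < λ₀ < −A_{2m}^{−1/(2m)}. -/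
theorem lt_five_quarters_of_cosh_eq_mul_sinh {α : ℝ}
    (h : Real.cosh α = α * Real.sinh α) : α < 5 / 4 := by
  by_contra! hα
  rw [Real.cosh_eq, Real.sinh_eq] at h
  have h1 : Real.exp α * Real.exp (-α) = 1 := by rw [← Real.exp_add]; simp
  have hexp : 3 < Real.exp α := by
    have h2 : Real.exp 1 * Real.exp (1 / 4) ≤ Real.exp α := by
      rw [← Real.exp_add]
      exact Real.exp_le_exp.2 (by linarith)
    have h3 := Real.add_one_le_exp (1 / 4 : ℝ)
    nlinarith [Real.exp_one_gt_d9]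
  have h4 : (α - 1) * Real.exp α ^ 2 = α + 1 := by
    linear_combination (-2 * Real.exp α) * h + (α + 1) * h1
  have h5 : 9 < Real.exp α ^ 2 := by nlinarith
  nlinarith [mul_pos (by linarith : 0 < α - 1) (sub_pos.2 h5)]

theorem half_odd_mul_pi_lt_of_cos_add_mul_sin_eq_zero {X : ℕ → ℝ} (hX_mono : StrictMono X)
    (hX_pos : ∀ m, 0 < X m) (hX_root : ∀ m, Real.cos (X m) + X m * Real.sin (X m) = 0) (m : ℕ) :
    (2 * (m : ℝ) + 1) * Real.pi / 2 < X m := by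
  induction m with
  | zero =>
    by_contra! h
    norm_num at h
    have hcos := Real.cos_nonneg_of_mem_Icc ⟨by linarith [hX_pos 0, Real.pi_pos], h⟩
    have hsin := Real.sin_pos_of_pos_of_lt_pi (hX_pos 0) (by linarith [Real.pi_pos])
    nlinarith [hX_root 0, mul_pos (hX_pos 0) hsin]
  | succ m ih =>
    have hderiv (x : ℝ) : HasDerivAt (fun t => Real.cos t + t * Real.sin t) (x * Real.cos x) x := by
      refine ((Real.hasDerivAt_cos x).add ((hasDerivAt_id' x).mul (Real.hasDerivAt_sin x))).congr_deriv ?_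
      ring
    obtain ⟨c, ⟨hc₁, hc₂⟩, hc⟩ := exists_hasDerivAt_eq_zero (hX_mono m.lt_succ_self)
      (by fun_prop) ((hX_root m).trans (hX_root (m + 1)).symm) fun x _ => hderiv x
    have hcos := (mul_eq_zero.1 hc).resolve_left ((hX_pos m).trans hc₁).ne'
    obtain ⟨k, hk⟩ := Real.cos_eq_zero_iff.1 hcos
    have hmk : (m : ℝ) < k := by nlinarith [Real.pi_pos]
    have hmk' : (m : ℝ) + 1 ≤ k := by
      have : (m : ℤ) < k := by exact_mod_cast hmk
      exact_mod_cast this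
    push_cast
    nlinarith [Real.pi_pos]

theorem div_pow_le_div_add_one_pow_four {L l : ℝ} {p k : ℕ} (hp : 3 ≤ p) (hL : 0 < L)
    (hL' : L ≤ 25 / 4) (hl : (2 * (k : ℝ) + 1) ^ 2 * 9 ≤ l) :
    (L / l) ^ p ≤ (25 / 36) ^ 3 * (1 / ((k : ℝ) + 1) ^ 4) := by
  have hk : (0 : ℝ) ≤ k := k.cast_nonneg
  have hl9 : 9 ≤ l := by nlinarith
  have hl0 : 0 < l := by linarith
  calc (L / l) ^ p ≤ (L / l) ^ 3 :=
        pow_le_pow_of_le_one (by positivity) ((div_le_one hl0).2 (by linarith)) hp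
    _ ≤ ((25 / 4) / ((2 * (k : ℝ) + 1) ^ 2 * 9)) ^ 3 := by gcongr
    _ = (25 / 36) ^ 3 * (1 / (2 * (k : ℝ) + 1) ^ 6) := by field_simp; norm_num
    _ ≤ _ := by
      gcongr
      calc ((k : ℝ) + 1) ^ 4 ≤ (2 * (k : ℝ) + 1) ^ 4 := by gcongr; linarith
        _ ≤ (2 * (k : ℝ) + 1) ^ 6 := pow_le_pow_right₀ (by linarith) (by norm_num)

theorem summable_div_pow_and_tsum_lt_one {L : ℝ} {l : ℕ → ℝ} {p : ℕ} (hp : 3 ≤ p) (hL : 0 < L)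
    (hL' : L ≤ 25 / 4) (hl_even : ∀ k : ℕ, (2 * (k : ℝ) + 1) ^ 2 * 9 ≤ l (2 * k))
    (hl_odd : ∀ k : ℕ, (2 * (k : ℝ) + 1) ^ 2 * 9 ≤ l (2 * k + 1)) :
    Summable (fun n => (L / l n) ^ p) ∧ ∑' n, (L / l n) ^ p < 1 := by
  have hzeta : HasSum (fun k : ℕ => (25 / 36 : ℝ) ^ 3 * (1 / ((k : ℝ) + 1) ^ 4))
      ((25 / 36) ^ 3 * (Real.pi ^ 4 / 90)) := by
    refine HasSum.mul_left _ ?_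
    simpa using (hasSum_nat_add_iff' 1).2 hasSum_zeta_four
  have hnonneg {k n : ℕ} (h : (2 * (k : ℝ) + 1) ^ 2 * 9 ≤ l n) : 0 ≤ (L / l n) ^ p := by
    have : 0 ≤ l n := le_trans (by positivity) h
    positivity
  have hle_even k := div_pow_le_div_add_one_pow_four hp hL hL' (hl_even k)
  have hle_odd k := div_pow_le_div_add_one_pow_four hp hL hL' (hl_odd k)
  have hs_even := Summable.of_nonneg_of_le (fun k => hnonneg (hl_even k)) hle_even hzeta.summable
  have hs_odd := Summable.of_nonneg_of_le (fun k => hnonneg (hl_odd k)) hle_odd hzeta.summable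
  have hsum := HasSum.even_add_odd (f := fun n => (L / l n) ^ p) hs_even.hasSum hs_odd.hasSum
  refine ⟨hsum.summable, ?_⟩
  rw [hsum.tsum_eq]
  have he := hs_even.tsum_le_tsum hle_even hzeta.summable
  have ho := hs_odd.tsum_le_tsum hle_odd hzeta.summable
  rw [hzeta.tsum_eq] at he ho
  have hpi : Real.pi ^ 4 < 3.15 ^ 4 := by gcongr; exact Real.pi_lt_d2
  norm_num at he ho hpi ⊢
  linarith


/-- Euler–Rayleigh bounds for the negative eigenvalue `λ₀ = -4α²`:
for every `m ≥ 2`, `-|A_{2m-1}|^{-1/(2m-1)} < λ₀ < -A_{2m}^{-1/(2m)}`,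
where `A p = ∑_n 1/λ_n^p`. (The powers are real powers.) -/
theorem euler_rayleigh_bounds_root_type
    (α : ℝ) (hα_pos : 0 < α) (hα_eq : Real.cosh α = α * Real.sinh α)
    (X : ℕ → ℝ) (hX_mono : StrictMono X) (hX_pos : ∀ m, 0 < X m)
    (hX_root : ∀ m, Real.cos (X m) + X m * Real.sin (X m) = 0)
    (hX_all : ∀ t : ℝ, 0 < t → Real.cos t + t * Real.sin t = 0 → ∃ m, X m = t)
    (lam : ℕ → ℝ) (hlam0 : lam 0 = -4 * α ^ 2)
    (hlam_odd : ∀ m : ℕ, lam (2 * m + 1) = (2 * (m : ℝ) + 1) ^ 2 * Real.pi ^ 2)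
    (hlam_even : ∀ m : ℕ, lam (2 * m + 2) = 4 * (X m) ^ 2)
    (A : ℕ → ℝ) (hA : ∀ p : ℕ, A p = ∑' n : ℕ, 1 / (lam n) ^ p)
    (m : ℕ) (hm : 2 ≤ m) :
    -(|A (2 * m - 1)| ^ (-(1 / (2 * (m : ℝ) - 1)))) < lam 0 ∧
      lam 0 < -(A (2 * m) ^ (-(1 / (2 * (m : ℝ))))) := by
  have hα : α < 5 / 4 := lt_five_quarters_of_cosh_eq_mul_sinh hα_eq
  obtain ⟨L, hL⟩ : ∃ L, L = 4 * α ^ 2 := ⟨_, rfl⟩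
  have hL0 : 0 < L := hL ▸ by positivity
  have hL' : L ≤ 25 / 4 := by nlinarith
  replace hlam0 : lam 0 = -L := by rw [hlam0, hL]; ring
  have hodd (k : ℕ) : (2 * (k : ℝ) + 1) ^ 2 * 9 ≤ lam (2 * k + 1) := by
    rw [hlam_odd]
    gcongr
    nlinarith [Real.pi_gt_three]
  have heven (k : ℕ) : (2 * (k : ℝ) + 1) ^ 2 * 9 ≤ lam (2 * k + 1 + 1) := by
    rw [hlam_even]
    have hX := half_odd_mul_pi_lt_of_cos_add_mul_sin_eq_zero hX_mono hX_pos hX_root k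
    have hX' : (2 * (k : ℝ) + 1) * 3 ≤ 2 * X k := by
      nlinarith [Real.pi_gt_three, (k.cast_nonneg : (0 : ℝ) ≤ k)]
    calc (2 * (k : ℝ) + 1) ^ 2 * 9 = ((2 * (k : ℝ) + 1) * 3) ^ 2 := by ring
      _ ≤ (2 * X k) ^ 2 := by gcongr
      _ = 4 * X k ^ 2 := by ring
  have hlam_pos (n : ℕ) : 0 < lam (n + 1) := by
    obtain ⟨k, rfl | rfl⟩ := n.even_or_odd'
    · exact lt_of_lt_of_le (by positivity) (hodd k)
    · exact lt_of_lt_of_le (by positivity) (heven k)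
  have key (p : ℕ) (hp : 3 ≤ p) :
      ∃ S, 0 < S ∧ S < 1 ∧ A p = (L ^ p)⁻¹ * ((-1) ^ p + S) := by
    obtain ⟨hs, hlt⟩ := summable_div_pow_and_tsum_lt_one hp hL0 hL'
      (l := fun n => lam (n + 1)) hodd heven
    have hterm (n : ℕ) : 1 / lam (n + 1) ^ p = (L ^ p)⁻¹ * (L / lam (n + 1)) ^ p := by
      rw [div_pow]
      field_simp
    have hpos (n : ℕ) : 0 < (L / lam (n + 1)) ^ p := pow_pos (div_pos hL0 (hlam_pos n)) p
    refine ⟨_, hs.tsum_pos (fun n => (hpos n).le) 0 (hpos 0), hlt, ?_⟩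
    rw [hA, Summable.tsum_eq_zero_add, hlam0, mul_add, ← tsum_mul_left]
    · simp only [hterm, one_div, ← inv_pow, inv_neg]
      rw [neg_pow, mul_comm]
    · refine (summable_nat_add_iff 1).1 ?_
      simpa only [hterm] using hs.mul_left _
  have hroot {p : ℕ} (hp : p ≠ 0) : ((L ^ p)⁻¹ : ℝ) ^ (-(1 / (p : ℝ))) = L := by
    rw [Real.rpow_neg (by positivity), Real.inv_rpow (by positivity), inv_inv, one_div,
      Real.pow_rpow_inv_natCast hL0.le hp]
  have hLp (p : ℕ) : 0 < (L ^ p)⁻¹ := by positivity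
  rw [hlam0]
  constructor <;> rw [neg_lt_neg_iff]
  · obtain ⟨S, hS0, hS1, hAS⟩ := key (2 * m - 1) (by omega)
    have hcast : 2 * (m : ℝ) - 1 = ((2 * m - 1 : ℕ) : ℝ) := by
      rw [Nat.cast_sub (by omega)]
      push_cast
      ring
    rw [Odd.neg_one_pow ⟨m - 1, by omega⟩] at hAS
    have habs : |A (2 * m - 1)| = (L ^ (2 * m - 1))⁻¹ * (1 - S) := by
      rw [hAS, abs_mul, abs_of_pos (hLp _), abs_of_neg (by linarith)]
      ring
    have hp : (0 : ℝ) < ((2 * m - 1 : ℕ) : ℝ) := by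
      exact_mod_cast (by omega : 0 < 2 * m - 1)
    rw [habs, hcast]
    conv_lhs => rw [← hroot (p := 2 * m - 1) (by omega)]
    refine Real.rpow_lt_rpow_of_neg (mul_pos (hLp _) (by linarith)) ?_
      (neg_lt_zero.2 (by positivity))
    exact mul_lt_of_lt_one_right (hLp _) (by linarith)
  · obtain ⟨S, hS0, -, hAS⟩ := key (2 * m) (by omega)
    have hcast : 2 * (m : ℝ) = ((2 * m : ℕ) : ℝ) := by push_cast; ring
    rw [(even_two_mul m).neg_one_pow] at hAS
    have hp : (0 : ℝ) < ((2 * m : ℕ) : ℝ) := by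
      exact_mod_cast (by omega : 0 < 2 * m)
    rw [hAS, hcast]
    conv_rhs => rw [← hroot (p := 2 * m) (by omega)]
    refine Real.rpow_lt_rpow_of_neg (hLp _) ?_ (neg_lt_zero.2 (by positivity))
    exact lt_mul_of_one_lt_right (hLp _) (by linarith)
end

section
/- Let α be the unique positive real number satisfying cosh α = α·sinh α, let (x_m)_{m≥1} be the strictly increasing enumeration of the positive solutions of cos x + x·sin x = 0, define λ₀ = −4α², λ_{2m−1} = (2m−1)²π², λ_{2m} = 4x_m² for m ≥ 1, and set A_p = Σ_{n=0}^∞ 1/λ_n^p. Then for every integer m ≥ 1, A_{2m}/A_{2m+1} < λ₀ < A_{2m−1}/A_{2m}. -/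
/-- The `m`-th positive zero of `cos x + x sin x` lies to the right of `(m + 1/2) π`. -/
theorem lt_of_root_cos_add_mul_sin (X : ℕ → ℝ) (hX_mono : StrictMono X) (hX_pos : ∀ m, 0 < X m)
    (hX_root : ∀ m, Real.cos (X m) + X m * Real.sin (X m) = 0) (m : ℕ) :
    ((m : ℝ) + 1 / 2) * Real.pi < X m := by
  induction m with
  | zero =>
    by_contra! h
    push_cast at h
    have hs := Real.sin_pos_of_pos_of_lt_pi (hX_pos 0) (by linarith [Real.pi_pos])
    have hc := Real.cos_nonneg_of_neg_pi_div_two_le_of_le (x := X 0)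
      (by linarith [Real.pi_pos, hX_pos 0]) (by linarith)
    linarith [mul_pos (hX_pos 0) hs, hX_root 0]
  | succ m ih =>
    have hd : ∀ x : ℝ, HasDerivAt (fun x => Real.cos x + x * Real.sin x) (x * Real.cos x) x := by
      intro x
      exact ((Real.hasDerivAt_cos x).add
        ((hasDerivAt_id' x).mul (Real.hasDerivAt_sin x))).congr_deriv (by ring)
    obtain ⟨c, ⟨hc1, hc2⟩, hc⟩ := exists_hasDerivAt_eq_zero (hX_mono (Nat.lt_succ_self m))
      (fun x _ => (hd x).continuousAt.continuousWithinAt)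
      ((hX_root m).trans (hX_root (m + 1)).symm) (fun x _ => hd x)
    have hcos : Real.cos c = 0 := by
      rcases mul_eq_zero.1 hc with h | h
      · linarith [hX_pos m]
      · exact h
    obtain ⟨k, hk⟩ := Real.cos_eq_zero_iff.1 hcos
    have hmk : (m : ℤ) < k := by
      by_contra! h
      have h' : (k : ℝ) ≤ m := by exact_mod_cast h
      nlinarith [Real.pi_pos]
    have hmk' : (m : ℝ) + 1 ≤ k := by exact_mod_cast hmk
    push_cast
    nlinarith [Real.pi_pos]

/-- An upper bound for the positive solution of `coth α = α`. -/
theorem lt_of_cosh_eq_mul_sinh (α : ℝ) (h : Real.cosh α = α * Real.sinh α) : α < 5 / 4 := by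
  by_contra! hα
  rw [Real.cosh_eq, Real.sinh_eq] at h
  have he : Real.exp α * Real.exp (-α) = 1 := by rw [← Real.exp_add]; simp
  have h9 : 9 < Real.exp α * Real.exp α := by
    have h1 : Real.exp α = Real.exp 1 * Real.exp (α - 1) := by rw [← Real.exp_add]; ring_nf
    have h2 := Real.exp_one_gt_d9
    have h3 := Real.add_one_le_exp (α - 1)
    have h4 : 3 < Real.exp α := by rw [h1]; nlinarith
    nlinarith
  have h5 : (α - 1) * (Real.exp α * Real.exp α) = α + 1 := by
    linear_combination (-2 * Real.exp α) * h + (α + 1) * he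
  nlinarith

theorem hasSum_one_div_add_one_sq :
    HasSum (fun k : ℕ => 1 / ((k : ℝ) + 1) ^ 2) (Real.pi ^ 2 / 6) := by
  have h := (hasSum_nat_add_iff' 1).2 hasSum_zeta_two
  simpa using h

/-- A bound for power sums of a sequence whose terms decay quadratically in pairs. -/
theorem summable_pow_and_tsum_le (r : ℕ → ℝ) (hr : ∀ n, 0 ≤ r n) (q : ℝ) (hq : 0 ≤ q)
    (h0 : ∀ k : ℕ, r (2 * k) ≤ q / ((k : ℝ) + 1) ^ 2)
    (h1 : ∀ k : ℕ, r (2 * k + 1) ≤ q / ((k : ℝ) + 1) ^ 2) (p : ℕ) (hp : 1 ≤ p) :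
    Summable (fun n => r n ^ p) ∧ ∑' n, r n ^ p ≤ q ^ p * (Real.pi ^ 2 / 3) := by
  have key : ∀ (x : ℝ) (k : ℕ), 0 ≤ x → x ≤ q / ((k : ℝ) + 1) ^ 2 →
      x ^ p ≤ q ^ p * (1 / ((k : ℝ) + 1) ^ 2) := by
    intro x k hx h
    have hk : (1 : ℝ) ≤ ((k : ℝ) + 1) ^ 2 :=
      one_le_pow₀ (by linarith [Nat.cast_nonneg (α := ℝ) k])
    calc x ^ p ≤ (q / ((k : ℝ) + 1) ^ 2) ^ p := pow_le_pow_left₀ hx h p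
      _ = q ^ p * (1 / (((k : ℝ) + 1) ^ 2) ^ p) := by rw [div_pow]; ring
      _ ≤ q ^ p * (1 / ((k : ℝ) + 1) ^ 2) := by
        have : ((k : ℝ) + 1) ^ 2 ≤ (((k : ℝ) + 1) ^ 2) ^ p := le_self_pow₀ hk (by omega)
        gcongr
  have hz := hasSum_one_div_add_one_sq.mul_left (q ^ p)
  have hs0 : Summable (fun k => r (2 * k) ^ p) :=
    Summable.of_nonneg_of_le (fun k => pow_nonneg (hr _) p)
      (fun k => key _ k (hr _) (h0 k)) hz.summable
  have hs1 : Summable (fun k => r (2 * k + 1) ^ p) :=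
    Summable.of_nonneg_of_le (fun k => pow_nonneg (hr _) p)
      (fun k => key _ k (hr _) (h1 k)) hz.summable
  have hS := HasSum.even_add_odd (f := fun n => r n ^ p) hs0.hasSum hs1.hasSum
  refine ⟨hS.summable, ?_⟩
  rw [hS.tsum_eq]
  have b0 := hasSum_le (fun k => key _ k (hr _) (h0 k)) hs0.hasSum hz
  have b1 := hasSum_le (fun k => key _ k (hr _) (h1 k)) hs1.hasSum hz
  linarith


/-- Euler–Rayleigh bounds for the negative eigenvalue `λ₀ = -4α²`:
for every `m ≥ 1`, `A_{2m}/A_{2m+1} < λ₀ < A_{2m-1}/A_{2m}`,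
where `A p = ∑_n 1/λ_n^p`. -/
theorem euler_rayleigh_bounds_ratio_type
    (α : ℝ) (hα_pos : 0 < α) (hα_eq : Real.cosh α = α * Real.sinh α)
    (X : ℕ → ℝ) (hX_mono : StrictMono X) (hX_pos : ∀ m, 0 < X m)
    (hX_root : ∀ m, Real.cos (X m) + X m * Real.sin (X m) = 0)
    (hX_all : ∀ t : ℝ, 0 < t → Real.cos t + t * Real.sin t = 0 → ∃ m, X m = t)
    (lam : ℕ → ℝ) (hlam0 : lam 0 = -4 * α ^ 2)
    (hlam_odd : ∀ m : ℕ, lam (2 * m + 1) = (2 * (m : ℝ) + 1) ^ 2 * Real.pi ^ 2)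
    (hlam_even : ∀ m : ℕ, lam (2 * m + 2) = 4 * (X m) ^ 2)
    (A : ℕ → ℝ) (hA : ∀ p : ℕ, A p = ∑' n : ℕ, 1 / (lam n) ^ p)
    (m : ℕ) (hm : 1 ≤ m) :
    A (2 * m) / A (2 * m + 1) < lam 0 ∧ lam 0 < A (2 * m - 1) / A (2 * m) := by
  set μ : ℝ := 4 * α ^ 2 with hμ
  have hμ0 : 0 < μ := by positivity
  have hα := lt_of_cosh_eq_mul_sinh α hα_eq
  have hμ1 : μ < 25 / 4 := by nlinarith
  have hpi := Real.pi_gt_d2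
  have hpi' := Real.pi_lt_d2
  have hodd : ∀ k : ℕ, ((k : ℝ) + 1) ^ 2 * Real.pi ^ 2 ≤ lam (2 * k + 1) := by
    intro k
    rw [hlam_odd]
    have := Nat.cast_nonneg (α := ℝ) k
    gcongr
    linarith
  have heven : ∀ k : ℕ, ((k : ℝ) + 1) ^ 2 * Real.pi ^ 2 ≤ lam (2 * k + 1 + 1) := by
    intro k
    rw [hlam_even]
    have hk := Nat.cast_nonneg (α := ℝ) k
    have hx := lt_of_root_cos_add_mul_sin X hX_mono hX_pos hX_root k
    have h2 : ((k : ℝ) + 1) * Real.pi ≤ 2 * X k := by nlinarith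
    calc ((k : ℝ) + 1) ^ 2 * Real.pi ^ 2 = (((k : ℝ) + 1) * Real.pi) ^ 2 := by ring
      _ ≤ (2 * X k) ^ 2 := by gcongr
      _ = 4 * X k ^ 2 := by ring
  have hlam_pos : ∀ n, 0 < lam (n + 1) := by
    intro n
    obtain ⟨k, rfl | rfl⟩ := Nat.even_or_odd' n
    · exact lt_of_lt_of_le (by positivity) (hodd k)
    · exact lt_of_lt_of_le (by positivity) (heven k)
  have hr : ∀ (x : ℝ) (k : ℕ), ((k : ℝ) + 1) ^ 2 * Real.pi ^ 2 ≤ x →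
      μ / x ≤ (16 / 25) / ((k : ℝ) + 1) ^ 2 := by
    intro x k hx
    have hk : 0 < ((k : ℝ) + 1) ^ 2 := by positivity
    rw [div_le_div_iff₀ (lt_of_lt_of_le (by positivity) hx) hk]
    have : μ ≤ 16 / 25 * Real.pi ^ 2 := by nlinarith
    nlinarith
  have hsum := summable_pow_and_tsum_le (fun n => μ / lam (n + 1))
    (fun n => (div_pos hμ0 (hlam_pos n)).le) (16 / 25) (by norm_num)
    (fun k => hr _ k (hodd k)) (fun k => hr _ k (heven k))
  -- `T p` is the contribution of the positive eigenvalues to `A p`, scaled by `μ ^ p`.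
  set T : ℕ → ℝ := fun p => ∑' n, (μ / lam (n + 1)) ^ p
  have hT0 : ∀ p, 1 ≤ p → 0 < T p := fun p hp =>
    (hsum p hp).1.tsum_pos (fun n => (pow_pos (div_pos hμ0 (hlam_pos n)) p).le) 0
      (pow_pos (div_pos hμ0 (hlam_pos 0)) p)
  have hlam0' : lam 0 = -μ := by rw [hlam0, hμ]; ring
  have hA' : ∀ p, 1 ≤ p → A p = ((-1) ^ p + T p) / μ ^ p := by
    intro p hp
    have hterm : ∀ n, 1 / lam (n + 1) ^ p = (μ / lam (n + 1)) ^ p / μ ^ p := by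
      intro n
      have := hlam_pos n
      rw [div_pow]
      field_simp
    have hs : Summable (fun n => 1 / lam (n + 1) ^ p) := by
      simp_rw [hterm]
      exact (hsum p hp).1.div_const _
    rw [hA, ((summable_nat_add_iff (f := fun n => 1 / lam n ^ p) 1).1 hs).tsum_eq_zero_add]
    simp_rw [hterm]
    rw [tsum_div_const, hlam0', neg_pow, add_div]
    congr 1
    rcases neg_one_pow_eq_or ℝ p with h | h <;> rw [h] <;> field_simp
  have hE := hA' (2 * m) (by omega)
  have hO := hA' (2 * m + 1) (by omega)
  have hO' := hA' (2 * m - 1) (by omega)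
  have tE := hT0 (2 * m) (by omega)
  have tO := hT0 (2 * m + 1) (by omega)
  have tO' := hT0 (2 * m - 1) (by omega)
  have tlt : T (2 * m + 1) < 1 := by
    have h1 := (hsum (2 * m + 1) (by omega)).2
    have h2 : (16 / 25 : ℝ) ^ (2 * m + 1) ≤ (16 / 25) ^ 3 :=
      pow_le_pow_of_le_one (by norm_num) (by norm_num) (by omega)
    have h3 : Real.pi ^ 2 / 3 < 3.31 := by nlinarith
    calc T (2 * m + 1) ≤ (16 / 25 : ℝ) ^ (2 * m + 1) * (Real.pi ^ 2 / 3) := h1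
      _ ≤ (16 / 25) ^ 3 * 3.31 := by gcongr
      _ < 1 := by norm_num
  rw [Even.neg_one_pow (even_two_mul m)] at hE
  rw [Odd.neg_one_pow ⟨m, rfl⟩] at hO
  rw [Odd.neg_one_pow ⟨m - 1, by omega⟩] at hO'
  have hμp : 0 < μ ^ (2 * m) := by positivity
  have hEpos : 0 < A (2 * m) := by rw [hE]; positivity
  have hOneg : A (2 * m + 1) < 0 := by
    rw [hO]
    exact div_neg_of_neg_of_pos (by linarith) (by positivity)
  rw [hlam0']
  constructor
  · rw [div_lt_iff_of_neg hOneg, hE, hO]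
    have : -μ * ((-1 + T (2 * m + 1)) / μ ^ (2 * m + 1)) = (1 - T (2 * m + 1)) / μ ^ (2 * m) := by
      rw [pow_succ]; field_simp; ring
    rw [this]
    gcongr
    linarith
  · rw [lt_div_iff₀ hEpos, hE, hO']
    have hp : μ ^ (2 * m) = μ ^ (2 * m - 1) * μ := by
      rw [← pow_succ]; congr 1; omega
    have : -μ * ((1 + T (2 * m)) / μ ^ (2 * m)) = (-1 - T (2 * m)) / μ ^ (2 * m - 1) := by
      rw [hp]; field_simp; ring
    rw [this]
    gcongr
    linarith
end

section
/- Let α be the unique positive real number satisfying cosh α = α·sinh α, set λ₀ = −4α², and define φ₀ : [0,1] → ℝ by φ₀(x) = cosh(2α·(x − 1/2)) (so φ₀(x) = cosh(√(−λ₀)·(x − 1/2))). Then −φ₀''(x) = λ₀·φ₀(x) for all x ∈ (0,1), and φ₀ satisfies the non-local boundary conditions φ₀(0) + φ₀(1) = −φ₀'(0) and φ₀(0) + φ₀(1) = φ₀'(1). -/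
/-- The derivative of `x ↦ cosh (c (x - a))`. -/
theorem deriv_cosh_const_mul_sub_const (c a : ℝ) :
    deriv (fun x : ℝ => Real.cosh (c * (x - a))) = fun x => c * Real.sinh (c * (x - a)) := by
  ext x
  have h : HasDerivAt (fun x : ℝ => c * (x - a)) (c * 1) x :=
    ((hasDerivAt_id x).sub_const a).const_mul c
  rw [h.cosh.deriv]
  ring

/-- The second derivative of `x ↦ cosh (c (x - a))`. -/
theorem deriv_deriv_cosh_const_mul_sub_const (c a : ℝ) :
    deriv (deriv fun x : ℝ => Real.cosh (c * (x - a))) =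
      fun x => c ^ 2 * Real.cosh (c * (x - a)) := by
  rw [deriv_cosh_const_mul_sub_const]
  ext x
  have h : HasDerivAt (fun x : ℝ => c * (x - a)) (c * 1) x :=
    ((hasDerivAt_id x).sub_const a).const_mul c
  rw [(h.sinh.const_mul c).deriv]
  ring

/-- The function `φ₀(x) = cosh(2α(x - 1/2))` is an eigenfunction of the
non-local boundary value problem with eigenvalue `λ₀ = -4α²`, where `α` is the
unique positive solution of `cosh α = α sinh α`:
`-φ₀'' = λ₀ φ₀` on `(0,1)` and `φ₀(0) + φ₀(1) = -φ₀'(0) = φ₀'(1)`. -/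
theorem negative_eigenfunction_solves_nonlocal_bvp
    (α : ℝ) (hα_pos : 0 < α) (hα_eq : Real.cosh α = α * Real.sinh α)
    (lam₀ : ℝ) (hlam₀ : lam₀ = -4 * α ^ 2)
    (φ₀ : ℝ → ℝ) (hφ₀ : ∀ x : ℝ, φ₀ x = Real.cosh (2 * α * (x - 1 / 2))) :
    (∀ x ∈ Set.Ioo (0 : ℝ) 1, -(deriv (deriv φ₀) x) = lam₀ * φ₀ x) ∧
    φ₀ 0 + φ₀ 1 = -(deriv φ₀ 0) ∧
    φ₀ 0 + φ₀ 1 = deriv φ₀ 1 := by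
  obtain rfl : φ₀ = fun x => Real.cosh (2 * α * (x - 1 / 2)) := funext hφ₀
  have h₀ : 2 * α * (0 - 1 / 2) = -α := by ring
  have h₁ : 2 * α * (1 - 1 / 2) = α := by ring
  refine ⟨fun x _ => ?_, ?_, ?_⟩
  · rw [deriv_deriv_cosh_const_mul_sub_const, hlam₀]
    ring
  all_goals
    simp only [deriv_cosh_const_mul_sub_const, h₀, h₁, Real.cosh_neg, Real.sinh_neg]
    linear_combination 2 * hα_eq
end

section
/- Let t > 0 be a real number satisfying cos t + t·sin t = 0 (equivalently cot t = −t), and define φ : [0,1] → ℝ by φ(x) = cos(2t·(x − 1/2)). Then −φ''(x) = 4t²·φ(x) for all x ∈ (0,1), and φ satisfies the non-local boundary conditions φ(0) + φ(1) = −φ'(0) and φ(0) + φ(1) = φ'(1). -/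
theorem hasDerivAt_two_mul_mul_sub_half (t x : ℝ) :
    HasDerivAt (fun y : ℝ => 2 * t * (y - 1 / 2)) (2 * t) x := by
  simpa only [id, mul_one] using ((hasDerivAt_id x).sub_const (1 / 2)).const_mul (2 * t)

/-- For every positive root `t` of `cos t + t sin t = 0` (equivalently
`cot t = -t`), the function `φ(x) = cos(2t(x - 1/2))` is an eigenfunction of
the non-local boundary value problem with eigenvalue `4t²`:
`-φ'' = 4t² φ` on `(0,1)` and `φ(0) + φ(1) = -φ'(0) = φ'(1)`. -/
theorem even_cosine_solves_nonlocal_bvp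
    (t : ℝ) (ht_pos : 0 < t) (ht_root : Real.cos t + t * Real.sin t = 0)
    (φ : ℝ → ℝ) (hφ : ∀ x : ℝ, φ x = Real.cos (2 * t * (x - 1 / 2))) :
    (∀ x ∈ Set.Ioo (0 : ℝ) 1, -(deriv (deriv φ) x) = 4 * t ^ 2 * φ x) ∧
    φ 0 + φ 1 = -(deriv φ 0) ∧
    φ 0 + φ 1 = deriv φ 1 := by
  obtain rfl : φ = fun x => Real.cos (2 * t * (x - 1 / 2)) := funext hφ
  have hderiv : deriv (fun x => Real.cos (2 * t * (x - 1 / 2))) =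
      fun x => -Real.sin (2 * t * (x - 1 / 2)) * (2 * t) :=
    funext fun x => (hasDerivAt_two_mul_mul_sub_half t x).cos.deriv
  have h₀ : 2 * t * (0 - 1 / 2) = -t := by ring
  have h₁ : 2 * t * (1 - 1 / 2) = t := by ring
  simp only [hderiv, h₀, h₁, Real.cos_neg, Real.sin_neg]
  refine ⟨fun x _ => ?_, by linarith, by linarith⟩
  have hderiv₂ : HasDerivAt (fun y => -Real.sin (2 * t * (y - 1 / 2)) * (2 * t))
      (-(Real.cos (2 * t * (x - 1 / 2)) * (2 * t)) * (2 * t)) x :=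
    (hasDerivAt_two_mul_mul_sub_half t x).sin.neg.mul_const (2 * t)
  rw [hderiv₂.deriv]
  ring
end

section
/- Let α be the unique positive real number satisfying cosh α = α·sinh α and let (x_m)_{m≥1} be the strictly increasing enumeration of the positive solutions of cos x + x·sin x = 0. Suppose λ is a real number and φ : [0,1] → ℝ is a twice continuously differentiable function, not identically zero, satisfying −φ''(x) = λ·φ(x) for all x ∈ (0,1) and the non-local boundary conditions φ(0)+φ(1) = −φ'(0) and φ(0)+φ(1) = φ'(1). Then either λ = −4α², or λ = (2m−1)²π² for some integer m ≥ 1, or λ = 4x_m² for some integer m ≥ 1. -/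
/-- A function that is continuous on `[a, b]` with zero derivative on `(a, b)` is constant. -/
lemma eq_left_of_hasDerivAt_zero_Ioo {f : ℝ → ℝ} {a b : ℝ} (hf : ContinuousOn f (Set.Icc a b))
    (hf' : ∀ x ∈ Set.Ioo a b, HasDerivAt f 0 x) {x : ℝ} (hx : x ∈ Set.Icc a b) : f x = f a := by
  rcases hx.1.eq_or_lt with rfl | hax
  · rfl
  obtain ⟨_, _, h⟩ := exists_hasDerivAt_eq_slope f (fun _ => 0) hax
    (hf.mono (Set.Icc_subset_Icc_right hx.2))
    (fun y hy => hf' y ⟨hy.1, hy.2.trans_le hx.2⟩)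
  rcases div_eq_zero_iff.mp h.symm with h | h <;> linarith

/-- The characteristic equation of the boundary value problem, in terms of the fundamental
solutions `c`, `s` of `-u'' = lam * u`, taken with base point at the midpoint of `[0, 1]`. -/
lemma characteristic_equation {lam : ℝ} {f g c s : ℝ → ℝ}
    (hc : ∀ x, HasDerivAt c (-lam * s x) x) (hs : ∀ x, HasDerivAt s (c x) x)
    (hcs : ∀ x, c x ^ 2 + lam * s x ^ 2 = 1)
    (hc_even : ∀ x, c (-x) = c x) (hs_odd : ∀ x, s (-x) = -s x)
    (hf : ContinuousOn f (Set.Icc 0 1)) (hg : ContinuousOn g (Set.Icc 0 1))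
    (hf' : ∀ x ∈ Set.Ioo (0 : ℝ) 1, HasDerivAt f (g x) x)
    (hg' : ∀ x ∈ Set.Ioo (0 : ℝ) 1, HasDerivAt g (-lam * f x) x)
    (hne : ∃ x ∈ Set.Icc (0 : ℝ) 1, f x ≠ 0)
    (h0 : f 0 + f 1 = -g 0) (h1 : f 0 + f 1 = g 1) :
    c (1 / 2) = 0 ∨ 2 * c (1 / 2) + lam * s (1 / 2) = 0 := by
  have hc' (x : ℝ) : HasDerivAt (fun y => c (y - 1 / 2)) (-lam * s (x - 1 / 2)) x :=
    (hc (x - 1 / 2)).comp_sub_const x (1 / 2)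
  have hs' (x : ℝ) : HasDerivAt (fun y => s (y - 1 / 2)) (c (x - 1 / 2)) x :=
    (hs (x - 1 / 2)).comp_sub_const x (1 / 2)
  have hc_cont : ContinuousOn (fun y => c (y - 1 / 2)) (Set.Icc 0 1) :=
    fun x _ => (hc' x).continuousAt.continuousWithinAt
  have hs_cont : ContinuousOn (fun y => s (y - 1 / 2)) (Set.Icc 0 1) :=
    fun x _ => (hs' x).continuousAt.continuousWithinAt
  obtain ⟨A, hA⟩ : ∃ A, ∀ x ∈ Set.Icc (0 : ℝ) 1,
      f x * c (x - 1 / 2) - g x * s (x - 1 / 2) = A :=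
    ⟨_, fun x hx => eq_left_of_hasDerivAt_zero_Ioo
      (f := fun x => f x * c (x - 1 / 2) - g x * s (x - 1 / 2))
      ((hf.mul hc_cont).sub (hg.mul hs_cont))
      (fun y hy => (((hf' y hy).mul (hc' y)).sub ((hg' y hy).mul (hs' y))).congr_deriv
        (by ring)) hx⟩
  obtain ⟨B, hB⟩ : ∃ B, ∀ x ∈ Set.Icc (0 : ℝ) 1,
      g x * c (x - 1 / 2) + f x * (lam * s (x - 1 / 2)) = B :=
    ⟨_, fun x hx => eq_left_of_hasDerivAt_zero_Ioo
      (f := fun x => g x * c (x - 1 / 2) + f x * (lam * s (x - 1 / 2)))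
      ((hg.mul hc_cont).add (hf.mul (hs_cont.const_mul lam)))
      (fun y hy => (((hg' y hy).mul (hc' y)).add
        ((hf' y hy).mul ((hs' y).const_mul lam))).congr_deriv (by ring)) hx⟩
  have hf_eq (x : ℝ) (hx : x ∈ Set.Icc (0 : ℝ) 1) :
      f x = A * c (x - 1 / 2) + B * s (x - 1 / 2) := by
    rw [← hA x hx, ← hB x hx]
    linear_combination -f x * hcs (x - 1 / 2)
  have hg_eq (x : ℝ) (hx : x ∈ Set.Icc (0 : ℝ) 1) :
      g x = -lam * A * s (x - 1 / 2) + B * c (x - 1 / 2) := by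
    rw [← hA x hx, ← hB x hx]
    linear_combination -g x * hcs (x - 1 / 2)
  have hleft : (0 : ℝ) - 1 / 2 = -(1 / 2) := by norm_num
  have hright : (1 : ℝ) - 1 / 2 = 1 / 2 := by norm_num
  have f0 := hf_eq 0 (by simp)
  have f1 := hf_eq 1 (by simp)
  have g0 := hg_eq 0 (by simp)
  have g1 := hg_eq 1 (by simp)
  rw [hleft, hc_even, hs_odd] at f0 g0
  rw [hright] at f1 g1
  have hBc : B * c (1 / 2) = 0 := by linear_combination (h0 - h1 - g0 - g1) / 2
  have hAc : A * (2 * c (1 / 2) + lam * s (1 / 2)) = 0 := by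
    linear_combination (h0 + h1 + g1 - g0) / 2 - f0 - f1
  rcases mul_eq_zero.mp hBc with hB0 | h
  · rcases mul_eq_zero.mp hAc with hA0 | h
    · obtain ⟨x, hx, hfx⟩ := hne
      exact absurd (by rw [hf_eq x hx, hA0, hB0]; ring) hfx
    · exact Or.inr h
  · exact Or.inl h

/-- The equation `cosh x = x * sinh x` has at most one positive solution. -/
lemma eq_of_cosh_eq_mul_sinh_s19 {x y : ℝ} (hx : 0 < x) (hy : 0 < y)
    (hx' : Real.cosh x = x * Real.sinh x) (hy' : Real.cosh y = y * Real.sinh y) : x = y := by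
  wlog hxy : x ≤ y generalizing x y
  · exact (this hy hx hy' hx' (le_of_not_ge hxy)).symm
  by_contra hne
  have hlt : x < y := lt_of_le_of_ne hxy hne
  have hsub : 0 < Real.sinh (y - x) := Real.sinh_pos_iff.mpr (sub_pos.mpr hlt)
  rw [Real.sinh_sub] at hsub
  have hpos : 0 < Real.cosh y * Real.sinh x :=
    mul_pos (Real.cosh_pos y) (Real.sinh_pos_iff.mpr hx)
  have heq : y * (Real.sinh y * Real.cosh x) = x * (Real.cosh y * Real.sinh x) := by
    linear_combination Real.cosh y * hx' - Real.cosh x * hy'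
  nlinarith [mul_pos hy hsub, mul_pos (sub_pos.mpr hlt) hpos]

/-- Completeness of the spectrum of the non-local boundary value problem:
if `φ` is a nonzero `C²` solution of `-φ'' = λ φ` on `(0,1)` with the
non-local boundary conditions `φ(0)+φ(1) = -φ'(0) = φ'(1)`, then either
`λ = -4α²`, or `λ = (2m-1)²π²` for some `m ≥ 1`, or `λ = 4 x_m²` for some
`m ≥ 1`. Here `α` is the unique positive solution of `cosh α = α sinh α` and
`X 0 < X 1 < ⋯` enumerates the positive roots of `cos t + t sin t = 0`
(so `X m` is the classical `x_{m+1}`). -/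
theorem spectrum_of_nonlocal_bvp
    (α : ℝ) (hα_pos : 0 < α) (hα_eq : Real.cosh α = α * Real.sinh α)
    (X : ℕ → ℝ) (hX_mono : StrictMono X) (hX_pos : ∀ m, 0 < X m)
    (hX_root : ∀ m, Real.cos (X m) + X m * Real.sin (X m) = 0)
    (hX_all : ∀ t : ℝ, 0 < t → Real.cos t + t * Real.sin t = 0 → ∃ m, X m = t)
    (lam : ℝ) (φ : ℝ → ℝ)
    (hφ_smooth : ContDiffOn ℝ 2 φ (Set.Icc 0 1))
    (hφ_ne : ∃ x ∈ Set.Icc (0 : ℝ) 1, φ x ≠ 0)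
    (hφ_ode : ∀ x ∈ Set.Ioo (0 : ℝ) 1,
      -(derivWithin (derivWithin φ (Set.Icc 0 1)) (Set.Icc 0 1) x) = lam * φ x)
    (hφ_bc1 : φ 0 + φ 1 = -(derivWithin φ (Set.Icc 0 1) 0))
    (hφ_bc2 : φ 0 + φ 1 = derivWithin φ (Set.Icc 0 1) 1) :
    lam = -4 * α ^ 2 ∨
    (∃ m : ℕ, 1 ≤ m ∧ lam = (2 * (m : ℝ) - 1) ^ 2 * Real.pi ^ 2) ∨
    (∃ m : ℕ, lam = 4 * (X m) ^ 2) := by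
  have hφ_diff : DifferentiableOn ℝ φ (Set.Icc 0 1) := hφ_smooth.differentiableOn (by norm_num)
  have hφ'_smooth : ContDiffOn ℝ 1 (derivWithin φ (Set.Icc 0 1)) (Set.Icc 0 1) :=
    hφ_smooth.derivWithin (uniqueDiffOn_Icc zero_lt_one) (by norm_num)
  have hφ'_diff := hφ'_smooth.differentiableOn one_ne_zero
  have key {c s : ℝ → ℝ} (hc : ∀ x, HasDerivAt c (-lam * s x) x)
      (hs : ∀ x, HasDerivAt s (c x) x) (hcs : ∀ x, c x ^ 2 + lam * s x ^ 2 = 1)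
      (hc_even : ∀ x, c (-x) = c x) (hs_odd : ∀ x, s (-x) = -s x) :
      c (1 / 2) = 0 ∨ 2 * c (1 / 2) + lam * s (1 / 2) = 0 := by
    refine characteristic_equation hc hs hcs hc_even hs_odd hφ_diff.continuousOn
      hφ'_diff.continuousOn (fun x hx => ?_) (fun x hx => ?_) hφ_ne hφ_bc1 hφ_bc2
    · exact (hφ_diff x (Set.Ioo_subset_Icc_self hx)).hasDerivWithinAt.hasDerivAt
        (Icc_mem_nhds hx.1 hx.2)
    · exact ((hφ'_diff x (Set.Ioo_subset_Icc_self hx)).hasDerivWithinAt.hasDerivAt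
        (Icc_mem_nhds hx.1 hx.2)).congr_deriv (by linarith [hφ_ode x hx])
  rcases lt_trichotomy lam 0 with hneg | rfl | hpos
  · left
    obtain ⟨k, hk, rfl⟩ : ∃ k : ℝ, 0 < k ∧ lam = -4 * k ^ 2 :=
      ⟨√(-lam / 4), Real.sqrt_pos.mpr (by linarith), by
        rw [Real.sq_sqrt (by linarith)]; ring⟩
    have hmul (x : ℝ) : HasDerivAt (fun y : ℝ => 2 * k * y) (2 * k) x := by
      simpa using (hasDerivAt_id x).const_mul (2 * k)
    have h := key (c := fun x => Real.cosh (2 * k * x))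
      (s := fun x => Real.sinh (2 * k * x) / (2 * k))
      (fun x => (hmul x).cosh.congr_deriv (by field_simp; ring))
      (fun x => ((hmul x).sinh.div_const (2 * k)).congr_deriv (by field_simp))
      (fun x => by
        field_simp
        linear_combination 4 * Real.cosh_sq (2 * k * x))
      (fun x => by simp) (fun x => by simp [neg_div])
    have harg : 2 * k * (1 / 2) = k := by ring
    simp only [harg] at h
    rcases h with h | h
    · exact absurd h (Real.cosh_pos k).ne'
    · have hk' : Real.cosh k = k * Real.sinh k := by
        field_simp at h
        linarith
      rw [eq_of_cosh_eq_mul_sinh_s19 hk hα_pos hk' hα_eq]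
  · have h := key (c := fun _ => 1) (s := fun x => x)
      (fun x => by simpa using hasDerivAt_const x (1 : ℝ)) (fun x => hasDerivAt_id x)
      (fun x => by ring) (fun _ => rfl) (fun _ => rfl)
    norm_num at h
  · right
    obtain ⟨k, hk, rfl⟩ : ∃ k : ℝ, 0 < k ∧ lam = 4 * k ^ 2 :=
      ⟨√(lam / 4), Real.sqrt_pos.mpr (by linarith), by
        rw [Real.sq_sqrt (by linarith)]; ring⟩
    have hmul (x : ℝ) : HasDerivAt (fun y : ℝ => 2 * k * y) (2 * k) x := by
      simpa using (hasDerivAt_id x).const_mul (2 * k)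
    have h := key (c := fun x => Real.cos (2 * k * x))
      (s := fun x => Real.sin (2 * k * x) / (2 * k))
      (fun x => (hmul x).cos.congr_deriv (by field_simp; ring))
      (fun x => ((hmul x).sin.div_const (2 * k)).congr_deriv (by field_simp))
      (fun x => by
        field_simp
        linear_combination 4 * Real.cos_sq_add_sin_sq (2 * k * x))
      (fun x => by simp) (fun x => by simp [neg_div])
    have harg : 2 * k * (1 / 2) = k := by ring
    simp only [harg] at h
    rcases h with h | h
    · left
      obtain ⟨n, hn⟩ := Real.cos_eq_zero_iff.mp h
      have hn0 : 0 ≤ n := by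
        by_contra! hlt
        have hle : (n : ℝ) ≤ -1 := by exact_mod_cast Int.le_sub_one_of_lt hlt
        nlinarith [Real.pi_pos]
      lift n to ℕ using hn0
      refine ⟨n + 1, by omega, ?_⟩
      rw [hn]
      push_cast
      ring
    · right
      have hk' : Real.cos k + k * Real.sin k = 0 := by
        field_simp at h
        linarith
      obtain ⟨m, hm⟩ := hX_all k hk hk'
      exact ⟨m, by rw [hm]⟩
end
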